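/- Let Ω be a bounded domain of ℝⁿ, n ≥ 2, let p > 1, a ≥ 0 and b ∈ ℝ. Suppose the weighted Poincaré inequality (P_{p,a,b}) holds on Ω. Then for any fixed closed cube Q compactly contained in Ω there exists a constant C = C(p,a,b,Ω,Q) > 0 such that for every vector field v ∈ W^{1,p}(Ω,ρ^a)ⁿ one has ∫_Ω |Dv(x)|^p ρ(x)^a dx ≤ C { ∫_Ω |ε(v)(x)|^p ρ(x)^{b−p} dx + ∫_Q |Dv(x)|^p ρ(x)^a dx }. -/

import Mathlib

open MeasureTheory Set Filter
open scoped ENNReal NNReal Topology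

noncomputable section

abbrev Evec (n : ℕ) := EuclideanSpace ℝ (Fin n)

/-- `ρ(x) = dist(x, ∂Ω)`, the distance to the boundary of `Ω`. -/
def bdist {n : ℕ} (Ω : Set (Evec n)) (x : Evec n) : ℝ := Metric.infDist x (frontier Ω)

/-- A bounded domain: open, connected and bounded. -/
def IsBoundedDomain {n : ℕ} (Ω : Set (Evec n)) : Prop :=
  IsOpen Ω ∧ IsConnected Ω ∧ Bornology.IsBounded Ω

/-- A closed cube in `ℝⁿ`. -/
def IsClosedCube {n : ℕ} (Q : Set (Evec n)) : Prop :=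
  ∃ (c : Evec n) (r : ℝ), 0 < r ∧ Q = {x : Evec n | ∀ i, |x i - c i| ≤ r}

/-- The weighted `p`-energy `∫_S |g(x)|^p ρ(x)^a dx`, where `ρ` is the distance
to the boundary of `Ω`. -/
def wIp {n : ℕ} (Ω S : Set (Evec n)) (p a : ℝ) (g : Evec n → ℝ) : ℝ≥0∞ :=
  ∫⁻ x in S, ENNReal.ofReal (|g x| ^ p * bdist Ω x ^ a)

/-- The weighted `L^p(S, ρ^a)` norm `(∫_S |g(x)|^p ρ(x)^a dx)^{1/p}`. -/
def wLp {n : ℕ} (Ω S : Set (Evec n)) (p a : ℝ) (g : Evec n → ℝ) : ℝ≥0∞ :=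
  wIp Ω S p a g ^ (1 / p)

/-- The weighted average `u_{Ω,a} = (∫_Ω ρ^a)⁻¹ ∫_Ω u ρ^a`. -/
def wAvg {n : ℕ} (Ω : Set (Evec n)) (a : ℝ) (u : Evec n → ℝ) : ℝ :=
  (∫ x in Ω, bdist Ω x ^ a)⁻¹ * ∫ x in Ω, u x * bdist Ω x ^ a

/-- `|∇u(x)|` for a scalar function `u`. -/
def gradLen {n : ℕ} (u : Evec n → ℝ) (x : Evec n) : ℝ := ‖fderiv ℝ u x‖

/-- The entry `∂v_i/∂x_j (x)` of the gradient matrix `Dv`. -/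
def pder {n : ℕ} (v : Evec n → Evec n) (i j : Fin n) (x : Evec n) : ℝ :=
  fderiv ℝ v x (EuclideanSpace.single j 1) i

/-- `|Dv(x)|`, the (Frobenius) norm of the gradient matrix of a vector field `v`. -/
def DvLen {n : ℕ} (v : Evec n → Evec n) (x : Evec n) : ℝ :=
  Real.sqrt (∑ i, ∑ j, pder v i j x ^ 2)

/-- `|ε(v)(x)|`, the norm of the symmetric part `ε_{ij}(v) = (∂v_i/∂x_j + ∂v_j/∂x_i)/2`
of the gradient matrix. -/
def epsLen {n : ℕ} (v : Evec n → Evec n) (x : Evec n) : ℝ :=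
  Real.sqrt (∑ i, ∑ j, ((pder v i j x + pder v j i x) / 2) ^ 2)

/-- `u ∈ W^{1,p}(Ω, ρ^a, ρ^b)` (scalar case). -/
def MemW1 {n : ℕ} (Ω : Set (Evec n)) (p a b : ℝ) (u : Evec n → ℝ) : Prop :=
  DifferentiableOn ℝ u Ω ∧ wIp Ω Ω p a u < ⊤ ∧ wIp Ω Ω p b (gradLen u) < ⊤

/-- `v ∈ W^{1,p}(Ω, ρ^a, ρ^b)ⁿ` (vector case). -/
def MemW1Vec {n : ℕ} (Ω : Set (Evec n)) (p a b : ℝ) (v : Evec n → Evec n) : Prop :=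
  DifferentiableOn ℝ v Ω ∧ wIp Ω Ω p a (fun x => ‖v x‖) < ⊤ ∧ wIp Ω Ω p b (DvLen v) < ⊤

/-- The weighted Poincaré inequality `(P_{p,a,b})`: there is `C > 0` such that
`∫_Ω |u - u_{Ω,a}|^p ρ^a ≤ C ∫_Ω |∇u|^p ρ^b` for all `u ∈ W^{1,p}(Ω,ρ^a,ρ^b)`. -/
def PoincareIneq {n : ℕ} (Ω : Set (Evec n)) (p a b : ℝ) : Prop :=
  ∃ C > 0, ∀ u : Evec n → ℝ, MemW1 Ω p a b u →
    wIp Ω Ω p a (fun x => u x - wAvg Ω a u) ≤ ENNReal.ofReal C * wIp Ω Ω p b (gradLen u)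

/-- `f` is everywhere differentiable with derivative `f'`, and `f''` is the second derivative
of `f` at `0`. -/
structure HasSecondDeriv (f f' : ℝ → ℝ) (f'' : ℝ) : Prop where
  fst : ∀ t, HasDerivAt f (f' t) t
  snd : HasDerivAt f' f'' 0

namespace HasSecondDeriv

variable {f f' g g' : ℝ → ℝ} {f'' g'' : ℝ}

lemma add (hf : HasSecondDeriv f f' f'') (hg : HasSecondDeriv g g' g'') :
    HasSecondDeriv (fun t => f t + g t) (fun t => f' t + g' t) (f'' + g'') :=
  ⟨fun t => (hf.fst t).add (hg.fst t), hf.snd.add hg.snd⟩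

lemma const_mul (c : ℝ) (hf : HasSecondDeriv f f' f'') :
    HasSecondDeriv (fun t => c * f t) (fun t => c * f' t) (c * f'') :=
  ⟨fun t => (hf.fst t).const_mul c, hf.snd.const_mul c⟩

lemma mul (hf : HasSecondDeriv f f' f'') (hg : HasSecondDeriv g g' g'') :
    HasSecondDeriv (fun t => f t * g t) (fun t => f' t * g t + f t * g' t)
      (f'' * g 0 + 2 * f' 0 * g' 0 + f 0 * g'') :=
  ⟨fun t => (hf.fst t).mul (hg.fst t), 
    ((hf.snd.mul (hg.fst 0)).add ((hf.fst 0).mul hg.snd)).congr_deriv (by ring)⟩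

lemma rpow (r : ℝ) (hpos : ∀ t, 0 < f t) (hf : HasSecondDeriv f f' f'') :
    HasSecondDeriv (fun t => f t ^ r) (fun t => f' t * r * f t ^ (r - 1))
      (r * (r - 1) * f 0 ^ (r - 2) * f' 0 ^ 2 + r * f 0 ^ (r - 1) * f'') :=
  ⟨fun t => (hf.fst t).rpow_const (Or.inl (hpos t).ne'), 
    ((hf.snd.mul_const r).mul
      ((hf.fst 0).rpow_const (p := r - 1) (Or.inl (hpos 0).ne'))).congr_deriv (by
        rw [show r - 1 - 1 = r - 2 by ring]; ring)⟩

lemma sq_add (u α κ : ℝ) :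
    HasSecondDeriv (fun t => (u + t * α) ^ 2 + κ) (fun t => 2 * (u + t * α) * α) (2 * α ^ 2) := by
  refine ⟨fun t => ?_, ?_⟩
  · have h := ((((hasDerivAt_id t).mul_const α).const_add u).pow 2).add_const κ
    exact h.congr_deriv (by simp)
  · have h := ((((hasDerivAt_id (0:ℝ)).mul_const α).const_add u).const_mul 2).mul_const α
    exact h.congr_deriv (by ring)

end HasSecondDeriv

/-- The second derivative of `Q` along a line, computed from a one-variable formula. -/
lemma HasSecondDeriv.eq_fderiv_fderiv {F : Type*} [NormedAddCommGroup F] [NormedSpace ℝ F]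
    {Q : F → ℝ} (hQ : ContDiff ℝ 2 Q) {z h : F} {f' : ℝ → ℝ} {f'' : ℝ}
    (H : HasSecondDeriv (fun t => Q (z + t • h)) f' f'') :
    fderiv ℝ (fderiv ℝ Q) z h h = f'' := by
  have hline : ∀ t : ℝ, HasDerivAt (fun t : ℝ => z + t • h) h t := fun t => by
    simpa using ((hasDerivAt_id t).smul_const h).const_add z
  have h1 : ∀ t, fderiv ℝ Q (z + t • h) h = f' t := fun t => by
    have h2 : HasDerivAt (fun t : ℝ => Q (z + t • h)) (fderiv ℝ Q (z + t • h) h) t :=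
      HasFDerivAt.comp_hasDerivAt t
        ((hQ.differentiable (by norm_num)) (z + t • h)).hasFDerivAt (hline t)
    exact h2.unique (H.fst t)
  have hd : DifferentiableAt ℝ (fderiv ℝ Q) (z + (0:ℝ) • h) :=
    ((hQ.fderiv_right (m := 1) (by norm_num)).differentiable (by norm_num)) _
  have h3 : HasDerivAt (fun t : ℝ => fderiv ℝ Q (z + t • h))
      (fderiv ℝ (fderiv ℝ Q) (z + (0:ℝ) • h) h) 0 :=
    HasFDerivAt.comp_hasDerivAt 0 hd.hasFDerivAt (hline 0)
  have h4 : HasDerivAt (fun t : ℝ => fderiv ℝ Q (z + t • h) h)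
      (fderiv ℝ (fderiv ℝ Q) (z + (0:ℝ) • h) h h) 0 :=
    ((ContinuousLinearMap.apply ℝ ℝ h).hasFDerivAt).comp_hasDerivAt 0 h3
  simp only [h1] at h4
  have h5 := h4.unique H.snd
  rwa [zero_smul, add_zero] at h5

set_option maxHeartbeats 800000 in
/-- The Hessian estimate behind the Bellman function. -/
lemma bellman_hessian {p q κ : ℝ} (hp : 2 ≤ p) (hpq : p.HolderConjugate q) (hκ : 0 < κ)
    (u w α β : ℝ) :
    let L := u ^ 2 + κ
    let m := w ^ 2 + κ
    let S := m + L ^ (p - 1)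
    let θ := 1 - q / 2
    let L1 := 2 * u * α
    let m1 := 2 * w * β
    let S1 := m1 + L1 * (p - 1) * L ^ (p - 1 - 1)
    let S2 := 2 * β ^ 2 + ((p - 1) * (p - 1 - 1) * L ^ (p - 1 - 2) * L1 ^ 2
      + (p - 1) * L ^ (p - 1 - 1) * (2 * α ^ 2))
    S ^ θ * α ^ 2 + (S ^ θ)⁻¹ * β ^ 2 ≤
      8 * (p - 1) ^ 2 * (p / 2 * (p / 2 - 1) * L ^ (p / 2 - 2) * L1 ^ 2
        + p / 2 * L ^ (p / 2 - 1) * (2 * α ^ 2))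
      + 25 / (q * (q - 1)) * (q / 2 * (q / 2 - 1) * m ^ (q / 2 - 2) * m1 ^ 2
        + q / 2 * m ^ (q / 2 - 1) * (2 * β ^ 2))
      + (2 * α ^ 2 * S ^ θ + 2 * L1 * (S1 * θ * S ^ (θ - 1))
        + L * (θ * (θ - 1) * S ^ (θ - 2) * S1 ^ 2 + θ * S ^ (θ - 1) * S2)) := by
  intro L m S θ L1 m1 S1 S2
  have hq1 : 1 < q := hpq.symm.lt
  have hrel : (p - 1) * (q - 1) = 1 := by nlinarith [hpq.mul_eq_add]
  have hq2 : q ≤ 2 := by nlinarith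
  have hθ0 : 0 ≤ θ := by simp only [θ]; linarith
  have hθ1 : θ ≤ 1 / 2 := by simp only [θ]; linarith
  have hL : 0 < L := by positivity
  have hm : 0 < m := by positivity
  have hLp : 0 < L ^ (p - 1) := by positivity
  have hS : 0 < S := by positivity
  have hmS : m ≤ S := by simp only [S]; linarith
  have hLS : L ^ (p - 1) ≤ S := by simp only [S]; linarith
  have huL : u ^ 2 ≤ L := by simp only [L]; linarith
  have hwm : w ^ 2 ≤ m := by simp only [m]; linarith
  have hθ : θ = 1 - q / 2 := rfl
  clear_value L m S θ
  have eL : L ≤ S ^ (q - 1) := by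
    calc L = (L ^ (p - 1)) ^ (q - 1) := by rw [← Real.rpow_mul hL.le, hrel, Real.rpow_one]
      _ ≤ S ^ (q - 1) := Real.rpow_le_rpow hLp.le hLS (by linarith)
  have eSm : (S ^ θ)⁻¹ ≤ m ^ (q / 2 - 1) := by
    rw [show q / 2 - 1 = -θ by rw [hθ]; ring, Real.rpow_neg hm.le]
    exact inv_anti₀ (by positivity) (Real.rpow_le_rpow hm.le hmS hθ0)
  have e1 : L * m * S ^ (θ - 2) ≤ m ^ (q / 2 - 1) := by
    refine le_trans ?_ eSm
    calc L * m * S ^ (θ - 2) ≤ S ^ (q - 1) * S ^ (1:ℝ) * S ^ (θ - 2) := by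
          rw [Real.rpow_one]; gcongr
      _ = (S ^ θ)⁻¹ := by
          rw [← Real.rpow_add hS, ← Real.rpow_add hS, ← Real.rpow_neg hS.le]
          congr 1; rw [hθ]; ring
  have e2 : L ^ (2 * p - 2) * S ^ (θ - 2) ≤ L ^ (p / 2 - 1) := by
    calc L ^ (2 * p - 2) * S ^ (θ - 2) ≤ L ^ (2 * p - 2) * (L ^ (p - 1)) ^ (θ - 2) := by
          gcongr ?_ * ?_
          exact Real.rpow_le_rpow_of_nonpos hLp hLS (by linarith)
      _ = L ^ (p / 2 - 1) := by
          rw [← Real.rpow_mul hL.le, ← Real.rpow_add hL]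
          congr 1; rw [hθ]; nlinarith [hpq.mul_eq_add]
  set A := S ^ θ * α ^ 2 with hA
  have hA0 : 0 ≤ A := by positivity
  set P := L ^ (p / 2 - 1) with hP
  set M := m ^ (q / 2 - 1) with hM
  have hP0 : 0 < P := by positivity
  have hM0 : 0 < M := by positivity
  -- the three groups of terms
  have t1 : p * P * α ^ 2 ≤ p / 2 * (p / 2 - 1) * L ^ (p / 2 - 2) * L1 ^ 2
        + p / 2 * P * (2 * α ^ 2) := by
    have : 0 ≤ p / 2 * (p / 2 - 1) * L ^ (p / 2 - 2) * L1 ^ 2 := by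
      have : 0 ≤ p / 2 - 1 := by linarith
      positivity
    linarith
  have t2 : q * (q - 1) * M * β ^ 2 ≤ q / 2 * (q / 2 - 1) * m ^ (q / 2 - 2) * m1 ^ 2
        + q / 2 * M * (2 * β ^ 2) := by
    have h : m ^ (q / 2 - 2) * m1 ^ 2 ≤ 4 * M * β ^ 2 := by
      have : M = m ^ (q / 2 - 2) * m := by
        rw [hM, ← Real.rpow_add_one hm.ne']; congr 1; ring
      rw [this]
      have h0 : 0 ≤ m ^ (q / 2 - 2) * β ^ 2 := by positivity
      simp only [m1]; nlinarith
    have h' : 0 ≤ q / 2 * (1 - q / 2) := mul_nonneg (by linarith) (by linarith)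
    nlinarith
  have hS2 : 0 ≤ S2 := by
    have : 0 ≤ p - 1 := by linarith
    have : 0 ≤ p - 1 - 1 := by linarith
    positivity
  have t3a : 0 ≤ L * (θ * S ^ (θ - 1) * S2) := by positivity
  have sS : S ^ θ = S ^ (θ - 1) * S := by rw [← Real.rpow_add_one hS.ne']; congr 1; ring
  have sS1 : S ^ (θ - 1) = S ^ (θ - 2) * S := by rw [← Real.rpow_add_one hS.ne']; congr 1; ring
  have t3b : -A - 16 * (L * m * S ^ (θ - 2)) * β ^ 2 * θ ^ 2 ≤ 2 * L1 * (S1 * θ * S ^ (θ - 1)) := by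
    have hpos : 0 ≤ 2 * L1 * (L1 * (p - 1) * L ^ (p - 1 - 1) * θ * S ^ (θ - 1)) := by
      have : 0 ≤ p - 1 := by linarith
      have : 0 ≤ 2 * L1 ^ 2 * ((p - 1) * L ^ (p - 1 - 1) * θ * S ^ (θ - 1)) := by positivity
      exact this.trans_eq (by ring)
    have hcross : -A - 16 * (L * m * S ^ (θ - 2)) * β ^ 2 * θ ^ 2
        ≤ 2 * L1 * (m1 * θ * S ^ (θ - 1)) := by
      rw [hA, sS, sS1]
      have h0 : 0 ≤ S ^ (θ - 2) := by positivity
      have h1 : u ^ 2 * w ^ 2 ≤ L * m := by gcongr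
      have h2 : 0 ≤ S ^ (θ - 2) * ((S * α + 4 * θ * u * w * β) ^ 2
        + 16 * θ ^ 2 * β ^ 2 * (L * m - u ^ 2 * w ^ 2)) := by
        have : 0 ≤ L * m - u ^ 2 * w ^ 2 := by linarith
        positivity
      have h3 : 2 * (2 * u * α) * (2 * w * β * θ * (S ^ (θ - 2) * S))
          - (-(S ^ (θ - 2) * S * S * α ^ 2) - 16 * (L * m * S ^ (θ - 2)) * β ^ 2 * θ ^ 2)
          = S ^ (θ - 2) * ((S * α + 4 * θ * u * w * β) ^ 2
            + 16 * θ ^ 2 * β ^ 2 * (L * m - u ^ 2 * w ^ 2)) := by ring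
      simp only [L1, m1]; linarith
    have : 2 * L1 * (S1 * θ * S ^ (θ - 1)) = 2 * L1 * (m1 * θ * S ^ (θ - 1))
        + 2 * L1 * (L1 * (p - 1) * L ^ (p - 1 - 1) * θ * S ^ (θ - 1)) := by
      simp only [S1]; ring
    linarith
  have t3c : -(8 * (L * m * S ^ (θ - 2)) * β ^ 2) - 8 * (p - 1) ^ 2 * P * α ^ 2
      ≤ L * (θ * (θ - 1) * S ^ (θ - 2) * S1 ^ 2) := by
    have hS1 : S1 ^ 2 ≤ 8 * m * β ^ 2 + 8 * (p - 1) ^ 2 * (L ^ (p - 1 - 1)) ^ 2 * L * α ^ 2 := by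
      have e : S1 ^ 2 = 2 * m1 ^ 2 + 2 * (L1 * (p - 1) * L ^ (p - 1 - 1)) ^ 2
          - (m1 - L1 * (p - 1) * L ^ (p - 1 - 1)) ^ 2 := by simp only [S1]; ring
      have h1 : w ^ 2 * β ^ 2 ≤ m * β ^ 2 := by gcongr
      have h2 : u ^ 2 * ((p - 1) ^ 2 * (L ^ (p - 1 - 1)) ^ 2 * α ^ 2)
        ≤ L * ((p - 1) ^ 2 * (L ^ (p - 1 - 1)) ^ 2 * α ^ 2) := by gcongr
      have e1 : 2 * m1 ^ 2 = 8 * (w ^ 2 * β ^ 2) := by simp only [m1]; ring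
      have e2 : 2 * (L1 * (p - 1) * L ^ (p - 1 - 1)) ^ 2
        = 8 * (u ^ 2 * ((p - 1) ^ 2 * (L ^ (p - 1 - 1)) ^ 2 * α ^ 2)) := by
        simp only [L1]; ring
      have h3 := sq_nonneg (m1 - L1 * (p - 1) * L ^ (p - 1 - 1))
      rw [e, e1, e2]
      linarith
    have hLL : L * ((L ^ (p - 1 - 1)) ^ 2 * L) = L ^ (2 * p - 2) := by
      rw [← Real.rpow_natCast, ← Real.rpow_mul hL.le, ← Real.rpow_add_one hL.ne', mul_comm,
        ← Real.rpow_add_one hL.ne']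
      congr 1; push_cast; ring
    have h1 : L * S ^ (θ - 2) * S1 ^ 2 ≤ 8 * (L * m * S ^ (θ - 2)) * β ^ 2
        + 8 * (p - 1) ^ 2 * P * α ^ 2 := by
      calc L * S ^ (θ - 2) * S1 ^ 2 ≤ L * S ^ (θ - 2) * (8 * m * β ^ 2
            + 8 * (p - 1) ^ 2 * (L ^ (p - 1 - 1)) ^ 2 * L * α ^ 2) := by gcongr
        _ = 8 * (L * m * S ^ (θ - 2)) * β ^ 2
            + 8 * (p - 1) ^ 2 * ((L * ((L ^ (p - 1 - 1)) ^ 2 * L)) * S ^ (θ - 2)) * α ^ 2 := by ring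
        _ ≤ _ := by rw [hLL]; gcongr
    have h0 : 0 ≤ L * S ^ (θ - 2) * S1 ^ 2 := by positivity
    have hθ' : θ * (1 - θ) ≤ 1 := mul_le_one₀ (by linarith) (by linarith) (by linarith)
    have e : L * (θ * (θ - 1) * S ^ (θ - 2) * S1 ^ 2)
      = -(θ * (1 - θ) * (L * S ^ (θ - 2) * S1 ^ 2)) := by ring
    have h2 := mul_le_mul_of_nonneg_right hθ' h0
    rw [e]
    linarith
  have k1 : 8 * (p - 1) ^ 2 * P * α ^ 2 ≤ 8 * (p - 1) ^ 2 * (p * P * α ^ 2) := by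
    have h0 : 0 ≤ P * α ^ 2 := by positivity
    have h1 : P * α ^ 2 ≤ p * (P * α ^ 2) := le_mul_of_one_le_left h0 (by linarith)
    have h2 := mul_le_mul_of_nonneg_left h1 (show 0 ≤ 8 * (p - 1) ^ 2 by positivity)
    linarith
  have hqq : 0 < q * (q - 1) := mul_pos (by linarith) (by linarith)
  have k2 : 25 / (q * (q - 1)) * (q * (q - 1) * M * β ^ 2) = 25 * M * β ^ 2 := by
    rw [div_mul_eq_mul_div, div_eq_iff hqq.ne']; ring
  have k1' := mul_le_mul_of_nonneg_left t1 (show 0 ≤ 8 * (p - 1) ^ 2 by positivity)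
  have k2' := mul_le_mul_of_nonneg_left t2 (show 0 ≤ 25 / (q * (q - 1)) by positivity)
  have k3 : L * m * S ^ (θ - 2) * β ^ 2 ≤ M * β ^ 2 := by gcongr
  have k4 : (S ^ θ)⁻¹ * β ^ 2 ≤ M * β ^ 2 := by gcongr
  have k5 : L * m * S ^ (θ - 2) * β ^ 2 * θ ^ 2 ≤ L * m * S ^ (θ - 2) * β ^ 2 := by
    exact mul_le_of_le_one_right (by positivity) (pow_le_one₀ hθ0 (by linarith))
  have hsplit : L * (θ * (θ - 1) * S ^ (θ - 2) * S1 ^ 2 + θ * S ^ (θ - 1) * S2)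
    = L * (θ * (θ - 1) * S ^ (θ - 2) * S1 ^ 2) + L * (θ * S ^ (θ - 1) * S2) := by ring
  have hA2 : 2 * α ^ 2 * S ^ θ = 2 * A := by rw [hA]; ring
  rw [hsplit, hA2]
  linarith

/-- A Bellman function for the bilinear embedding theorem (`p ≥ 2`). -/
lemma exists_bellman {p q : ℝ} (hp : 2 ≤ p) (hpq : p.HolderConjugate q) :
    ∃ C > 0, ∀ κ > 0, ∃ Q : ℝ × ℝ → ℝ, ContDiff ℝ 2 Q ∧ 0 ≤ Q 0 ∧ (∀ z, Q 0 ≤ Q z) ∧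
      (∀ z, Q z ≤ C * (z.2 ^ 2 + κ + (z.1 ^ 2 + κ) ^ (p - 1)) ^ (q / 2)) ∧
      ∀ z, ∃ τ > 0, ∀ h : ℝ × ℝ,
        τ * h.1 ^ 2 + τ⁻¹ * h.2 ^ 2 ≤ fderiv ℝ (fderiv ℝ Q) z h h := by
  have hq1 : 1 < q := hpq.symm.lt
  have hrel : (p - 1) * (q - 1) = 1 := by nlinarith [hpq.mul_eq_add]
  have hq2 : q ≤ 2 := by nlinarith
  have hqq : 0 < q * (q - 1) := mul_pos (by linarith) (by linarith)
  refine ⟨8 * (p - 1) ^ 2 + 25 / (q * (q - 1)) + 1, by positivity, fun κ hκ => ?_⟩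
  have hκ' : ∀ x : ℝ, 0 < x ^ 2 + κ := fun x => by positivity
  have hS' : ∀ u w : ℝ, 0 < w ^ 2 + κ + (u ^ 2 + κ) ^ (p - 1) := fun u w => by
    have := hκ' u; positivity
  refine ⟨fun z => 8 * (p - 1) ^ 2 * (z.1 ^ 2 + κ) ^ (p / 2)
    + 25 / (q * (q - 1)) * (z.2 ^ 2 + κ) ^ (q / 2)
    + (z.1 ^ 2 + κ) * (z.2 ^ 2 + κ + (z.1 ^ 2 + κ) ^ (p - 1)) ^ (1 - q / 2), ?_, ?_, ?_, ?_, ?_⟩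
  · have c1 : ContDiff ℝ 2 (fun z : ℝ × ℝ => z.1 ^ 2 + κ) := by fun_prop
    have c2 : ContDiff ℝ 2 (fun z : ℝ × ℝ => z.2 ^ 2 + κ) := by fun_prop
    have c3 := c2.add (c1.rpow_const_of_ne (p := p - 1) (fun z => (hκ' z.1).ne'))
    exact ((contDiff_const.mul (c1.rpow_const_of_ne (fun z => (hκ' z.1).ne'))).add
      (contDiff_const.mul (c2.rpow_const_of_ne (fun z => (hκ' z.2).ne')))).add
      (c1.mul (c3.rpow_const_of_ne (fun z => (hS' z.1 z.2).ne')))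
  · positivity
  · intro z
    simp only [Prod.fst_zero, Prod.snd_zero]
    have h1 : (0:ℝ) ^ 2 + κ ≤ z.1 ^ 2 + κ := by nlinarith [sq_nonneg z.1]
    have h2 : (0:ℝ) ^ 2 + κ ≤ z.2 ^ 2 + κ := by nlinarith [sq_nonneg z.2]
    have h0 : 0 ≤ (0:ℝ) ^ 2 + κ := by positivity
    have h3 : 0 ≤ p - 1 := by linarith
    have h4 : 0 ≤ 1 - q / 2 := by linarith
    have h5 : 0 ≤ q / 2 := by linarith
    gcongr
  · intro z
    set L := z.1 ^ 2 + κ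
    set m := z.2 ^ 2 + κ
    set S := m + L ^ (p - 1)
    have hL : 0 < L := hκ' _
    have hm : 0 < m := hκ' _
    have hLp : 0 < L ^ (p - 1) := by positivity
    have hS : 0 < S := by positivity
    have hmS : m ≤ S := by simp only [S]; linarith
    have hLS : L ^ (p - 1) ≤ S := by simp only [S]; linarith
    have eL : L ≤ S ^ (q - 1) := by
      calc L = (L ^ (p - 1)) ^ (q - 1) := by rw [← Real.rpow_mul hL.le, hrel, Real.rpow_one]
        _ ≤ S ^ (q - 1) := Real.rpow_le_rpow hLp.le hLS (by linarith)
    have a1 : L ^ (p / 2) ≤ S ^ (q / 2) := by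
      calc L ^ (p / 2) ≤ (S ^ (q - 1)) ^ (p / 2) := Real.rpow_le_rpow hL.le eL (by linarith)
        _ = S ^ (q / 2) := by
          rw [← Real.rpow_mul hS.le]; congr 1; nlinarith [hpq.mul_eq_add]
    have a2 : m ^ (q / 2) ≤ S ^ (q / 2) := Real.rpow_le_rpow hm.le hmS (by linarith)
    have a3 : L * S ^ (1 - q / 2) ≤ S ^ (q / 2) := by
      calc L * S ^ (1 - q / 2) ≤ S ^ (q - 1) * S ^ (1 - q / 2) := by gcongr
        _ = S ^ (q / 2) := by rw [← Real.rpow_add hS]; congr 1; ring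
    rw [add_mul, add_mul, one_mul]
    exact add_le_add (add_le_add (mul_le_mul_of_nonneg_left a1 (by positivity))
      (mul_le_mul_of_nonneg_left a2 (by positivity))) a3
  · intro z
    refine ⟨(z.2 ^ 2 + κ + (z.1 ^ 2 + κ) ^ (p - 1)) ^ (1 - q / 2),
      Real.rpow_pos_of_pos (hS' _ _) _, fun h => ?_⟩
    have key := bellman_hessian hp hpq hκ z.1 z.2 h.1 h.2
    refine key.trans (le_of_eq (Eq.symm ?_))
    have hL := HasSecondDeriv.sq_add z.1 h.1 κ
    have hm := HasSecondDeriv.sq_add z.2 h.2 κ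
    have hS := hm.add (hL.rpow (p - 1) (fun t => hκ' _))
    have H := (((hL.rpow (p / 2) (fun t => hκ' _)).const_mul (8 * (p - 1) ^ 2)).add
      ((hm.rpow (q / 2) (fun t => hκ' _)).const_mul (25 / (q * (q - 1))))).add
      (hL.mul (hS.rpow (1 - q / 2) (fun t => hS' _ _)))
    rw [HasSecondDeriv.eq_fderiv_fderiv (F := ℝ × ℝ) ?_ H]
    · simp
    · have c1 : ContDiff ℝ 2 (fun z : ℝ × ℝ => z.1 ^ 2 + κ) := by fun_prop
      have c2 : ContDiff ℝ 2 (fun z : ℝ × ℝ => z.2 ^ 2 + κ) := by fun_prop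
      have c3 := c2.add (c1.rpow_const_of_ne (p := p - 1) (fun z => (hκ' z.1).ne'))
      exact ((contDiff_const.mul (c1.rpow_const_of_ne (fun z => (hκ' z.1).ne'))).add
        (contDiff_const.mul (c2.rpow_const_of_ne (fun z => (hκ' z.2).ne')))).add
        (c1.mul (c3.rpow_const_of_ne (fun z => (hS' z.1 z.2).ne')))

section HeatFlow

variable {n : ℕ} {F : Type*} [NormedAddCommGroup F] [NormedSpace ℝ F]

/-- Smooth compactly supported functions. -/
structure IsTest (f : Evec n → F) : Prop where
  smooth : ContDiff ℝ (⊤ : ℕ∞) f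
  supp : HasCompactSupport f

/-- The `l`-th partial derivative. -/
def dl (l : Fin n) (f : Evec n → F) (x : Evec n) : F :=
  fderiv ℝ f x (EuclideanSpace.single l 1)

lemma sum_single (z : Evec n) : z = ∑ l, z l • (EuclideanSpace.single l 1 : Evec n) := by
  ext i
  simp [Finset.sum_apply, Pi.single_apply]

namespace IsTest

variable {f g : Evec n → F}

lemma contDiff (hf : IsTest f) (k : ℕ) : ContDiff ℝ k f :=
  hf.smooth.of_le (by exact_mod_cast le_top)

lemma continuous (hf : IsTest f) : Continuous f := hf.smooth.continuous

lemma differentiable (hf : IsTest f) : Differentiable ℝ f := hf.smooth.differentiable (by simp)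

lemma fderiv (hf : IsTest f) : IsTest (fderiv ℝ f) :=
  ⟨hf.smooth.fderiv_right (m := (⊤ : ℕ∞)) (by simp), hf.supp.fderiv ℝ⟩

lemma dl (hf : IsTest f) (l : Fin n) : IsTest (dl l f) :=
  ⟨hf.fderiv.smooth.clm_apply contDiff_const, by
    have := hf.fderiv.supp
    exact this.comp_left (g := fun A : Evec n →L[ℝ] F => A (EuclideanSpace.single l 1)) (by simp)⟩

lemma integrable (hf : IsTest f) : Integrable f := hf.continuous.integrable_of_hasCompactSupport hf.supp

lemma bdd (hf : IsTest f) : ∃ M, 0 < M ∧ ∀ x, ‖f x‖ ≤ M := by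
  obtain ⟨M, hM⟩ := hf.continuous.bounded_above_of_compact_support hf.supp
  exact ⟨max M 1, by positivity, fun x => (hM x).trans (le_max_left _ _)⟩

end IsTest

/-- The standard Gaussian density on `ℝⁿ`. -/
def gk (z : Evec n) : ℝ :=
  (∫ y : Evec n, Real.exp (-(1 / 2) * ‖y‖ ^ 2))⁻¹ * Real.exp (-(1 / 2) * ‖z‖ ^ 2)

lemma integrable_exp_neg_sq {b : ℝ} (hb : 0 < b) :
    Integrable (fun z : Evec n => Real.exp (-b * ‖z‖ ^ 2)) := by
  have h := GaussianFourier.integrable_cexp_neg_mul_sq_norm_add (V := Evec n) (b := b)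
    (by simpa using hb) 0 0
  refine h.norm.congr (ae_of_all _ fun z => ?_)
  simp only [Complex.norm_exp]
  congr 1
  simp [← Complex.ofReal_pow]

lemma integral_exp_pos : 0 < ∫ y : Evec n, Real.exp (-(1 / 2) * ‖y‖ ^ 2) := by
  rw [GaussianFourier.integral_rexp_neg_mul_sq_norm (by norm_num)]
  positivity

lemma gk_nonneg (z : Evec n) : 0 ≤ gk z :=
  mul_nonneg (inv_nonneg.2 integral_exp_pos.le) (Real.exp_nonneg _)

lemma continuous_gk : Continuous (gk : Evec n → ℝ) := by unfold gk; fun_prop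

lemma integrable_gk : Integrable (gk : Evec n → ℝ) :=
  (integrable_exp_neg_sq (by norm_num)).const_mul _

lemma integral_gk : ∫ z : Evec n, gk z = 1 := by
  unfold gk
  rw [integral_const_mul, inv_mul_cancel₀ integral_exp_pos.ne']

lemma integrable_norm_mul_gk : Integrable (fun z : Evec n => ‖z‖ * gk z) := by
  refine Integrable.mono' (((integrable_exp_neg_sq (n := n) (b := 1 / 4) (by norm_num)).const_mul
    (∫ y : Evec n, Real.exp (-(1 / 2) * ‖y‖ ^ 2))⁻¹).const_mul 1) 
    ((continuous_norm.mul continuous_gk).aestronglyMeasurable) (ae_of_all _ fun z => ?_)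
  rw [Real.norm_of_nonneg (mul_nonneg (norm_nonneg _) (gk_nonneg _))]
  have h1 : ‖z‖ ≤ Real.exp (1 / 4 * ‖z‖ ^ 2) := by
    have := Real.add_one_le_exp (1 / 4 * ‖z‖ ^ 2)
    nlinarith [sq_nonneg (‖z‖ - 2)]
  have h2 : Real.exp (-(1 / 2) * ‖z‖ ^ 2) =
      Real.exp (-(1 / 4) * ‖z‖ ^ 2) * (Real.exp (1 / 4 * ‖z‖ ^ 2))⁻¹ := by
    rw [← Real.exp_neg, ← Real.exp_add]; congr 1; ring
  have hI := inv_nonneg.2 (integral_exp_pos (n := n)).le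
  unfold gk
  rw [h2]
  have h3 : ‖z‖ * (Real.exp (1 / 4 * ‖z‖ ^ 2))⁻¹ ≤ 1 := by
    rw [← div_eq_mul_inv, div_le_one (Real.exp_pos _)]; exact h1
  calc _ = (∫ y : Evec n, Real.exp (-(1 / 2) * ‖y‖ ^ 2))⁻¹ * Real.exp (-(1 / 4) * ‖z‖ ^ 2)
        * (‖z‖ * (Real.exp (1 / 4 * ‖z‖ ^ 2))⁻¹) := by ring
    _ ≤ (∫ y : Evec n, Real.exp (-(1 / 2) * ‖y‖ ^ 2))⁻¹ * Real.exp (-(1 / 4) * ‖z‖ ^ 2) * 1 := by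
        gcongr
    _ = _ := by ring

lemma differentiable_gk : Differentiable ℝ (gk : Evec n → ℝ) := by
  unfold gk
  exact ((contDiff_norm_sq ℝ).differentiable (n := 1) (by simp) |>.const_mul _).exp.const_mul _

lemma fderiv_gk (z : Evec n) (l : Fin n) :
    fderiv ℝ gk z (EuclideanSpace.single l 1) = -(gk z * z l) := by
  have h : HasFDerivAt (gk : Evec n → ℝ) ((∫ y : Evec n, Real.exp (-(1 / 2) * ‖y‖ ^ 2))⁻¹ •
      (Real.exp (-(1 / 2) * ‖z‖ ^ 2) • ((-(1 / 2) : ℝ) • (2 • innerSL ℝ z)))) z :=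
    (((hasStrictFDerivAt_norm_sq z).hasFDerivAt.const_mul (-(1 / 2))).exp).const_mul _
  rw [h.fderiv]
  simp [gk, PiLp.inner_apply]
  ring

/-- The heat extension, parametrised so that `∂ₛ u = s Δu`. -/
def heat (f : Evec n → F) (s : ℝ) (x : Evec n) : F := ∫ z, gk z • f (x - s • z)

lemma integrable_heat_integrand {f : Evec n → F} {M : ℝ} (hf : Continuous f) (hM : ∀ x, ‖f x‖ ≤ M)
    (s : ℝ) (x : Evec n) : Integrable (fun z => gk z • f (x - s • z)) := by
  refine (integrable_gk.mul_const M).mono' ?_ (ae_of_all _ fun z => ?_)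
  · exact (continuous_gk.smul (hf.comp (by fun_prop))).aestronglyMeasurable
  · rw [norm_smul, Real.norm_of_nonneg (gk_nonneg z)]
    exact mul_le_mul_of_nonneg_left (hM _) (gk_nonneg z)

lemma heat_zero [CompleteSpace F] (f : Evec n → F) (x : Evec n) : heat f 0 x = f x := by
  simp [heat, integral_smul_const, integral_gk]

lemma norm_heat_le {f : Evec n → F} {M : ℝ} (hM : ∀ x, ‖f x‖ ≤ M) (s : ℝ) (x : Evec n) :
    ‖heat f s x‖ ≤ M := by
  calc ‖heat f s x‖ ≤ ∫ z, gk z * M := by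
        refine norm_integral_le_of_norm_le (integrable_gk.mul_const M) (ae_of_all _ fun z => ?_)
        rw [norm_smul, Real.norm_of_nonneg (gk_nonneg z)]
        exact mul_le_mul_of_nonneg_left (hM _) (gk_nonneg z)
    _ = M := by rw [integral_mul_const, integral_gk, one_mul]

lemma continuous_heat {f : Evec n → F} (hf : IsTest f) :
    Continuous (fun q : ℝ × Evec n => heat f q.1 q.2) := by
  obtain ⟨M, hM0, hM⟩ := hf.bdd
  refine continuous_of_dominated (bound := fun z => gk z * M) (fun q => ?_)
    (fun q => ae_of_all _ fun z => ?_) (integrable_gk.mul_const M) (ae_of_all _ fun z => ?_)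
  · exact (integrable_heat_integrand hf.continuous hM _ _).aestronglyMeasurable
  · rw [norm_smul, Real.norm_of_nonneg (gk_nonneg z)]
    exact mul_le_mul_of_nonneg_left (hM _) (gk_nonneg z)
  · exact (hf.continuous.comp (by fun_prop)).const_smul _

lemma integrable_heat_aux {f : Evec n → F} (hf : IsTest f) (s : ℝ) :
    Integrable (fun q : Evec n × Evec n => gk q.2 • f (q.1 - s • q.2)) (volume.prod volume) := by
  rw [integrable_prod_iff']
  · refine ⟨ae_of_all _ fun z => (hf.integrable.comp_sub_right (s • z)).smul (gk z), ?_⟩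
    simp only [norm_smul, Real.norm_of_nonneg (gk_nonneg _), integral_const_mul]
    have : ∀ z : Evec n, ∫ x, ‖f (x - s • z)‖ = ∫ x, ‖f x‖ := fun z =>
      integral_sub_right_eq_self (fun x => ‖f x‖) (s • z)
    simp only [this]
    exact integrable_gk.mul_const _
  · exact ((continuous_gk.comp continuous_snd).smul
      (hf.continuous.comp (by fun_prop))).aestronglyMeasurable

lemma integrable_heat {f : Evec n → F} (hf : IsTest f) (s : ℝ) : Integrable (heat f s) :=
  (integrable_heat_aux hf s).integral_prod_left

lemma integral_norm_heat_le {f : Evec n → F} (hf : IsTest f) (s : ℝ) :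
    ∫ x, ‖heat f s x‖ ≤ ∫ x, ‖f x‖ := by
  have h := (integrable_heat_aux hf s).norm
  calc ∫ x, ‖heat f s x‖ ≤ ∫ x, ∫ z, ‖gk z • f (x - s • z)‖ :=
        integral_mono (integrable_heat hf s).norm h.integral_prod_left
          (fun x => norm_integral_le_integral_norm _)
    _ = ∫ z, ∫ x, ‖gk z • f (x - s • z)‖ := integral_integral_swap h
    _ = ∫ z, gk z * ∫ x, ‖f x‖ := by
        congr 1 with z
        simp only [norm_smul, Real.norm_of_nonneg (gk_nonneg _), integral_const_mul]
        rw [integral_sub_right_eq_self (fun x => ‖f x‖) (s • z)]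
    _ = ∫ x, ‖f x‖ := by rw [integral_mul_const, integral_gk, one_mul]

lemma hasFDerivAt_heat [CompleteSpace F] {f : Evec n → F} (hf : IsTest f) (s : ℝ) (x : Evec n) :
    HasFDerivAt (heat f s) (heat (fderiv ℝ f) s x) x := by
  obtain ⟨M, hM0, hM⟩ := hf.bdd
  obtain ⟨M', hM0', hM'⟩ := hf.fderiv.bdd
  refine hasFDerivAt_integral_of_dominated_of_fderiv_le (bound := fun z => gk z * M')
    (F := fun x z => gk z • f (x - s • z)) (F' := fun x z => gk z • fderiv ℝ f (x - s • z))
    (s := univ) univ_mem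
    (Eventually.of_forall fun y =>
      (integrable_heat_integrand hf.continuous hM _ _).aestronglyMeasurable)
    (integrable_heat_integrand hf.continuous hM _ _)
    (integrable_heat_integrand hf.fderiv.continuous hM' _ _).aestronglyMeasurable
    (ae_of_all _ fun z y _ => ?_) (integrable_gk.mul_const M') (ae_of_all _ fun z y _ => ?_)
  · rw [norm_smul, Real.norm_of_nonneg (gk_nonneg z)]
    exact mul_le_mul_of_nonneg_left (hM' _) (gk_nonneg z)
  · have := (hf.differentiable (y - s • z)).hasFDerivAt.comp y ((hasFDerivAt_id y).sub_const (s • z))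
    exact (this.const_smul (gk z))

lemma heat_fderiv_apply [CompleteSpace F] {f : Evec n → F} (hf : IsTest f) (l : Fin n) (s : ℝ)
    (x : Evec n) : heat (fderiv ℝ f) s x (EuclideanSpace.single l 1) = heat (dl l f) s x := by
  obtain ⟨M', hM0', hM'⟩ := hf.fderiv.bdd
  unfold heat
  rw [ContinuousLinearMap.integral_apply (integrable_heat_integrand hf.fderiv.continuous hM' _ _)]
  rfl

lemma integral_gk_mul_coord [CompleteSpace F] {h : Evec n → F} (hh : IsTest h) (l : Fin n) (s : ℝ)
    (x : Evec n) : ∫ z, (gk z * z l) • h (x - s • z) = -(s • heat (dl l h) s x) := by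
  obtain ⟨M, hM0, hM⟩ := hh.bdd
  obtain ⟨M', hM0', hM'⟩ := (hh.dl l).bdd
  have hd : ∀ z, HasFDerivAt (fun z => h (x - s • z))
      ((fderiv ℝ h (x - s • z)).comp (-(s • ContinuousLinearMap.id ℝ (Evec n)))) z := fun z =>
    (hh.differentiable (x - s • z)).hasFDerivAt.comp z
      (((hasFDerivAt_id z).const_smul s).const_sub x)
  have hd' : ∀ z, fderiv ℝ (fun z => h (x - s • z)) z (EuclideanSpace.single l 1)
      = -(s • dl l h (x - s • z)) := fun z => by
    rw [(hd z).fderiv]; simp [dl]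
  have key := integral_smul_fderiv_eq_neg_fderiv_smul_of_integrable (μ := volume)
    (f := (gk : Evec n → ℝ)) (g := fun z => h (x - s • z)) (v := EuclideanSpace.single l 1)
    ?_ ?_ (integrable_heat_integrand hh.continuous hM s x)
    (fun z _ => differentiable_gk z) (fun z _ => (hd z).differentiableAt)
  · simp only [hd', fderiv_gk, neg_smul, smul_neg, integral_neg, neg_neg] at key
    rw [← key]
    simp only [smul_comm _ s, integral_smul]
    rfl
  · simp only [fderiv_gk]
    refine (integrable_norm_mul_gk.mul_const M).mono' ?_ (ae_of_all _ fun z => ?_)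
    · exact (((continuous_gk.mul (by fun_prop)).neg).smul
        (hh.continuous.comp (by fun_prop))).aestronglyMeasurable
    · rw [norm_smul, norm_neg, norm_mul, Real.norm_of_nonneg (gk_nonneg z)]
      have := PiLp.norm_apply_le z l
      have := gk_nonneg z
      have := hM (x - s • z)
      rw [mul_comm (gk z)]
      gcongr
  · simp only [hd', smul_neg, smul_comm _ s]
    exact ((integrable_heat_integrand (hh.dl l).continuous hM' s x).smul s).neg

lemma norm_smul_heat_dl_le [CompleteSpace F] {h : Evec n → F} (hh : IsTest h) (l : Fin n) :
    ∃ C, ∀ s x, ‖s • heat (dl l h) s x‖ ≤ C := by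
  obtain ⟨M, hM0, hM⟩ := hh.bdd
  refine ⟨∫ z : Evec n, ‖z‖ * gk z * M, fun s x => ?_⟩
  rw [← norm_neg, ← integral_gk_mul_coord hh]
  refine norm_integral_le_of_norm_le (integrable_norm_mul_gk.mul_const M) (ae_of_all _ fun z => ?_)
  rw [norm_smul, norm_mul, Real.norm_of_nonneg (gk_nonneg z), mul_comm (gk z)]
  have := PiLp.norm_apply_le z l
  have := gk_nonneg z
  have := hM (x - s • z)
  gcongr

lemma hasDerivAt_heat [CompleteSpace F] {f : Evec n → F} (hf : IsTest f) (s : ℝ) (x : Evec n) :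
    HasDerivAt (fun s => heat f s x) (s • ∑ l, heat (dl l (dl l f)) s x) s := by
  obtain ⟨M, hM0, hM⟩ := hf.bdd
  obtain ⟨M', hM0', hM'⟩ := hf.fderiv.bdd
  have h := (hasDerivAt_integral_of_dominated_loc_of_deriv_le (μ := volume)
    (bound := fun z : Evec n => ‖z‖ * gk z * M') (x₀ := s)
    (F := fun s z => gk z • f (x - s • z)) (F' := fun s z => gk z • fderiv ℝ f (x - s • z) (-z))
    (s := univ) univ_mem
    (Eventually.of_forall fun s =>
      (integrable_heat_integrand hf.continuous hM _ _).aestronglyMeasurable)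
    (integrable_heat_integrand hf.continuous hM _ _)
    ?_ (ae_of_all _ fun z y _ => ?_) (integrable_norm_mul_gk.mul_const M')
    (ae_of_all _ fun z y _ => ?_)).2
  · refine h.congr_deriv ?_
    have e : ∀ z : Evec n, gk z • fderiv ℝ f (x - s • z) (-z)
        = ∑ l, -((gk z * z l) • dl l f (x - s • z)) := fun z => by
      conv_lhs => rw [map_neg, sum_single z, map_sum]
      rw [← sum_single z, ← Finset.sum_neg_distrib, Finset.smul_sum]
      refine Finset.sum_congr rfl fun l _ => ?_
      rw [map_smul, smul_neg, smul_smul]; rfl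
    have hi : ∀ l ∈ Finset.univ, Integrable (fun z => -((gk z * z l) • dl l f (x - s • z))) := by
      intro l _
      obtain ⟨M1, hM10, hM1⟩ := (hf.dl l).bdd
      refine Integrable.neg ((integrable_norm_mul_gk.mul_const M1).mono' ?_ (ae_of_all _ fun z => ?_))
      · exact ((continuous_gk.mul (by fun_prop)).smul
          ((hf.dl l).continuous.comp (by fun_prop))).aestronglyMeasurable
      · rw [norm_smul, norm_mul, Real.norm_of_nonneg (gk_nonneg z), mul_comm (gk z)]
        have := PiLp.norm_apply_le z l
        have := gk_nonneg z
        have := hM1 (x - s • z)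
        gcongr
    simp only [e]
    rw [integral_finsetSum _ hi, Finset.smul_sum]
    refine Finset.sum_congr rfl fun l _ => ?_
    rw [integral_neg, integral_gk_mul_coord (hf.dl l), neg_neg]
  · exact (continuous_gk.smul ((hf.fderiv.continuous.comp (by fun_prop)).clm_apply
      continuous_neg)).aestronglyMeasurable
  · rw [norm_smul, Real.norm_of_nonneg (gk_nonneg z)]
    have h1 := (fderiv ℝ f (x - y • z)).le_opNorm (-z)
    rw [norm_neg] at h1
    have h2 := hM' (x - y • z)
    calc gk z * ‖fderiv ℝ f (x - y • z) (-z)‖ ≤ gk z * (M' * ‖z‖) := by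
          refine mul_le_mul_of_nonneg_left (h1.trans ?_) (gk_nonneg z)
          gcongr
      _ = ‖z‖ * gk z * M' := by ring
  · have h1 : HasDerivAt (fun s : ℝ => x - s • z) (-z) y := by
      simpa using ((hasDerivAt_id y).smul_const z).const_sub x
    exact (HasFDerivAt.comp_hasDerivAt y (hf.differentiable (x - y • z)).hasFDerivAt h1).const_smul _

end HeatFlow

section HeatIdentity

variable {n : ℕ} {F : Type*} [NormedAddCommGroup F] [NormedSpace ℝ F]

lemma integrable_heat_prod {h : Evec n → F} (hh : IsTest h) (T : ℝ) :
    Integrable (fun q : ℝ × Evec n => heat h q.1 q.2)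
      ((volume.restrict (Ioc 0 T)).prod volume) := by
  have hm : AEStronglyMeasurable (fun q : ℝ × Evec n => heat h q.1 q.2)
      ((volume.restrict (Ioc 0 T)).prod volume) := (continuous_heat hh).aestronglyMeasurable
  rw [integrable_prod_iff hm]
  refine ⟨ae_of_all _ fun s => integrable_heat hh s, ?_⟩
  refine Integrable.mono' (integrable_const (∫ x, ‖h x‖)) hm.norm.integral_prod_right'
    (ae_of_all _ fun s => ?_)
  rw [Real.norm_of_nonneg (integral_nonneg fun _ => norm_nonneg _)]
  exact integral_norm_heat_le hh s

lemma integrable_heat_prod_of_le {G : Type*} [NormedAddCommGroup G] {h : Evec n → F}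
    (hh : IsTest h) (T : ℝ) {Φ : ℝ × Evec n → G} (hΦ : Continuous Φ) (C : ℝ)
    (hC : ∀ s x, 0 ≤ s → s ≤ T → ‖Φ (s, x)‖ ≤ C * ‖heat h s x‖) :
    Integrable Φ ((volume.restrict (Ioc 0 T)).prod volume) := by
  refine ((integrable_heat_prod hh T).norm.const_mul C).mono' hΦ.aestronglyMeasurable ?_
  have h1 : ∀ᵐ s ∂(volume.restrict (Ioc 0 T)), s ∈ Ioc 0 T := ae_restrict_mem measurableSet_Ioc
  have h2 := (Measure.quasiMeasurePreserving_fst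
    (μ := volume.restrict (Ioc 0 T)) (ν := (volume : Measure (Evec n)))).ae h1
  filter_upwards [h2] with q hq
  exact hC q.1 q.2 hq.1.le hq.2

lemma integral_fderiv_apply_eq_zero {Ψ : Evec n → ℝ} (hΨ : Integrable Ψ) (v : Evec n)
    (hd : Differentiable ℝ Ψ) (hΨ' : Integrable (fun x => fderiv ℝ Ψ x v)) :
    ∫ x, fderiv ℝ Ψ x v = 0 := by
  have := integral_smul_fderiv_eq_neg_fderiv_smul_of_integrable (μ := volume)
    (f := fun _ : Evec n => (1 : ℝ)) (g := Ψ) (v := v) (by simp) (by simpa using hΨ')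
    (by simpa using hΨ) (fun x _ => by fun_prop) (fun x _ => hd x)
  simpa using this

variable [FiniteDimensional ℝ F]

lemma integral_laplace_eq {Z : Evec n → F} (hZ : IsTest Z) {Q : F → ℝ} (hQ : ContDiff ℝ 2 Q)
    (s : ℝ) (l : Fin n) :
    ∫ x, fderiv ℝ Q (heat Z s x) (heat (dl l (dl l Z)) s x)
      = -∫ x, fderiv ℝ (fderiv ℝ Q) (heat Z s x) (heat (dl l Z) s x) (heat (dl l Z) s x) := by
  have := FiniteDimensional.complete ℝ F
  obtain ⟨M, hM0, hM⟩ := hZ.bdd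
  obtain ⟨M1, hM10, hM1⟩ := (hZ.dl l).bdd
  have hQ1 : ContDiff ℝ 1 (fderiv ℝ Q) := hQ.fderiv_right (m := 1) (by norm_num)
  have hQ2 : Continuous (fderiv ℝ (fderiv ℝ Q)) := hQ1.continuous_fderiv (by simp)
  obtain ⟨C1, hC1⟩ := (isCompact_closedBall (0 : F) M).exists_bound_of_continuousOn
    hQ1.continuous.continuousOn
  obtain ⟨C2, hC2⟩ : ∃ C2, ∀ z ∈ Metric.closedBall (0 : F) M,
      ‖fderiv ℝ (fderiv ℝ Q) z‖ ≤ C2 :=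
    (isCompact_closedBall (0 : F) M).exists_bound_of_continuousOn
      (f := fderiv ℝ (fderiv ℝ Q)) hQ2.continuousOn
  have hball : ∀ x, heat Z s x ∈ Metric.closedBall (0 : F) M := fun x => by
    simpa using norm_heat_le hM s x
  have c0 : Continuous (heat Z s) := (continuous_heat hZ).comp (Continuous.prodMk_right s)
  have c1 : Continuous (heat (dl l Z) s) :=
    (continuous_heat (hZ.dl l)).comp (Continuous.prodMk_right s)
  have c2 : Continuous (heat (dl l (dl l Z)) s) :=
    (continuous_heat ((hZ.dl l).dl l)).comp (Continuous.prodMk_right s)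
  have hd : ∀ x, HasFDerivAt (fun x => fderiv ℝ Q (heat Z s x) (heat (dl l Z) s x))
      ((fderiv ℝ Q (heat Z s x)).comp (heat (fderiv ℝ (dl l Z)) s x) +
        ((fderiv ℝ (fderiv ℝ Q) (heat Z s x)).comp (heat (fderiv ℝ Z) s x)).flip
          (heat (dl l Z) s x)) x := fun x =>
    (((hQ1.differentiable (by simp) _).hasFDerivAt).comp x (hasFDerivAt_heat hZ s x)).clm_apply
      (hasFDerivAt_heat (hZ.dl l) s x)
  have e : ∀ x, fderiv ℝ (fun x => fderiv ℝ Q (heat Z s x) (heat (dl l Z) s x)) x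
      (EuclideanSpace.single l 1) = fderiv ℝ Q (heat Z s x) (heat (dl l (dl l Z)) s x) +
      fderiv ℝ (fderiv ℝ Q) (heat Z s x) (heat (dl l Z) s x) (heat (dl l Z) s x) := fun x => by
    rw [(hd x).fderiv]
    simp [heat_fderiv_apply hZ, heat_fderiv_apply (hZ.dl l)]
  have i0 : Integrable (fun x => fderiv ℝ Q (heat Z s x) (heat (dl l Z) s x)) := by
    refine ((integrable_heat (hZ.dl l) s).norm.const_mul C1).mono'
      ((hQ1.continuous.comp c0).clm_apply c1).aestronglyMeasurable (ae_of_all _ fun x => ?_)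
    exact (ContinuousLinearMap.le_opNorm _ _).trans
      (mul_le_mul_of_nonneg_right (hC1 _ (hball x)) (norm_nonneg _))
  have i1 : Integrable (fun x => fderiv ℝ Q (heat Z s x) (heat (dl l (dl l Z)) s x)) := by
    refine ((integrable_heat ((hZ.dl l).dl l) s).norm.const_mul C1).mono'
      ((hQ1.continuous.comp c0).clm_apply c2).aestronglyMeasurable (ae_of_all _ fun x => ?_)
    exact (ContinuousLinearMap.le_opNorm _ _).trans
      (mul_le_mul_of_nonneg_right (hC1 _ (hball x)) (norm_nonneg _))
  have i2 : Integrable (fun x => fderiv ℝ (fderiv ℝ Q) (heat Z s x) (heat (dl l Z) s x)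
      (heat (dl l Z) s x)) := by
    refine ((integrable_heat (hZ.dl l) s).norm.const_mul (C2 * M1)).mono'
      (((hQ2.comp c0).clm_apply c1).clm_apply c1).aestronglyMeasurable (ae_of_all _ fun x => ?_)
    refine (ContinuousLinearMap.le_opNorm₂ _ _ _).trans ?_
    have a1 := hC2 _ (hball x)
    have a2 := norm_heat_le hM1 s x
    have a3 := (ContinuousLinearMap.opNorm_nonneg _).trans a1
    gcongr
  have key := integral_fderiv_apply_eq_zero i0 (EuclideanSpace.single l 1)
    (fun x => (hd x).differentiableAt) (by simp only [e]; exact i1.add i2)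
  simp only [e] at key
  rw [integral_add i1 i2] at key
  linarith

/-- The heat flow identity. -/
lemma heat_flow {Z : Evec n → F} (hZ : IsTest Z) {Q : F → ℝ} (hQ : ContDiff ℝ 2 Q)
    {T : ℝ} (hT : 0 ≤ T) :
    Integrable (fun q : ℝ × Evec n => q.1 * ∑ l, fderiv ℝ (fderiv ℝ Q) (heat Z q.1 q.2)
      (heat (dl l Z) q.1 q.2) (heat (dl l Z) q.1 q.2))
      ((volume.restrict (Ioc 0 T)).prod volume) ∧
    Integrable (fun x => Q (Z x) - Q (heat Z T x)) ∧
    ∫ q : ℝ × Evec n, q.1 * ∑ l, fderiv ℝ (fderiv ℝ Q) (heat Z q.1 q.2)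
      (heat (dl l Z) q.1 q.2) (heat (dl l Z) q.1 q.2)
      ∂((volume.restrict (Ioc 0 T)).prod volume) = ∫ x, (Q (Z x) - Q (heat Z T x)) := by
  have := FiniteDimensional.complete ℝ F
  obtain ⟨M, hM0, hM⟩ := hZ.bdd
  have hQ1 : ContDiff ℝ 1 (fderiv ℝ Q) := hQ.fderiv_right (m := 1) (by norm_num)
  have hQ2 : Continuous (fderiv ℝ (fderiv ℝ Q)) := hQ1.continuous_fderiv (by simp)
  obtain ⟨C1, hC1⟩ := (isCompact_closedBall (0 : F) M).exists_bound_of_continuousOn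
    hQ1.continuous.continuousOn
  obtain ⟨C2, hC2⟩ : ∃ C2, ∀ z ∈ Metric.closedBall (0 : F) M,
      ‖fderiv ℝ (fderiv ℝ Q) z‖ ≤ C2 :=
    (isCompact_closedBall (0 : F) M).exists_bound_of_continuousOn
      (f := fderiv ℝ (fderiv ℝ Q)) hQ2.continuousOn
  have hball : ∀ s x, heat Z s x ∈ Metric.closedBall (0 : F) M := fun s x => by
    simpa using norm_heat_le hM s x
  have c0 := continuous_heat hZ
  have c1 := fun l => continuous_heat (hZ.dl l)
  have c2 := fun l => continuous_heat ((hZ.dl l).dl l)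
  have C1nn : 0 ≤ C1 := (norm_nonneg _).trans (hC1 _ (hball 0 0))
  have C2nn : 0 ≤ C2 := (ContinuousLinearMap.opNorm_nonneg _).trans (hC2 _ (hball 0 0))
  set μ : Measure (ℝ × Evec n) := (volume.restrict (Ioc 0 T)).prod volume with hμ
  have iD2 : ∀ l, Integrable (fun q : ℝ × Evec n => q.1 * fderiv ℝ (fderiv ℝ Q) (heat Z q.1 q.2)
      (heat (dl l Z) q.1 q.2) (heat (dl l Z) q.1 q.2)) μ := fun l => by
    obtain ⟨M1, hM10, hM1⟩ := (hZ.dl l).bdd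
    refine integrable_heat_prod_of_le (hZ.dl l) T
      (continuous_fst.mul (((hQ2.comp c0).clm_apply (c1 l)).clm_apply (c1 l))) (T * (C2 * M1))
      (fun s x hs hsT => ?_)
    rw [norm_mul, Real.norm_of_nonneg hs, mul_assoc]
    have a0 := ContinuousLinearMap.le_opNorm₂ (fderiv ℝ (fderiv ℝ Q) (heat Z s x))
      (heat (dl l Z) s x) (heat (dl l Z) s x)
    have a1 := hC2 _ (hball s x)
    have a2 := norm_heat_le hM1 s x
    refine mul_le_mul hsT (a0.trans ?_) (norm_nonneg _) hT
    gcongr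
  have iD1 : ∀ l, Integrable (fun q : ℝ × Evec n => q.1 * fderiv ℝ Q (heat Z q.1 q.2)
      (heat (dl l (dl l Z)) q.1 q.2)) μ := fun l => by
    refine integrable_heat_prod_of_le ((hZ.dl l).dl l) T
      (continuous_fst.mul ((hQ1.continuous.comp c0).clm_apply (c2 l))) (T * C1)
      (fun s x hs hsT => ?_)
    rw [norm_mul, Real.norm_of_nonneg hs, mul_assoc]
    refine mul_le_mul hsT ((ContinuousLinearMap.le_opNorm _ _).trans ?_) (norm_nonneg _) hT
    have a1 := hC1 _ (hball s x)
    gcongr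
  have iS2 : Integrable (fun q : ℝ × Evec n => q.1 * ∑ l, fderiv ℝ (fderiv ℝ Q) (heat Z q.1 q.2)
      (heat (dl l Z) q.1 q.2) (heat (dl l Z) q.1 q.2)) μ := by
    simp only [Finset.mul_sum]
    exact integrable_finsetSum _ fun l _ => iD2 l
  have iS1 : Integrable (fun q : ℝ × Evec n => ∑ l, q.1 * fderiv ℝ Q (heat Z q.1 q.2)
      (heat (dl l (dl l Z)) q.1 q.2)) μ := integrable_finsetSum _ fun l _ => iD1 l
  have ftc : ∀ x, ∫ s in Ioc 0 T, ∑ l, s * fderiv ℝ Q (heat Z s x) (heat (dl l (dl l Z)) s x)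
      = -(Q (Z x) - Q (heat Z T x)) := fun x => by
    have hd : ∀ s, HasDerivAt (fun s => Q (heat Z s x))
        (∑ l, s * fderiv ℝ Q (heat Z s x) (heat (dl l (dl l Z)) s x)) s := fun s => by
      have h1 : HasDerivAt (fun s => Q (heat Z s x))
        (fderiv ℝ Q (heat Z s x) (s • ∑ l, heat (dl l (dl l Z)) s x)) s :=
        HasFDerivAt.comp_hasDerivAt s (hQ.differentiable (by simp) _).hasFDerivAt
          (hasDerivAt_heat hZ s x)
      refine h1.congr_deriv ?_
      rw [map_smul, map_sum, Finset.smul_sum]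
      rfl
    have hc : Continuous (fun s : ℝ => ∑ l, s * fderiv ℝ Q (heat Z s x)
        (heat (dl l (dl l Z)) s x)) := by
      have cc : Continuous (fun s : ℝ => (s, x)) := by fun_prop
      exact continuous_finsetSum _ fun l _ => continuous_id.mul
        ((hQ1.continuous.comp (c0.comp cc)).clm_apply ((c2 l).comp cc))
    rw [← intervalIntegral.integral_of_le hT, intervalIntegral.integral_eq_sub_of_hasDerivAt
      (fun s _ => hd s) (hc.intervalIntegrable _ _), heat_zero]
    ring
  refine ⟨iS2, ?_, ?_⟩
  · have := iS1.integral_prod_right.neg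
    simpa only [ftc, neg_neg, Pi.neg_def] using this
  · have e1 : ∫ q, ∑ l, q.1 * fderiv ℝ Q (heat Z q.1 q.2) (heat (dl l (dl l Z)) q.1 q.2) ∂μ
        = -∫ x, (Q (Z x) - Q (heat Z T x)) := by
      rw [hμ, integral_prod_symm _ iS1]
      simp only [ftc, integral_neg]
    have e2 : ∫ q, ∑ l, q.1 * fderiv ℝ Q (heat Z q.1 q.2) (heat (dl l (dl l Z)) q.1 q.2) ∂μ
        = -∫ q, q.1 * ∑ l, fderiv ℝ (fderiv ℝ Q) (heat Z q.1 q.2)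
          (heat (dl l Z) q.1 q.2) (heat (dl l Z) q.1 q.2) ∂μ := by
      simp only [Finset.mul_sum]
      rw [integral_finsetSum _ fun l _ => iD1 l, integral_finsetSum _ fun l _ => iD2 l,
        ← Finset.sum_neg_distrib]
      refine Finset.sum_congr rfl fun l _ => ?_
      rw [hμ, integral_prod _ (iD1 l), integral_prod _ (iD2 l), ← integral_neg]
      congr 1 with s
      simp only [integral_const_mul]
      rw [integral_laplace_eq hZ hQ]; ring
    linarith

end HeatIdentity

section BilinearEmbedding

lemma add_rpow_le_two_rpow {x y r : ℝ} (hx : 0 ≤ x) (hy : 0 ≤ y) (hr : 0 ≤ r) :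
    (x + y) ^ r ≤ 2 ^ r * (x ^ r + y ^ r) := by
  have hx' := Real.rpow_nonneg hx r
  have hy' := Real.rpow_nonneg hy r
  rcases le_total x y with h | h
  · calc (x + y) ^ r ≤ (2 * y) ^ r := Real.rpow_le_rpow (by linarith) (by linarith) hr
      _ = 2 ^ r * y ^ r := Real.mul_rpow (by norm_num) hy
      _ ≤ _ := by gcongr; linarith
  · calc (x + y) ^ r ≤ (2 * x) ^ r := Real.rpow_le_rpow (by linarith) (by linarith) hr
      _ = 2 ^ r * x ^ r := Real.mul_rpow (by norm_num) hx
      _ ≤ _ := by gcongr; linarith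

lemma sq_rpow_half (x r : ℝ) : (x ^ 2) ^ (r / 2) = |x| ^ r := by
  rw [← sq_abs, ← Real.rpow_natCast, ← Real.rpow_mul (abs_nonneg x)]
  congr 1; push_cast; ring

lemma bellman_size {p q : ℝ} (hp : 2 ≤ p) (hpq : p.HolderConjugate q) {κ : ℝ} (hκ : 0 < κ)
    (u w : ℝ) : (w ^ 2 + κ + (u ^ 2 + κ) ^ (p - 1)) ^ (q / 2) ≤
      2 ^ p * (|u| ^ p + |w| ^ q) + 2 ^ p * (κ ^ (q / 2) + κ ^ (p / 2)) := by
  have hq1 : 1 < q := hpq.symm.lt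
  have hrel : (p - 1) * q = p := by linarith [hpq.mul_eq_add]
  have hq2 : q ≤ 2 := by nlinarith
  have hL : 0 < u ^ 2 + κ := by positivity
  have h1 : (w ^ 2 + κ + (u ^ 2 + κ) ^ (p - 1)) ^ (q / 2)
      ≤ (w ^ 2 + κ) ^ (q / 2) + ((u ^ 2 + κ) ^ (p - 1)) ^ (q / 2) :=
    Real.rpow_add_le_add_rpow (by positivity) (by positivity) (by linarith) (by linarith)
  have h2 : (w ^ 2 + κ) ^ (q / 2) ≤ (w ^ 2) ^ (q / 2) + κ ^ (q / 2) :=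
    Real.rpow_add_le_add_rpow (by positivity) hκ.le (by linarith) (by linarith)
  have h3 : ((u ^ 2 + κ) ^ (p - 1)) ^ (q / 2) = (u ^ 2 + κ) ^ (p / 2) := by
    rw [← Real.rpow_mul hL.le]; congr 1; linarith
  have h4 : (u ^ 2 + κ) ^ (p / 2) ≤ 2 ^ (p / 2) * ((u ^ 2) ^ (p / 2) + κ ^ (p / 2)) :=
    add_rpow_le_two_rpow (by positivity) hκ.le (by linarith)
  rw [sq_rpow_half] at h2 h4
  have h5 : (2:ℝ) ^ (p / 2) ≤ 2 ^ p := Real.rpow_le_rpow_of_exponent_le (by norm_num) (by linarith)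
  have h6 : (1:ℝ) ≤ 2 ^ p := Real.one_le_rpow (by norm_num) (by linarith)
  have a1 : 0 ≤ |u| ^ p := by positivity
  have a2 : 0 ≤ |w| ^ q := by positivity
  have a3 : 0 ≤ κ ^ (q / 2) := by positivity
  have a4 : 0 ≤ κ ^ (p / 2) := by positivity
  have h7 := mul_le_mul_of_nonneg_right h5 (add_nonneg a1 a4)
  have h8 := mul_le_mul_of_nonneg_right h6 (add_nonneg a2 a3)
  linarith

variable {n : ℕ}

lemma IsTest.prodMk {f g : Evec n → ℝ} (hf : IsTest f) (hg : IsTest g) :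
    IsTest (fun x => (f x, g x)) :=
  ⟨hf.smooth.prodMk hg.smooth, by
    refine HasCompactSupport.of_support_subset_isCompact (K := tsupport f ∪ tsupport g)
      (hf.supp.isCompact.union hg.supp.isCompact) (fun x hx => ?_)
    by_contra hc
    simp only [mem_union, not_or] at hc
    exact hx (by simp [image_eq_zero_of_notMem_tsupport hc.1,
      image_eq_zero_of_notMem_tsupport hc.2])⟩

lemma heat_prodMk {f g : Evec n → ℝ} (hf : IsTest f) (hg : IsTest g) (s : ℝ) (x : Evec n) :
    heat (fun x => (f x, g x)) s x = (heat f s x, heat g s x) := by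
  obtain ⟨M, -, hM⟩ := hf.bdd
  obtain ⟨M', -, hM'⟩ := hg.bdd
  simp only [heat, Prod.smul_mk]
  exact integral_pair (integrable_heat_integrand hf.continuous hM s x)
    (integrable_heat_integrand hg.continuous hM' s x)

lemma dl_prodMk {f g : Evec n → ℝ} (hf : IsTest f) (hg : IsTest g) (l : Fin n) :
    dl l (fun x => (f x, g x)) = fun x => (dl l f x, dl l g x) := by
  ext1 x
  unfold dl
  rw [((hf.differentiable x).hasFDerivAt.prodMk (hg.differentiable x).hasFDerivAt).fderiv]
  rfl

lemma integrable_heat_pair {f g : Evec n → ℝ} (hf : IsTest f) (hg : IsTest g) (T : ℝ) :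
    Integrable (fun q : ℝ × Evec n => q.1 * (heat f q.1 q.2 * heat g q.1 q.2))
      ((volume.restrict (Ioc 0 T)).prod volume) := by
  obtain ⟨M, hM0, hM⟩ := hg.bdd
  refine integrable_heat_prod_of_le hf T
    (continuous_fst.mul ((continuous_heat hf).mul (continuous_heat hg))) (T * M)
    (fun s x hs hsT => ?_)
  rw [norm_mul, norm_mul, Real.norm_of_nonneg hs]
  have := norm_heat_le hM s x
  have h0 := norm_nonneg (heat g s x)
  calc s * (‖heat f s x‖ * ‖heat g s x‖) ≤ T * (‖heat f s x‖ * M) := by gcongr; linarith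
    _ = _ := by ring

lemma IsTest.integrable_rpow {f : Evec n → ℝ} (hf : IsTest f) {p : ℝ} (hp : 0 < p) :
    Integrable (fun x => |f x| ^ p) := by
  refine Continuous.integrable_of_hasCompactSupport
    (hf.continuous.abs.rpow_const fun x => Or.inr hp.le) ?_
  exact hf.supp.comp_left (g := fun t : ℝ => |t| ^ p) (by simp [hp.ne'])

lemma bilinear_embedding_of_two_le {p q : ℝ} (hp : 2 ≤ p) (hpq : p.HolderConjugate q) :
    ∃ C > 0, ∀ f g : Evec n → ℝ, IsTest f → IsTest g → ∀ (j k : Fin n) (T : ℝ), 0 ≤ T →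
      ∫ z : ℝ × Evec n, |z.1 * (heat (dl j f) z.1 z.2 * heat (dl k g) z.1 z.2)|
        ∂((volume.restrict (Ioc 0 T)).prod volume) ≤ C * ((∫ x, |f x| ^ p) + ∫ x, |g x| ^ q) := by
  obtain ⟨C, hC, hB⟩ := exists_bellman hp hpq
  refine ⟨C * 2 ^ p, by positivity, fun f g hf hg j k T hT => ?_⟩
  have hZ := hf.prodMk hg
  set Z : Evec n → ℝ × ℝ := fun x => (f x, g x) with hZdef
  have hK : IsCompact (tsupport Z) := hZ.supp
  have hfi := hf.integrable_rpow hpq.pos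
  have hgi := hg.integrable_rpow hpq.symm.pos
  set V := volume.real (tsupport Z)
  have main : ∀ κ > 0, ∫ z : ℝ × Evec n, |z.1 * (heat (dl j f) z.1 z.2 * heat (dl k g) z.1 z.2)|
      ∂((volume.restrict (Ioc 0 T)).prod volume) ≤ C * 2 ^ p * ((∫ x, |f x| ^ p) + ∫ x, |g x| ^ q)
        + C * 2 ^ p * (κ ^ (q / 2) + κ ^ (p / 2)) * V := by
    intro κ hκ
    obtain ⟨Q, hQ, hQ0, hQmin, hQle, hQcvx⟩ := hB κ hκ
    obtain ⟨hi, hi', he⟩ := heat_flow hZ hQ hT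
    have step1 : ∫ z : ℝ × Evec n, |z.1 * (heat (dl j f) z.1 z.2 * heat (dl k g) z.1 z.2)|
      ∂((volume.restrict (Ioc 0 T)).prod volume) ≤ ∫ x, (Q (Z x) - Q (heat Z T x)) := by
      rw [← he]
      refine integral_mono_ae (integrable_heat_pair (hf.dl j) (hg.dl k) T).norm hi ?_
      have h1 : ∀ᵐ s ∂(volume.restrict (Ioc 0 T)), s ∈ Ioc 0 T := ae_restrict_mem measurableSet_Ioc
      have h2 := (Measure.quasiMeasurePreserving_fst
        (μ := volume.restrict (Ioc 0 T)) (ν := (volume : Measure (Evec n)))).ae h1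
      filter_upwards [h2] with z hz
      rw [abs_mul, abs_of_pos hz.1]
      refine mul_le_mul_of_nonneg_left ?_ hz.1.le
      obtain ⟨τ, hτ, hcvx⟩ := hQcvx (heat Z z.1 z.2)
      have hl : ∀ l, heat (dl l Z) z.1 z.2 = (heat (dl l f) z.1 z.2, heat (dl l g) z.1 z.2) := by
        intro l; rw [dl_prodMk hf hg, heat_prodMk (hf.dl l) (hg.dl l)]
      have h3 : ∑ l, (τ * (heat (dl l f) z.1 z.2) ^ 2 + τ⁻¹ * (heat (dl l g) z.1 z.2) ^ 2) ≤
          ∑ l, fderiv ℝ (fderiv ℝ Q) (heat Z z.1 z.2) (heat (dl l Z) z.1 z.2)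
            (heat (dl l Z) z.1 z.2) := by
        refine Finset.sum_le_sum fun l _ => ?_
        have := hcvx (heat (dl l Z) z.1 z.2)
        rw [hl] at this ⊢
        exact this
      refine le_trans ?_ h3
      rw [Finset.sum_add_distrib]
      have h4 := Finset.single_le_sum (f := fun l => τ * (heat (dl l f) z.1 z.2) ^ 2)
        (fun l _ => by positivity) (Finset.mem_univ j)
      have h5 := Finset.single_le_sum (f := fun l => τ⁻¹ * (heat (dl l g) z.1 z.2) ^ 2)
        (fun l _ => by positivity) (Finset.mem_univ k)
      refine le_trans ?_ (add_le_add h4 h5)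
      generalize heat (dl j f) z.1 z.2 = a
      generalize heat (dl k g) z.1 z.2 = b
      rw [abs_mul, ← sq_abs a, ← sq_abs b]
      have e : τ * |a| ^ 2 + τ⁻¹ * |b| ^ 2 - 2 * (|a| * |b|) = τ⁻¹ * (τ * |a| - |b|) ^ 2 := by
        field_simp; ring
      have : 0 ≤ τ⁻¹ * (τ * |a| - |b|) ^ 2 := by positivity
      have : 0 ≤ |a| * |b| := by positivity
      linarith
    refine step1.trans ?_
    have hind : Integrable (indicator (tsupport Z)
        (fun _ : Evec n => C * 2 ^ p * (κ ^ (q / 2) + κ ^ (p / 2)))) :=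
      (integrableOn_const hK.measure_ne_top).integrable_indicator hK.measurableSet
    calc ∫ x, (Q (Z x) - Q (heat Z T x)) ≤ ∫ x, (C * 2 ^ p * (|f x| ^ p + |g x| ^ q) +
          indicator (tsupport Z) (fun _ => C * 2 ^ p * (κ ^ (q / 2) + κ ^ (p / 2))) x) := by
          refine integral_mono hi' (((hfi.add hgi).const_mul _).add hind) fun x => ?_
          simp only
          have h1 := hQmin (heat Z T x)
          by_cases hx : x ∈ tsupport Z
          · rw [indicator_of_mem hx]
            have h2 := hQle (Z x)
            have h3 := mul_le_mul_of_nonneg_left (bellman_size hp hpq hκ (f x) (g x)) hC.le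
            have h4 : (Z x).1 = f x := rfl
            have h5 : (Z x).2 = g x := rfl
            rw [h4, h5] at h2
            linarith
          · rw [indicator_of_notMem hx, image_eq_zero_of_notMem_tsupport hx]
            have : 0 ≤ C * 2 ^ p * (|f x| ^ p + |g x| ^ q) := by positivity
            linarith
      _ = _ := by
          have e1 := integral_add ((hfi.add hgi).const_mul (C * 2 ^ p)) hind
          simp only [Pi.add_apply] at e1
          rw [e1, integral_const_mul, integral_add hfi hgi, integral_indicator hK.measurableSet]
          simp [V, mul_comm]
  have lim : Tendsto (fun κ : ℝ => C * 2 ^ p * ((∫ x, |f x| ^ p) + ∫ x, |g x| ^ q)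
        + C * 2 ^ p * (κ ^ (q / 2) + κ ^ (p / 2)) * V) (𝓝[>] 0)
      (𝓝 (C * 2 ^ p * ((∫ x, |f x| ^ p) + ∫ x, |g x| ^ q)
        + C * 2 ^ p * ((0:ℝ) ^ (q / 2) + 0 ^ (p / 2)) * V)) := by
    refine Tendsto.mono_left ?_ nhdsWithin_le_nhds
    have c1 : Continuous (fun κ : ℝ => κ ^ (q / 2)) :=
      Real.continuous_rpow_const (by linarith [hpq.symm.pos])
    have c2 : Continuous (fun κ : ℝ => κ ^ (p / 2)) :=
      Real.continuous_rpow_const (by linarith)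
    exact (by fun_prop : Continuous (fun κ : ℝ => C * 2 ^ p * ((∫ x, |f x| ^ p) + ∫ x, |g x| ^ q)
        + C * 2 ^ p * (κ ^ (q / 2) + κ ^ (p / 2)) * V)).tendsto 0
  have := ge_of_tendsto lim (eventually_mem_nhdsWithin.mono main)
  rwa [Real.zero_rpow (by linarith [hpq.symm.pos]), Real.zero_rpow (by linarith), add_zero,
    mul_zero, zero_mul, add_zero] at this

/-- Bilinear embedding theorem for the heat flow. -/
lemma bilinear_embedding {p q : ℝ} (hpq : p.HolderConjugate q) :
    ∃ C > 0, ∀ f g : Evec n → ℝ, IsTest f → IsTest g → ∀ (j k : Fin n) (T : ℝ), 0 ≤ T →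
      ∫ z : ℝ × Evec n, |z.1 * (heat (dl j f) z.1 z.2 * heat (dl k g) z.1 z.2)|
        ∂((volume.restrict (Ioc 0 T)).prod volume) ≤ C * ((∫ x, |f x| ^ p) + ∫ x, |g x| ^ q) := by
  rcases le_total 2 p with hp | hp
  · exact bilinear_embedding_of_two_le hp hpq
  · have hq : 2 ≤ q := by nlinarith [hpq.mul_eq_add, hpq.lt, hpq.symm.lt]
    obtain ⟨C, hC, h⟩ := bilinear_embedding_of_two_le (n := n) hq hpq.symm
    refine ⟨C, hC, fun f g hf hg j k T hT => ?_⟩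
    have := h g f hg hf k j T hT
    rw [add_comm]
    simpa only [mul_comm (heat (dl k g) _ _)] using this

end BilinearEmbedding

section GlobalKorn

variable {n : ℕ}

lemma IsTest.add {f g : Evec n → ℝ} (hf : IsTest f) (hg : IsTest g) :
    IsTest (fun x => f x + g x) := ⟨hf.smooth.add hg.smooth, hf.supp.add hg.supp⟩

lemma IsTest.const_mul {f : Evec n → ℝ} (c : ℝ) (hf : IsTest f) : IsTest (fun x => c * f x) :=
  ⟨contDiff_const.mul hf.smooth, hf.supp.comp_left (g := fun t : ℝ => c * t) (by simp)⟩

lemma dl_add {f g : Evec n → ℝ} (hf : IsTest f) (hg : IsTest g) (l : Fin n) :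
    dl l (fun x => f x + g x) = fun x => dl l f x + dl l g x := by
  ext1 x
  unfold dl
  rw [fderiv_fun_add (hf.differentiable x) (hg.differentiable x)]
  rfl

lemma dl_const_mul {f : Evec n → ℝ} (hf : IsTest f) (c : ℝ) (l : Fin n) :
    dl l (fun x => c * f x) = fun x => c * dl l f x := by
  ext1 x
  unfold dl
  rw [((hf.differentiable x).hasFDerivAt.const_mul c).fderiv]
  rfl

lemma dl_comm {f : Evec n → ℝ} (hf : IsTest f) (j k : Fin n) : dl j (dl k f) = dl k (dl j f) := by
  ext1 x
  have h : ∀ a b : Fin n, dl a (dl b f) x = fderiv ℝ (fderiv ℝ f) x (EuclideanSpace.single a 1)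
      (EuclideanSpace.single b 1) := fun a b => by
    have := ((hf.fderiv.differentiable x).hasFDerivAt.clm_apply
      (hasFDerivAt_const (EuclideanSpace.single b (1:ℝ)) x)).fderiv
    unfold dl at *
    rw [this]
    simp
  rw [h, h]
  exact (hf.contDiff 2).contDiffAt.isSymmSndFDerivAt (by simp) _ _

lemma heat_add {f g : Evec n → ℝ} (hf : IsTest f) (hg : IsTest g) (s : ℝ) (x : Evec n) :
    heat (fun x => f x + g x) s x = heat f s x + heat g s x := by
  obtain ⟨M, -, hM⟩ := hf.bdd
  obtain ⟨M', -, hM'⟩ := hg.bdd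
  unfold heat
  rw [← integral_add (integrable_heat_integrand hf.continuous hM s x)
    (integrable_heat_integrand hg.continuous hM' s x)]
  simp only [smul_add]

lemma heat_const_mul (f : Evec n → ℝ) (c s : ℝ) (x : Evec n) :
    heat (fun x => c * f x) s x = c * heat f s x := by
  unfold heat
  rw [← integral_const_mul]
  congr 1 with z
  simp only [smul_eq_mul]; ring

lemma integral_heat_dl_mul {a b : Evec n → ℝ} (ha : IsTest a) (hb : IsTest b) (l : Fin n) (s : ℝ) :
    ∫ x, heat (dl l a) s x * heat b s x = -∫ x, heat a s x * heat (dl l b) s x := by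
  have hprod : ∀ {u v : Evec n → ℝ}, IsTest u → IsTest v →
      Integrable (fun x => heat u s x * heat v s x) := fun {u v} hu hv => by
    obtain ⟨M, -, hM⟩ := hv.bdd
    have hc := (continuous_heat hv).comp (Continuous.prodMk_right s)
    exact (integrable_heat hu s).mul_bdd (c := M) hc.aestronglyMeasurable
      (ae_of_all _ fun x => norm_heat_le hM s x)
  have e : ∀ {u : Evec n → ℝ}, IsTest u → ∀ x,
      fderiv ℝ (heat u s) x (EuclideanSpace.single l 1) = heat (dl l u) s x := fun {u} hu x => by
    rw [(hasFDerivAt_heat hu s x).fderiv, heat_fderiv_apply hu]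
  have := integral_mul_fderiv_eq_neg_fderiv_mul_of_integrable (μ := volume)
    (f := heat a s) (g := heat b s) (v := EuclideanSpace.single l 1)
    (by simp only [e ha]; exact hprod (ha.dl l) hb) (by simp only [e hb]; exact hprod ha (hb.dl l))
    (hprod ha hb) (fun x _ => (hasFDerivAt_heat ha s x).differentiableAt)
    (fun x _ => (hasFDerivAt_heat hb s x).differentiableAt)
  simp only [e ha, e hb] at this
  rw [this, neg_neg]

lemma integral_heat_dl_dl {w g : Evec n → ℝ} (hw : IsTest w) (hg : IsTest g) (k l : Fin n) (s : ℝ) :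
    ∫ x, heat (dl l (dl k w)) s x * heat (dl l g) s x =
      ∫ x, heat (dl l (dl l w)) s x * heat (dl k g) s x := by
  rw [dl_comm hw, integral_heat_dl_mul (hw.dl l) (hg.dl l), dl_comm hg,
    integral_heat_dl_mul (hw.dl l) (hg.dl k)]

lemma integral_mul_heat {D g : Evec n → ℝ} (hD : IsTest D) (hg : IsTest g) {T : ℝ} (hT : 0 ≤ T) :
    ∫ z : ℝ × Evec n, ∑ l, z.1 * (heat (dl l D) z.1 z.2 * heat (dl l g) z.1 z.2)
      ∂((volume.restrict (Ioc 0 T)).prod volume) =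
      ((∫ x, D x * g x) - ∫ x, heat D T x * heat g T x) / 2 := by
  have hQ : ContDiff ℝ 2 (fun z : ℝ × ℝ => z.1 * z.2) := by fun_prop
  have hH : ∀ z h : ℝ × ℝ, fderiv ℝ (fderiv ℝ (fun z : ℝ × ℝ => z.1 * z.2)) z h h
      = 2 * (h.1 * h.2) := fun z h => by
    have lin : ∀ a b : ℝ, HasSecondDeriv (fun t => a + t * b) (fun _ => b) 0 := fun a b =>
      ⟨fun t => (((hasDerivAt_id t).mul_const b).const_add a).congr_deriv (by simp),
        hasDerivAt_const 0 b⟩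
    rw [HasSecondDeriv.eq_fderiv_fderiv hQ ((lin z.1 h.1).mul (lin z.2 h.2))]
    ring
  obtain ⟨-, -, he⟩ := heat_flow (hD.prodMk hg) hQ hT
  simp only [hH, dl_prodMk hD hg, heat_prodMk hD hg, heat_prodMk (hD.dl _) (hg.dl _)] at he
  have i1 : Integrable (fun x => D x * g x) := by
    obtain ⟨M, -, hM⟩ := hg.bdd
    exact hD.integrable.mul_bdd (c := M) hg.continuous.aestronglyMeasurable
      (ae_of_all _ fun x => hM x)
  have i2 : Integrable (fun x => heat D T x * heat g T x) := by
    obtain ⟨M, -, hM⟩ := hg.bdd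
    have hc := (continuous_heat hg).comp (Continuous.prodMk_right T)
    exact (integrable_heat hD T).mul_bdd (c := M) hc.aestronglyMeasurable
      (ae_of_all _ fun x => norm_heat_le hM T x)
  rw [integral_sub i1 i2] at he
  rw [← he, eq_div_iff (by norm_num), ← integral_mul_const]
  congr 1 with z
  rw [Finset.sum_mul, Finset.mul_sum]
  exact Finset.sum_congr rfl fun l _ => by ring

/-- The entries of the symmetric gradient of the field with components `w`. -/
def symGrad (w : Fin n → Evec n → ℝ) (i j : Fin n) (x : Evec n) : ℝ :=
  (dl j (w i) x + dl i (w j) x) / 2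

lemma isTest_symGrad {w : Fin n → Evec n → ℝ} (hw : ∀ i, IsTest (w i)) (i j : Fin n) :
    IsTest (symGrad w i j) := by
  have := (((hw i).dl j).add ((hw j).dl i)).const_mul (1 / 2)
  refine (funext fun x => ?_ : (fun x => 1 / 2 * (dl j (w i) x + dl i (w j) x)) = symGrad w i j) ▸ this
  unfold symGrad; ring

lemma sum_dl_dl {w : Fin n → Evec n → ℝ} (hw : ∀ i, IsTest (w i)) (i j : Fin n) (x : Evec n) :
    dl j (dl j (w i)) x = 2 * dl j (symGrad w i j) x - dl i (symGrad w j j) x := by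
  have h : ∀ i j k, dl k (symGrad w i j) = fun x => 1 / 2 * (dl k (dl j (w i)) x + dl k (dl i (w j)) x)
      := fun i j k => by
    have e : symGrad w i j = fun x => 1 / 2 * (dl j (w i) x + dl i (w j) x) := by
      ext1 x; unfold symGrad; ring
    rw [e, dl_const_mul (((hw i).dl j).add ((hw j).dl i)), dl_add ((hw i).dl j) ((hw j).dl i)]
  rw [h, h, dl_comm (hw j) i j]
  ring

lemma heat_sum_dl_dl {w : Fin n → Evec n → ℝ} (hw : ∀ i, IsTest (w i)) (i j : Fin n) (s : ℝ)
    (x : Evec n) : heat (dl j (dl j (w i))) s x =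
      2 * heat (dl j (symGrad w i j)) s x - heat (dl i (symGrad w j j)) s x := by
  have h1 := (isTest_symGrad hw i j).dl j
  have h2 := (isTest_symGrad hw j j).dl i
  have e : dl j (dl j (w i)) = fun x => 2 * dl j (symGrad w i j) x + (-1) * dl i (symGrad w j j) x := by
    ext1 x; rw [sum_dl_dl hw]; ring
  rw [e, heat_add (h1.const_mul 2) (h2.const_mul (-1)), heat_const_mul, heat_const_mul]
  ring

lemma korn_dual {p q : ℝ} (hpq : p.HolderConjugate q) : ∃ C > 0, ∀ w : Fin n → Evec n → ℝ,
    (∀ i, IsTest (w i)) → ∀ g : Evec n → ℝ, IsTest g → ∀ i k : Fin n, ∀ lam > 0,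
      ∫ x, dl k (w i) x * g x ≤ C * (lam ^ p * ∑ a, ∑ b, ∫ x, |symGrad w a b x| ^ p) +
        C * (lam ^ (-q) * ∫ x, |g x| ^ q) := by
  obtain ⟨C, hC, hB⟩ := bilinear_embedding (n := n) hpq
  have hB' : ∀ f g : Evec n → ℝ, IsTest f → IsTest g → ∀ (j k : Fin n) (T : ℝ), 0 ≤ T → ∀ lam > 0,
      ∫ z : ℝ × Evec n, |z.1 * (heat (dl j f) z.1 z.2 * heat (dl k g) z.1 z.2)|
        ∂((volume.restrict (Ioc 0 T)).prod volume)
        ≤ C * (lam ^ p * ∫ x, |f x| ^ p) + C * (lam ^ (-q) * ∫ x, |g x| ^ q) := by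
    intro f g hf hg j k T hT lam hlam
    have := hB _ _ (hf.const_mul lam) (hg.const_mul lam⁻¹) j k T hT
    simp only [dl_const_mul hf, dl_const_mul hg, heat_const_mul] at this
    have e : ∀ z : ℝ × Evec n, z.1 * (lam * heat (dl j f) z.1 z.2 * (lam⁻¹ * heat (dl k g) z.1 z.2))
        = z.1 * (heat (dl j f) z.1 z.2 * heat (dl k g) z.1 z.2) := fun z => by field_simp
    simp only [e, abs_mul, abs_inv, abs_of_pos hlam, Real.mul_rpow hlam.le (abs_nonneg _),
      Real.mul_rpow (inv_nonneg.2 hlam.le) (abs_nonneg _), integral_const_mul, ← mul_add,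
      Real.inv_rpow hlam.le, ← Real.rpow_neg hlam.le] at this ⊢
    linarith
  refine ⟨6 * n * C + 1, by positivity, fun w hw g hg i k lam hlam => ?_⟩
  set E := ∑ a, ∑ b, ∫ x, |symGrad w a b x| ^ p with hE
  set G := ∫ x, |g x| ^ q with hG
  have hE0 : 0 ≤ E := Finset.sum_nonneg fun a _ => Finset.sum_nonneg fun b _ =>
    integral_nonneg fun x => by positivity
  have hG0 : 0 ≤ G := integral_nonneg fun x => by positivity
  have hEab : ∀ a b, ∫ x, |symGrad w a b x| ^ p ≤ E := fun a b =>
    (Finset.single_le_sum (f := fun b => ∫ x, |symGrad w a b x| ^ p)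
      (fun b _ => integral_nonneg fun x => by positivity) (Finset.mem_univ b)).trans
    (Finset.single_le_sum (f := fun a => ∑ b, ∫ x, |symGrad w a b x| ^ p)
      (fun a _ => Finset.sum_nonneg fun b _ => integral_nonneg fun x => by positivity)
      (Finset.mem_univ a))
  set B := C * (lam ^ p * E) + C * (lam ^ (-q) * G) with hBdef
  have hB0 : 0 ≤ B := by positivity
  have hBab : ∀ a b j T, 0 ≤ T → 
      ∫ z : ℝ × Evec n, |z.1 * (heat (dl j (symGrad w a b)) z.1 z.2 * heat (dl k g) z.1 z.2)|
        ∂((volume.restrict (Ioc 0 T)).prod volume) ≤ B := fun a b j T hT => by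
    refine (hB' _ _ (isTest_symGrad hw a b) hg j k T hT lam hlam).trans ?_
    have := hEab a b
    simp only [hBdef]
    gcongr
  obtain ⟨C1, hC1⟩ := norm_smul_heat_dl_le (hw i) k
  have hD := (hw i).dl k
  have main : ∀ T > 0, ∫ x, dl k (w i) x * g x ≤ 6 * n * B + C1 * (∫ x, ‖g x‖) * T⁻¹ := by
    intro T hT
    set μ : Measure (ℝ × Evec n) := (volume.restrict (Ioc 0 T)).prod volume with hμ
    have h1 := integral_mul_heat hD hg hT.le
    have h2 : ∫ x, heat (dl k (w i)) T x * heat g T x ≤ C1 * (∫ x, ‖g x‖) * T⁻¹ := by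
      have hb : ∀ x, heat (dl k (w i)) T x * heat g T x ≤ C1 * T⁻¹ * ‖heat g T x‖ := fun x => by
        have := hC1 T x
        rw [norm_smul, Real.norm_of_nonneg hT.le] at this
        refine (le_abs_self _).trans ?_
        rw [abs_mul, ← Real.norm_eq_abs, ← Real.norm_eq_abs]
        refine mul_le_mul_of_nonneg_right ?_ (norm_nonneg _)
        rw [← div_eq_mul_inv, le_div_iff₀ hT]; linarith
      have hC1' : 0 ≤ C1 := (norm_nonneg _).trans (hC1 0 0)
      have i2 : Integrable (fun x => heat (dl k (w i)) T x * heat g T x) := by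
        obtain ⟨M, -, hM⟩ := hg.bdd
        have hc := (continuous_heat hg).comp (Continuous.prodMk_right T)
        exact (integrable_heat hD T).mul_bdd (c := M) hc.aestronglyMeasurable
          (ae_of_all _ fun x => norm_heat_le hM T x)
      have h3 := integral_mono i2 ((integrable_heat hg T).norm.const_mul (C1 * T⁻¹)) hb
      rw [integral_const_mul] at h3
      have h4 := mul_le_mul_of_nonneg_left (integral_norm_heat_le hg T)
        (mul_nonneg hC1' (inv_nonneg.2 hT.le))
      linarith
    have i1 : ∀ {f g : Evec n → ℝ}, IsTest f → IsTest g → Integrable (fun z : ℝ × Evec n =>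
        z.1 * (heat f z.1 z.2 * heat g z.1 z.2)) μ := fun hf hg => integrable_heat_pair hf hg T
    have h3 : ∫ z : ℝ × Evec n, ∑ l, z.1 * (heat (dl l (dl k (w i))) z.1 z.2 *
        heat (dl l g) z.1 z.2) ∂μ = ∑ l, (2 * ∫ z : ℝ × Evec n, z.1 * (heat (dl l (symGrad w i l))
          z.1 z.2 * heat (dl k g) z.1 z.2) ∂μ - ∫ z : ℝ × Evec n, z.1 * (heat (dl i (symGrad w l l))
          z.1 z.2 * heat (dl k g) z.1 z.2) ∂μ) := by
      rw [integral_finsetSum _ fun l _ => i1 (hD.dl l) (hg.dl l)]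
      refine Finset.sum_congr rfl fun l _ => ?_
      have e1 : ∫ z : ℝ × Evec n, z.1 * (heat (dl l (dl k (w i))) z.1 z.2 *
          heat (dl l g) z.1 z.2) ∂μ = ∫ z : ℝ × Evec n, z.1 * (heat (dl l (dl l (w i))) z.1 z.2 *
          heat (dl k g) z.1 z.2) ∂μ := by
        rw [hμ, integral_prod _ (i1 (hD.dl l) (hg.dl l)),
          integral_prod _ (i1 (((hw i).dl l).dl l) (hg.dl k))]
        congr 1 with s
        simp only [integral_const_mul]
        rw [integral_heat_dl_dl (hw i) hg]
      have e2 := integral_sub ((i1 ((isTest_symGrad hw i l).dl l) (hg.dl k)).const_mul 2)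
        (i1 ((isTest_symGrad hw l l).dl i) (hg.dl k))
      rw [e1, ← integral_const_mul, ← e2]
      congr 1 with z
      rw [heat_sum_dl_dl hw]; ring
    have habs : ∀ a b j, |∫ z : ℝ × Evec n, z.1 * (heat (dl j (symGrad w a b))
          z.1 z.2 * heat (dl k g) z.1 z.2) ∂μ| ≤ B := fun a b j =>
      (abs_integral_le_integral_abs).trans (hBab a b j T hT.le)
    have h4 : ∑ l, (2 * ∫ z : ℝ × Evec n, z.1 * (heat (dl l (symGrad w i l))
          z.1 z.2 * heat (dl k g) z.1 z.2) ∂μ - ∫ z : ℝ × Evec n, z.1 * (heat (dl i (symGrad w l l))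
          z.1 z.2 * heat (dl k g) z.1 z.2) ∂μ) ≤ ∑ _l : Fin n, 3 * B := by
      refine Finset.sum_le_sum fun l _ => ?_
      have a1 := (abs_le.1 (habs i l l)).2
      have a2 := (abs_le.1 (habs l l i)).1
      linarith
    rw [Finset.sum_const, Finset.card_univ, Fintype.card_fin, nsmul_eq_mul] at h4
    linarith
  have lim : Tendsto (fun T : ℝ => 6 * n * B + C1 * (∫ x, ‖g x‖) * T⁻¹) atTop
      (𝓝 (6 * n * B + C1 * (∫ x, ‖g x‖) * 0)) :=
    (tendsto_inv_atTop_zero.const_mul _).const_add _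
  have h5 := ge_of_tendsto lim ((eventually_gt_atTop 0).mono main)
  have h6 : 0 ≤ lam ^ p * E + lam ^ (-q) * G := by positivity
  have h7 : 6 * n * B = 6 * n * C * (lam ^ p * E) + 6 * n * C * (lam ^ (-q) * G) := by
    simp only [hBdef]; ring
  linarith

lemma abs_mul_rpow_le {p κ D : ℝ} (hκ : 0 < κ) :
    |D * (D ^ 2 + κ) ^ ((p - 2) / 2)| ≤ (D ^ 2 + κ) ^ ((p - 1) / 2) := by
  have h0 : 0 < D ^ 2 + κ := by positivity
  rw [abs_mul, abs_of_pos (Real.rpow_pos_of_pos h0 _)]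
  calc |D| * (D ^ 2 + κ) ^ ((p - 2) / 2)
      ≤ (D ^ 2 + κ) ^ (1 / 2 : ℝ) * (D ^ 2 + κ) ^ ((p - 2) / 2) := by
        gcongr
        rw [← Real.sqrt_eq_rpow]
        exact Real.abs_le_sqrt (by linarith)
    _ = _ := by rw [← Real.rpow_add h0]; congr 1; ring

lemma tendsto_mul_rpow {p : ℝ} (D : ℝ) :
    Tendsto (fun κ : ℝ => D * (D ^ 2 + κ) ^ ((p - 2) / 2)) (𝓝[>] 0)
      (𝓝 (D * (D ^ 2) ^ ((p - 2) / 2))) := by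
  refine Tendsto.mono_left ?_ nhdsWithin_le_nhds
  by_cases hD : D = 0
  · simp [hD]
  · have h : ContinuousAt (fun κ : ℝ => D * (D ^ 2 + κ) ^ ((p - 2) / 2)) 0 :=
      (ContinuousAt.rpow_const (by fun_prop) (Or.inl (by simpa using hD))).const_mul D
    simpa [ContinuousAt] using h

lemma mul_mul_sq_rpow {p : ℝ} (hp : 1 < p) (D : ℝ) :
    D * (D * (D ^ 2) ^ ((p - 2) / 2)) = |D| ^ p := by
  rw [sq_rpow_half]
  by_cases hD : D = 0
  · simp [hD, show p ≠ 0 by linarith]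
  · rw [← mul_assoc, ← abs_mul_abs_self, show p = 1 + 1 + (p - 2) by ring,
      Real.rpow_add (abs_pos.2 hD), Real.rpow_add (abs_pos.2 hD), Real.rpow_one]
    ring_nf

lemma abs_mul_sq_rpow {p q : ℝ} (hpq : p.HolderConjugate q) (D : ℝ) :
    |D * (D ^ 2) ^ ((p - 2) / 2)| ^ q = |D| ^ p := by
  rw [sq_rpow_half]
  by_cases hD : D = 0
  · simp [hD, hpq.symm.ne_zero, hpq.ne_zero]
  · have h : |D * |D| ^ (p - 2)| = |D| ^ (p - 1) := by
      rw [abs_mul, abs_of_nonneg (Real.rpow_nonneg (abs_nonneg D) _),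
        show p - 1 = 1 + (p - 2) by ring, Real.rpow_add (abs_pos.2 hD), Real.rpow_one]
    rw [h, ← Real.rpow_mul (abs_nonneg D)]
    congr 1
    linarith [hpq.mul_eq_add]

/-- Korn's first inequality in `L^p` for test fields. -/
lemma korn_global {p : ℝ} (hp : 1 < p) : ∃ C > 0, ∀ w : Fin n → Evec n → ℝ,
    (∀ i, IsTest (w i)) → ∀ i k : Fin n,
      ∫ x, |dl k (w i) x| ^ p ≤ C * ∑ a, ∑ b, ∫ x, |symGrad w a b x| ^ p := by
  obtain ⟨q, hpq⟩ : ∃ q, p.HolderConjugate q := ⟨_, Real.HolderConjugate.conjExponent hp⟩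
  obtain ⟨C, hC, hdual⟩ := korn_dual (n := n) hpq
  have hq1 := hpq.symm.lt
  have hrel : (p - 1) * q = p := by linarith [hpq.mul_eq_add]
  set lam := (2 * C) ^ (1 / q) with hlam
  have hlam0 : 0 < lam := by positivity
  have hlamq : C * lam ^ (-q) = 1 / 2 := by
    rw [hlam, ← Real.rpow_mul (by positivity), show 1 / q * -q = -1 by field_simp,
      Real.rpow_neg_one]
    field_simp
  refine ⟨2 * C * lam ^ p, by positivity, fun w hw i k => ?_⟩
  have hD := (hw i).dl k
  set D := dl k (w i) with hDdef
  obtain ⟨M, hM0, hM⟩ := hD.bdd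
  set g : ℝ → Evec n → ℝ := fun κ x => D x * (D x ^ 2 + κ) ^ ((p - 2) / 2) with hg
  have hgt : ∀ κ > 0, IsTest (g κ) := fun κ hκ => by
    refine ⟨hD.smooth.mul (((hD.smooth.pow 2).add contDiff_const).rpow_const_of_ne
      (fun x => by positivity)), ?_⟩
    exact hD.supp.comp_left (g := fun t : ℝ => t * (t ^ 2 + κ) ^ ((p - 2) / 2)) (by simp)
  set E := ∑ a, ∑ b, ∫ x, |symGrad w a b x| ^ p
  have hineq : ∀ κ > 0, ∫ x, D x * g κ x ≤ C * (lam ^ p * E) + C * (lam ^ (-q) * ∫ x, |g κ x| ^ q) :=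
    fun κ hκ => hdual w hw _ (hgt κ hκ) i k lam hlam0
  have hgb : ∀ κ > 0, κ ≤ 1 → ∀ x, |g κ x| ≤ indicator (tsupport D)
      (fun _ => (M ^ 2 + 1) ^ ((p - 1) / 2)) x := by
    intro κ hκ hκ1 x
    by_cases hx : x ∈ tsupport D
    · rw [indicator_of_mem hx]
      refine (abs_mul_rpow_le hκ).trans (Real.rpow_le_rpow (by positivity) ?_ (by linarith))
      have := sq_le_sq' (neg_le_of_abs_le (hM x)) (le_of_abs_le (hM x))
      linarith
    · rw [indicator_of_notMem hx]
      simp [hg, image_eq_zero_of_notMem_tsupport hx]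
  have hK : IsCompact (tsupport D) := hD.supp
  have hind : ∀ c : ℝ, Integrable (indicator (tsupport D) (fun _ : Evec n => c)) := fun c =>
    (integrableOn_const hK.measure_ne_top).integrable_indicator hK.measurableSet
  have hsmall : ∀ᶠ κ : ℝ in 𝓝[>] 0, 0 < κ ∧ κ ≤ 1 := by
    filter_upwards [Ioc_mem_nhdsGT (zero_lt_one' ℝ)] with κ hκ using hκ
  have lim1 : Tendsto (fun κ => ∫ x, D x * g κ x) (𝓝[>] 0) (𝓝 (∫ x, |D x| ^ p)) := by
    refine tendsto_integral_filter_of_dominated_convergence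
      (indicator (tsupport D) (fun _ => M * (M ^ 2 + 1) ^ ((p - 1) / 2))) ?_ ?_ (hind _)
      (ae_of_all _ fun x => ?_)
    · filter_upwards [hsmall] with κ hκ
      exact (hD.continuous.mul (hgt κ hκ.1).continuous).aestronglyMeasurable
    · filter_upwards [hsmall] with κ hκ
      refine ae_of_all _ fun x => ?_
      have h1 := hgb κ hκ.1 hκ.2 x
      have h2 : |D x| ≤ M := hM x
      rw [Real.norm_eq_abs, abs_mul]
      by_cases hx : x ∈ tsupport D
      · rw [indicator_of_mem hx] at h1 ⊢
        gcongr
      · rw [indicator_of_notMem hx, image_eq_zero_of_notMem_tsupport hx]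
        simp
    · have := (tendsto_mul_rpow (p := p) (D x)).const_mul (D x)
      rwa [mul_mul_sq_rpow hp] at this
  have lim2 : Tendsto (fun κ => ∫ x, |g κ x| ^ q) (𝓝[>] 0) (𝓝 (∫ x, |D x| ^ p)) := by
    refine tendsto_integral_filter_of_dominated_convergence
      (indicator (tsupport D) (fun _ => ((M ^ 2 + 1) ^ ((p - 1) / 2)) ^ q)) ?_ ?_ (hind _)
      (ae_of_all _ fun x => ?_)
    · filter_upwards [hsmall] with κ hκ
      exact ((hgt κ hκ.1).continuous.abs.rpow_const
        fun x => Or.inr (by linarith)).aestronglyMeasurable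
    · filter_upwards [hsmall] with κ hκ
      refine ae_of_all _ fun x => ?_
      have h1 := hgb κ hκ.1 hκ.2 x
      rw [Real.norm_of_nonneg (by positivity)]
      by_cases hx : x ∈ tsupport D
      · rw [indicator_of_mem hx] at h1 ⊢
        exact Real.rpow_le_rpow (abs_nonneg _) h1 (by linarith)
      · rw [indicator_of_notMem hx] at h1 ⊢
        rw [le_antisymm h1 (abs_nonneg _), Real.zero_rpow (by linarith)]
    · have := ((tendsto_mul_rpow (p := p) (D x)).abs).rpow_const (p := q) (Or.inr (by linarith))
      rwa [abs_mul_sq_rpow hpq] at this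
  have key := le_of_tendsto_of_tendsto lim1 ((lim2.const_mul (lam ^ (-q))).const_mul C |>.const_add
    (C * (lam ^ p * E))) (eventually_mem_nhdsWithin.mono hineq)
  have e : C * (lam ^ (-q) * ∫ x, |D x| ^ p) = 1 / 2 * ∫ x, |D x| ^ p := by rw [← hlamq]; ring
  rw [e] at key
  linarith

end GlobalKorn

section Averages

lemma lintegral_rpow_le_measure_mul {α : Type*} [MeasurableSpace α] {μ : Measure α} {p : ℝ}
    (hp : 1 < p) {h : α → ℝ≥0∞} (hh : AEMeasurable h μ) :
    (∫⁻ x, h x ∂μ) ^ p ≤ μ univ ^ (p - 1) * ∫⁻ x, h x ^ p ∂μ := by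
  have hpq := Real.HolderConjugate.conjExponent hp
  set q := p.conjExponent
  have h1 := ENNReal.lintegral_mul_le_Lp_mul_Lq μ hpq hh (aemeasurable_const (b := (1 : ℝ≥0∞)))
  simp only [Pi.mul_apply, mul_one, ENNReal.one_rpow, lintegral_one] at h1
  have hp0 : 0 ≤ p := by linarith
  have h2 := ENNReal.rpow_le_rpow h1 hp0
  rw [ENNReal.mul_rpow_of_nonneg _ _ hp0, ← ENNReal.rpow_mul, ← ENNReal.rpow_mul,
    one_div_mul_cancel (by linarith), ENNReal.rpow_one] at h2
  have e : 1 / q * p = p - 1 := by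
    have := hpq.symm.pos
    field_simp
    linarith [hpq.mul_eq_add]
  rw [e, mul_comm] at h2
  exact h2

end Averages

section KornPoincare

variable {n : ℕ}

lemma lintegral_comp_affine (G : Evec n → ℝ≥0∞) (hG : Measurable G) (c : Evec n) {r : ℝ} (hr : 0 < r) :
    ∫⁻ y, G (r • y + c) = ENNReal.ofReal ((r ^ n)⁻¹) * ∫⁻ y, G y := by
  have h1 := lintegral_map (μ := (volume : Measure (Evec n))) (f := fun y => G (y + c))
    (g := fun y => r • y) (by fun_prop) (by fun_prop)
  rw [← h1, Measure.map_addHaar_smul _ hr.ne', lintegral_smul_measure,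
    lintegral_add_right_eq_self]
  simp [abs_of_pos hr]

lemma lintegral_comp_affine_le (G : Evec n → ℝ≥0∞) (hG : Measurable G) (c : Evec n) {r : ℝ}
    (hr : 1 / 2 ≤ r) : ∫⁻ y, G (r • y + c) ≤ 2 ^ n * ∫⁻ y, G y := by
  rw [lintegral_comp_affine G hG c (by linarith)]
  gcongr
  have : ((r ^ n)⁻¹) ≤ 2 ^ n := by
    rw [← inv_pow]
    have h0 : (0 : ℝ) < r := by linarith
    gcongr
    rw [inv_le_comm₀ h0 two_pos]
    linarith
  calc ENNReal.ofReal ((r ^ n)⁻¹) ≤ ENNReal.ofReal (2 ^ n) := ENNReal.ofReal_le_ofReal this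
    _ = 2 ^ n := by rw [ENNReal.ofReal_pow (by norm_num)]; simp

lemma lintegral_segment_le {B : Set (Evec n)} (hB : Convex ℝ B) (hBm : MeasurableSet B)
    (G : Evec n → ℝ≥0∞) (hG : Measurable G) :
    ∫⁻ x in B, ∫⁻ y in B, ∫⁻ t in Ioc (0 : ℝ) 1, G (y + t • (x - y)) ≤
      2 ^ n * volume B * ∫⁻ x in B, G x := by
  set G' := B.indicator G with hG'
  have hG'm : Measurable G' := hG.indicator hBm
  have key : ∀ t ∈ Ioc (0 : ℝ) 1, ∫⁻ x in B, ∫⁻ y in B, G' (y + t • (x - y)) ≤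
      2 ^ n * volume B * ∫⁻ x, G' x := by
    intro t ht
    have aux : ∀ (f : Evec n → Evec n → ℝ≥0∞), (∀ x, ∫⁻ y, f x y ≤ 2 ^ n * ∫⁻ x, G' x) →
        ∫⁻ x in B, ∫⁻ y in B, f x y ≤ 2 ^ n * volume B * ∫⁻ x, G' x := by
      intro f hf
      calc _ ≤ ∫⁻ x in B, 2 ^ n * ∫⁻ x, G' x :=
            lintegral_mono fun x => (setLIntegral_le_lintegral _ _).trans (hf x)
        _ = _ := by rw [setLIntegral_const]; ring
    rcases le_total t (1 / 2) with h | h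
    · apply aux
      intro x
      convert! lintegral_comp_affine_le G' hG'm (t • x) (r := 1 - t) (by linarith) using 4
      module
    · rw [lintegral_lintegral_swap (Measurable.aemeasurable (by fun_prop))]
      apply aux
      intro y
      convert! lintegral_comp_affine_le G' hG'm ((1 - t) • y) (r := t) h using 4
      module
  calc _ ≤ ∫⁻ x in B, ∫⁻ y in B, ∫⁻ t in Ioc (0 : ℝ) 1, G' (y + t • (x - y)) := by
        refine setLIntegral_mono' hBm fun x hx => setLIntegral_mono' hBm fun y hy =>
          setLIntegral_mono' measurableSet_Ioc fun t ht => ?_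
        rw [hG', indicator_of_mem]
        exact hB.add_smul_sub_mem hy hx ⟨ht.1.le, ht.2⟩
    _ = ∫⁻ x in B, ∫⁻ t in Ioc (0 : ℝ) 1, ∫⁻ y in B, G' (y + t • (x - y)) := by
        congr 1 with x
        rw [lintegral_lintegral_swap (Measurable.aemeasurable (by fun_prop))]
    _ = ∫⁻ t in Ioc (0 : ℝ) 1, ∫⁻ x in B, ∫⁻ y in B, G' (y + t • (x - y)) := by
        rw [lintegral_lintegral_swap]
        refine Measurable.aemeasurable (Measurable.lintegral_prod_right' (f := fun z : (Evec n × ℝ) × Evec n =>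
          G' (z.2 + z.1.2 • (z.1.1 - z.2))) (by fun_prop))
    _ ≤ ∫⁻ t in Ioc (0 : ℝ) 1, 2 ^ n * volume B * ∫⁻ x, G' x :=
        setLIntegral_mono' measurableSet_Ioc key
    _ = _ := by
        rw [setLIntegral_const, hG', lintegral_indicator hBm]
        simp

/-- A standard normalized bump function. -/
def stdBump (n : ℕ) : ContDiffBump (0 : Evec n) := ⟨1 / 4, 1 / 2, by norm_num, by norm_num⟩

lemma isTest_normed (φ : ContDiffBump (0 : Evec n)) : IsTest (φ.normed volume) :=
  ⟨φ.contDiff_normed, φ.hasCompactSupport_normed⟩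

lemma fderiv_apply_eq_sum (f : Evec n → ℝ) (x e : Evec n) :
    fderiv ℝ f x e = ∑ l, e l * dl l f x := by
  conv_lhs => rw [sum_single e]
  simp [map_sum, dl]

lemma sum_sub_mul_sub {w : Fin n → Evec n → ℝ} (hw : ∀ i, IsTest (w i)) (x y : Evec n) :
    ∑ k, (w k x - w k y) * (x k - y k) = ∫ t in (0 : ℝ)..1,
      ∑ k, ∑ l, (x k - y k) * (x l - y l) * symGrad w k l (y + t • (x - y)) := by
  have hd : ∀ t : ℝ, HasDerivAt (fun t : ℝ => ∑ k, w k (y + t • (x - y)) * (x k - y k))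
      (∑ k, ∑ l, (x k - y k) * (x l - y l) * symGrad w k l (y + t • (x - y))) t := by
    intro t
    have h1 : ∀ k, HasDerivAt (fun t : ℝ => w k (y + t • (x - y)) * (x k - y k))
        ((∑ l, (x l - y l) * dl l (w k) (y + t • (x - y))) * (x k - y k)) t := by
      intro k
      have h2 : HasDerivAt (fun t : ℝ => y + t • (x - y)) (x - y) t := by
        simpa using ((hasDerivAt_id t).smul_const (x - y)).const_add y
      have h3 := ((hw k).differentiable (y + t • (x - y))).hasFDerivAt
      have h4 := (HasFDerivAt.comp_hasDerivAt t h3 h2).mul_const (x k - y k)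
      refine h4.congr_deriv ?_
      congr 1
      simp [fderiv_apply_eq_sum]
    refine (HasDerivAt.fun_sum fun k _ => h1 k).congr_deriv ?_
    have e : ∑ k, ∑ l, (x k - y k) * (x l - y l) * dl k (w l) (y + t • (x - y)) =
        ∑ k, ∑ l, (x k - y k) * (x l - y l) * dl l (w k) (y + t • (x - y)) := by
      rw [Finset.sum_comm]
      refine Finset.sum_congr rfl fun k _ => Finset.sum_congr rfl fun l _ => by ring
    have e2 : ∑ k, ∑ l, (x k - y k) * (x l - y l) * symGrad w k l (y + t • (x - y)) =
        ((∑ k, ∑ l, (x k - y k) * (x l - y l) * dl l (w k) (y + t • (x - y))) +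
        ∑ k, ∑ l, (x k - y k) * (x l - y l) * dl k (w l) (y + t • (x - y))) / 2 := by
      rw [← Finset.sum_add_distrib, Finset.sum_div]
      refine Finset.sum_congr rfl fun k _ => ?_
      rw [← Finset.sum_add_distrib, Finset.sum_div]
      refine Finset.sum_congr rfl fun l _ => ?_
      rw [symGrad]; ring
    rw [e2, e, add_self_div_two]
    refine Finset.sum_congr rfl fun k _ => ?_
    rw [Finset.sum_mul]
    refine Finset.sum_congr rfl fun l _ => by ring
  rw [intervalIntegral.integral_eq_sub_of_hasDerivAt (fun t _ => hd t)]
  · simp only [one_smul, zero_smul, add_zero, add_sub_cancel, ← Finset.sum_sub_distrib]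
    refine Finset.sum_congr rfl fun k _ => by ring
  · apply Continuous.intervalIntegrable
    have := fun k l => (isTest_symGrad hw k l).continuous
    fun_prop

end KornPoincare

section KornPoincare

variable {n : ℕ}

lemma IsTest.mul_left {f g : Evec n → ℝ} (hf : ContDiff ℝ (⊤ : ℕ∞) f) (hg : IsTest g) :
    IsTest (fun x => f x * g x) :=
  ⟨hf.mul hg.smooth, hg.supp.mul_left⟩

lemma dl_mul {f g : Evec n → ℝ} {x : Evec n} (hf : DifferentiableAt ℝ f x)
    (hg : DifferentiableAt ℝ g x) (l : Fin n) :
    dl l (fun x => f x * g x) x = f x * dl l g x + dl l f x * g x := by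
  simp only [dl]
  rw [fderiv_fun_mul hf hg]
  simp
  ring

lemma dl_coord (k l : Fin n) (x : Evec n) : dl l (fun x : Evec n => x k) x = if k = l then 1 else 0 := by
  have h : HasFDerivAt (fun x : Evec n => x k) (EuclideanSpace.proj k : Evec n →L[ℝ] ℝ) x :=
    (EuclideanSpace.proj k : Evec n →L[ℝ] ℝ).hasFDerivAt
  simp [dl, h.fderiv]

lemma integral_dl {f : Evec n → ℝ} (hf : IsTest f) (l : Fin n) : ∫ x, dl l f x = 0 :=
  integral_fderiv_apply_eq_zero hf.integrable _ hf.differentiable (hf.dl l).integrable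

lemma integral_sub_mul_dl {φ : Evec n → ℝ} (hφ : IsTest φ) (hφ1 : ∫ x, φ x = 1) (i k : Fin n) (x : Evec n) :
    ∫ y : Evec n, (x k - y k) * dl i φ y = if k = i then 1 else 0 := by
  have h0 : ContDiff ℝ (⊤ : ℕ∞) (fun y : Evec n => x k - y k) := by fun_prop
  have h1 := integral_dl (IsTest.mul_left h0 hφ) i
  have h2 : ∀ y, dl i (fun y => (x k - y k) * φ y) y =
      (x k - y k) * dl i φ y - (if k = i then 1 else 0) * φ y := by
    intro y
    rw [dl_mul (h0.differentiable (by simp) y) (hφ.differentiable y)]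
    have : dl i (fun y : Evec n => x k - y k) y = - dl i (fun y : Evec n => y k) y := by
      simp [dl, fderiv_const_sub]
    rw [this, dl_coord]; ring
  simp_rw [h2] at h1
  rw [integral_sub (IsTest.mul_left h0 (hφ.dl i)).integrable (hφ.integrable.const_mul _),
    integral_const_mul, hφ1] at h1
  linarith

lemma integral_mul_dl {f φ : Evec n → ℝ} (hf : IsTest f) (hφ : IsTest φ) (i : Fin n) :
    ∫ y, f y * dl i φ y = - ∫ y, dl i f y * φ y := by
  have h1 := integral_dl (IsTest.mul_left hf.smooth hφ) i
  simp_rw [fun y => dl_mul (hf.differentiable y) (hφ.differentiable y) i] at h1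
  rw [integral_add (IsTest.mul_left hf.smooth (hφ.dl i)).integrable
    (IsTest.mul_left (hf.dl i).smooth hφ).integrable] at h1
  linarith

/-- The affine field `x ↦ A x + c` approximating `w`. -/
def rigidMat (φ : Evec n → ℝ) (w : Fin n → Evec n → ℝ) (i k : Fin n) : ℝ := ∫ y, w k y * dl i φ y

lemma rigidMat_add {φ : Evec n → ℝ} (hφ : IsTest φ) {w : Fin n → Evec n → ℝ} (hw : ∀ i, IsTest (w i))
    (i k : Fin n) : rigidMat φ w i k + rigidMat φ w k i = - 2 * ∫ y, symGrad w i k y * φ y := by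
  rw [rigidMat, rigidMat, integral_mul_dl (hw k) hφ, integral_mul_dl (hw i) hφ, ← neg_add,
    ← integral_add (IsTest.mul_left ((hw k).dl i).smooth hφ).integrable
      (IsTest.mul_left ((hw i).dl k).smooth hφ).integrable, neg_mul, ← integral_const_mul]
  congr 2 with y
  rw [symGrad]; ring

lemma sub_rigid_eq {φ : Evec n → ℝ} (hφ : IsTest φ) (hφ1 : ∫ x, φ x = 1)
    {w : Fin n → Evec n → ℝ} (hw : ∀ i, IsTest (w i)) (i : Fin n) (x : Evec n) :
    w i x - (-∫ y, (∑ k, y k * w k y) * dl i φ y) - ∑ k, rigidMat φ w i k * x k =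
      ∫ y, (∑ k, (w k x - w k y) * (x k - y k)) * dl i φ y := by
  have hs : IsTest (fun y => (∑ k, y k * w k y) * dl i φ y) := by
    refine IsTest.mul_left ?_ (hφ.dl i)
    have := fun k => (hw k).smooth
    fun_prop
  have e : ∀ y : Evec n, (∑ k, (w k x - w k y) * (x k - y k)) * dl i φ y =
      ((∑ k, w k x * ((x k - y k) * dl i φ y)) - ∑ k, x k * (w k y * dl i φ y)) +
      (∑ k, y k * w k y) * dl i φ y := by
    intro y
    simp only [Finset.sum_mul, ← Finset.sum_sub_distrib, ← Finset.sum_add_distrib]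
    refine Finset.sum_congr rfl fun k _ => by ring
  have i1 : ∀ k, Integrable (fun y : Evec n => w k x * ((x k - y k) * dl i φ y)) := fun k =>
    (IsTest.mul_left (by fun_prop) (hφ.dl i)).integrable.const_mul _
  have i2 : ∀ k, Integrable (fun y : Evec n => x k * (w k y * dl i φ y)) := fun k =>
    (IsTest.mul_left (hw k).smooth (hφ.dl i)).integrable.const_mul _
  simp_rw [e]
  have I1 : Integrable (fun y : Evec n => ∑ k, w k x * ((x k - y k) * dl i φ y)) :=
    integrable_finsetSum _ fun k _ => i1 k
  have I2 : Integrable (fun y : Evec n => ∑ k, x k * (w k y * dl i φ y)) :=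
    integrable_finsetSum _ fun k _ => i2 k
  have I3 : Integrable (fun y : Evec n => (∑ k, w k x * ((x k - y k) * dl i φ y)) -
      ∑ k, x k * (w k y * dl i φ y)) := I1.sub I2
  rw [integral_add I3 hs.integrable, integral_sub I1 I2,
    integral_finsetSum _ fun k _ => i1 k, integral_finsetSum _ fun k _ => i2 k]
  simp_rw [integral_const_mul, integral_sub_mul_dl hφ hφ1, rigidMat]
  simp [mul_comm]
  ring

end KornPoincare

section KornPoincare

variable {n : ℕ}

lemma rpow_sum_sum_le {ι κ : Type*} [Fintype ι] [Fintype κ] (f : ι → κ → ℝ≥0∞) {p : ℝ} (hp : 1 < p) :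
    (∑ a, ∑ b, f a b) ^ p ≤
      (Fintype.card ι : ℝ≥0∞) ^ (p - 1) * (Fintype.card κ : ℝ≥0∞) ^ (p - 1) * ∑ a, ∑ b, f a b ^ p := by
  refine (ENNReal.rpow_sum_le_const_mul_sum_rpow _ _ hp.le).trans ?_
  rw [Finset.card_univ, mul_assoc, Finset.mul_sum _ _ ((Fintype.card κ : ℝ≥0∞) ^ (p - 1))]
  refine mul_le_mul_right (Finset.sum_le_sum fun a _ => ?_) _
  refine (ENNReal.rpow_sum_le_const_mul_sum_rpow _ _ hp.le).trans ?_
  rw [Finset.card_univ]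

/-- The `p`-energy of the symmetric gradient over a set. -/
def symEnergy (p : ℝ) (B : Set (Evec n)) (w : Fin n → Evec n → ℝ) : ℝ≥0∞ :=
  ∑ a, ∑ b, ∫⁻ x in B, ‖symGrad w a b x‖ₑ ^ p

lemma lintegral_sum_rpow_le {w : Fin n → Evec n → ℝ} (hw : ∀ i, IsTest (w i)) {p : ℝ} (hp : 1 < p)
    (B : Set (Evec n)) : ∫⁻ x in B, (∑ a, ∑ b, ‖symGrad w a b x‖ₑ) ^ p ≤
      (n : ℝ≥0∞) ^ (p - 1) * (n : ℝ≥0∞) ^ (p - 1) * symEnergy p B w := by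
  have hm : ∀ a b, Measurable (symGrad w a b) := fun a b => (isTest_symGrad hw a b).continuous.measurable
  refine (lintegral_mono fun x => rpow_sum_sum_le (fun a b => ‖symGrad w a b x‖ₑ) hp).trans ?_
  rw [lintegral_const_mul _ (by fun_prop), lintegral_finsetSum _ (by fun_prop), symEnergy]
  simp only [Fintype.card_fin]
  gcongr
  rw [lintegral_finsetSum _ (by fun_prop)]

lemma abs_coord_le_norm (x : Evec n) (k : Fin n) : |x k| ≤ ‖x‖ := by
  simpa using PiLp.norm_apply_le x k

lemma enorm_sum_sub_mul_sub_le {w : Fin n → Evec n → ℝ} (hw : ∀ i, IsTest (w i)) {x y : Evec n}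
    (hx : x ∈ Metric.ball (0 : Evec n) 1) (hy : y ∈ Metric.ball (0 : Evec n) 1) :
    ‖∑ k, (w k x - w k y) * (x k - y k)‖ₑ ≤
      4 * ∫⁻ t in Ioc (0 : ℝ) 1, ∑ a, ∑ b, ‖symGrad w a b (y + t • (x - y))‖ₑ := by
  have hm : ∀ a b, Continuous (symGrad w a b) := fun a b => (isTest_symGrad hw a b).continuous
  have hxy : ∀ k, ‖x k - y k‖ₑ ≤ 2 := by
    intro k
    rw [← ofReal_norm]
    refine le_of_le_of_eq (ENNReal.ofReal_le_ofReal ?_) (ENNReal.ofReal_ofNat 2)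
    have h1 := abs_coord_le_norm (x - y) k
    have h2 := norm_sub_le x y
    simp only [mem_ball_zero_iff] at hx hy
    rw [Real.norm_eq_abs]
    simp only [PiLp.sub_apply] at h1
    linarith
  rw [sum_sub_mul_sub hw, intervalIntegral.integral_of_le zero_le_one]
  refine (enorm_integral_le_lintegral_enorm _).trans ?_
  rw [← lintegral_const_mul _ (Continuous.measurable (by fun_prop))]
  refine lintegral_mono fun t => ?_
  dsimp only
  rw [Finset.mul_sum]
  refine (enorm_sum_le _ _).trans (Finset.sum_le_sum fun k _ => ?_)
  rw [Finset.mul_sum]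
  refine (enorm_sum_le _ _).trans (Finset.sum_le_sum fun l _ => ?_)
  rw [enorm_mul, enorm_mul]
  gcongr
  calc _ ≤ (2 : ℝ≥0∞) * 2 := by gcongr <;> apply hxy
    _ = 4 := by norm_num

lemma IsTest.enorm_bdd {f : Evec n → ℝ} (hf : IsTest f) : ∃ M : ℝ≥0∞, M ≠ ⊤ ∧ ∀ x, ‖f x‖ₑ ≤ M := by
  obtain ⟨M, -, hM⟩ := hf.bdd
  exact ⟨ENNReal.ofReal M, ENNReal.ofReal_ne_top, fun x => by
    rw [← ofReal_norm]; exact ENNReal.ofReal_le_ofReal (hM x)⟩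

lemma exists_unif_bdd {ι : Type*} [Finite ι] {f : ι → Evec n → ℝ} (hf : ∀ i, IsTest (f i)) :
    ∃ M : ℝ≥0∞, M ≠ ⊤ ∧ ∀ i x, ‖f i x‖ₑ ≤ M := by
  cases nonempty_fintype ι
  choose M hM h using fun i => (hf i).enorm_bdd
  exact ⟨∑ i, M i, by simpa using hM, fun i x => (h i x).trans
    (Finset.single_le_sum (f := M) (fun _ _ => zero_le) (Finset.mem_univ i))⟩

lemma korn_poincare {p : ℝ} (hp : 1 < p) {φ : Evec n → ℝ} (hφ : IsTest φ) (hφ1 : ∫ x, φ x = 1)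
    (hφs : Function.support φ ⊆ Metric.ball 0 1)
    (hφs' : ∀ i, Function.support (dl i φ) ⊆ Metric.ball 0 1) :
    ∃ C : ℝ≥0∞, C ≠ ⊤ ∧ ∀ w : Fin n → Evec n → ℝ, (∀ i, IsTest (w i)) → 
      (∀ i, ∃ c : ℝ, ∫⁻ x in Metric.ball 0 1, ‖w i x - c - ∑ k, rigidMat φ w i k * x k‖ₑ ^ p ≤
        C * symEnergy p (Metric.ball 0 1) w) ∧
      ∀ i k, ‖rigidMat φ w i k + rigidMat φ w k i‖ₑ ^ p ≤ C * symEnergy p (Metric.ball 0 1) w := by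
  set B := Metric.ball (0 : Evec n) 1 with hB
  have hBm : MeasurableSet B := Metric.isOpen_ball.measurableSet
  have hvB : volume B ≠ ⊤ := measure_ball_lt_top.ne
  obtain ⟨M1, hM1, hM1b⟩ := exists_unif_bdd (fun i => hφ.dl i)
  obtain ⟨M2, hM2, hM2b⟩ := hφ.enorm_bdd
  have hp0 : 0 ≤ p := by linarith
  set N : ℝ≥0∞ := (n : ℝ≥0∞) ^ (p - 1) * (n : ℝ≥0∞) ^ (p - 1) with hN
  have hNt : N ≠ ⊤ := ENNReal.mul_ne_top
    (ENNReal.rpow_ne_top_of_nonneg (by linarith) (by simp))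
    (ENNReal.rpow_ne_top_of_nonneg (by linarith) (by simp))
  set C1 : ℝ≥0∞ := (4 * M1) ^ p * volume B ^ (p - 1) * (2 ^ n * volume B * N) with hC1
  set C2 : ℝ≥0∞ := (2 * M2) ^ p * volume B ^ (p - 1) with hC2
  have hC1t : C1 ≠ ⊤ := by
    refine ENNReal.mul_ne_top (ENNReal.mul_ne_top (ENNReal.rpow_ne_top_of_nonneg hp0 ?_)
      (ENNReal.rpow_ne_top_of_nonneg (by linarith) hvB)) (ENNReal.mul_ne_top (ENNReal.mul_ne_top ?_ hvB) hNt)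
    · exact ENNReal.mul_ne_top (by simp) hM1
    · simp
  have hC2t : C2 ≠ ⊤ := by
    refine ENNReal.mul_ne_top (ENNReal.rpow_ne_top_of_nonneg hp0 (ENNReal.mul_ne_top (by simp) hM2))
      (ENNReal.rpow_ne_top_of_nonneg (by linarith) hvB)
  refine ⟨C1 + C2, by simp [hC1t, hC2t], fun w hw => ⟨fun i => ⟨-∫ y, (∑ k, y k * w k y) * dl i φ y, ?_⟩, fun i k => ?_⟩⟩
  · set S : Evec n → ℝ≥0∞ := fun x => ∑ a, ∑ b, ‖symGrad w a b x‖ₑ with hS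
    have hSm : Measurable S := by
      have hm : ∀ a b, Measurable (symGrad w a b) := fun a b => (isTest_symGrad hw a b).continuous.measurable
      fun_prop
    have h1 : ∀ x ∈ B, ‖w i x - (-∫ y, (∑ k, y k * w k y) * dl i φ y) - ∑ k, rigidMat φ w i k * x k‖ₑ ^ p ≤
        (4 * M1) ^ p * volume B ^ (p - 1) *
          ∫⁻ y in B, ∫⁻ t in Ioc (0 : ℝ) 1, S (y + t • (x - y)) ^ p := by
      intro x hx
      rw [sub_rigid_eq hφ hφ1 hw]
      have h2 : ‖∫ y, (∑ k, (w k x - w k y) * (x k - y k)) * dl i φ y‖ₑ ≤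
          ∫⁻ y in B, 4 * M1 * ∫⁻ t in Ioc (0 : ℝ) 1, S (y + t • (x - y)) := by
        refine (enorm_integral_le_lintegral_enorm _).trans ?_
        rw [← setLIntegral_eq_of_support_subset (s := B)]
        · refine setLIntegral_mono' hBm fun y hy => ?_
          rw [enorm_mul, mul_right_comm]
          gcongr
          · exact enorm_sum_sub_mul_sub_le hw hx hy
          · exact hM1b _ _
        · intro y hy
          apply hφs' i
          intro h0
          simp [h0] at hy
      rw [lintegral_const_mul _ (Measurable.lintegral_prod_right'
        (f := fun z : Evec n × ℝ => S (z.1 + z.2 • (x - z.1))) (by fun_prop))] at h2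
      refine (ENNReal.rpow_le_rpow h2 hp0).trans ?_
      rw [ENNReal.mul_rpow_of_nonneg _ _ hp0, mul_assoc]
      gcongr
      refine (lintegral_rpow_le_measure_mul hp (Measurable.lintegral_prod_right'
        (f := fun z : Evec n × ℝ => S (z.1 + z.2 • (x - z.1))) (by fun_prop)).aemeasurable).trans ?_
      rw [Measure.restrict_apply_univ]
      gcongr with y
      refine (lintegral_rpow_le_measure_mul hp (Measurable.aemeasurable (by fun_prop))).trans ?_
      simp
    refine (setLIntegral_mono' hBm h1).trans ?_
    rw [lintegral_const_mul']
    swap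
    · exact ENNReal.mul_ne_top (ENNReal.rpow_ne_top_of_nonneg hp0 (ENNReal.mul_ne_top (by simp) hM1))
        (ENNReal.rpow_ne_top_of_nonneg (by linarith) hvB)
    have h3 := lintegral_segment_le (convex_ball (0 : Evec n) 1) hBm (fun x => S x ^ p) (by fun_prop)
    have h4 := lintegral_sum_rpow_le hw hp B
    calc _ ≤ (4 * M1) ^ p * volume B ^ (p - 1) * (2 ^ n * volume B * (N * symEnergy p B w)) := by
          gcongr
          exact h3.trans (by gcongr)
      _ = C1 * symEnergy p B w := by rw [hC1]; ring
      _ ≤ _ := by gcongr; exact le_self_add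
  · have hm : Measurable (symGrad w i k) := (isTest_symGrad hw i k).continuous.measurable
    rw [rigidMat_add hφ hw]
    have h2 : ‖-2 * ∫ y, symGrad w i k y * φ y‖ₑ ≤ 2 * M2 * ∫⁻ y in B, ‖symGrad w i k y‖ₑ := by
      rw [enorm_mul, mul_assoc]
      gcongr
      · simp [← ofReal_norm]
      · refine (enorm_integral_le_lintegral_enorm _).trans ?_
        rw [← setLIntegral_eq_of_support_subset (s := B), ← lintegral_const_mul _ (by fun_prop)]
        · refine lintegral_mono fun y => ?_
          rw [enorm_mul, mul_comm]
          gcongr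
          exact hM2b _
        · intro y hy
          apply hφs
          intro h0
          simp [h0] at hy
    refine (ENNReal.rpow_le_rpow h2 hp0).trans ?_
    rw [ENNReal.mul_rpow_of_nonneg _ _ hp0]
    calc _ ≤ (2 * M2) ^ p * (volume B ^ (p - 1) * ∫⁻ y in B, ‖symGrad w i k y‖ₑ ^ p) := by
          gcongr
          refine (lintegral_rpow_le_measure_mul hp (by fun_prop)).trans ?_
          simp
      _ ≤ (2 * M2) ^ p * (volume B ^ (p - 1) * symEnergy p B w) := by
          gcongr
          rw [symEnergy]
          refine le_trans ?_ (Finset.single_le_sum (f := fun a => ∑ b, ∫⁻ x in B, ‖symGrad w a b x‖ₑ ^ p)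
            (fun _ _ => zero_le) (Finset.mem_univ i))
          exact (Finset.single_le_sum (f := fun b => ∫⁻ x in B, ‖symGrad w i b x‖ₑ ^ p)
            (fun _ _ => zero_le) (Finset.mem_univ k))
      _ = C2 * symEnergy p B w := by rw [hC2]; ring
      _ ≤ _ := by gcongr; exact le_add_self

end KornPoincare

section LocalKorn

variable {n : ℕ}

lemma IsTest.lintegral_enorm_rpow {f : Evec n → ℝ} (hf : IsTest f) {p : ℝ} (hp : 0 < p) :
    ∫⁻ x, ‖f x‖ₑ ^ p = ENNReal.ofReal (∫ x, |f x| ^ p) := by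
  rw [ofReal_integral_eq_lintegral_ofReal (hf.integrable_rpow hp) (ae_of_all _ fun x => by positivity)]
  congr 1 with x
  rw [← ofReal_norm, Real.norm_eq_abs, ENNReal.ofReal_rpow_of_nonneg (abs_nonneg _) hp.le]

lemma korn_global_enorm {p : ℝ} (hp : 1 < p) : ∃ C : ℝ≥0∞, C ≠ ⊤ ∧ ∀ w : Fin n → Evec n → ℝ,
    (∀ i, IsTest (w i)) → ∀ i k, ∫⁻ x, ‖dl k (w i) x‖ₑ ^ p ≤ C * symEnergy p univ w := by
  obtain ⟨C, hC, h⟩ := korn_global (n := n) hp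
  have hp0 : 0 < p := by linarith
  refine ⟨ENNReal.ofReal C, ENNReal.ofReal_ne_top, fun w hw i k => ?_⟩
  rw [((hw i).dl k).lintegral_enorm_rpow hp0]
  refine (ENNReal.ofReal_le_ofReal (h w hw i k)).trans_eq ?_
  have h0 : ∀ a b, 0 ≤ ∫ x, |symGrad w a b x| ^ p := fun a b =>
    integral_nonneg fun x => by positivity
  rw [ENNReal.ofReal_mul hC.le, symEnergy,
    ENNReal.ofReal_sum_of_nonneg fun a _ => Finset.sum_nonneg fun b _ => h0 a b]
  congr 1
  refine Finset.sum_congr rfl fun a _ => ?_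
  rw [ENNReal.ofReal_sum_of_nonneg fun b _ => h0 a b]
  refine Finset.sum_congr rfl fun b _ => ?_
  rw [setLIntegral_univ, (isTest_symGrad hw a b).lintegral_enorm_rpow hp0]

lemma rpow_add_four_le (a b c d : ℝ≥0∞) {p : ℝ} (hp : 1 < p) :
    (a + b + c + d) ^ p ≤ 4 ^ (p - 1) * (a ^ p + b ^ p + c ^ p + d ^ p) := by
  simpa [Fin.sum_univ_four] using
    ENNReal.rpow_sum_le_const_mul_sum_rpow (Finset.univ : Finset (Fin 4)) ![a, b, c, d] hp.le

lemma le_symEnergy (p : ℝ) (B : Set (Evec n)) (w : Fin n → Evec n → ℝ) (i k : Fin n) :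
    ∫⁻ x in B, ‖symGrad w i k x‖ₑ ^ p ≤ symEnergy p B w :=
  le_trans (Finset.single_le_sum (f := fun b => ∫⁻ x in B, ‖symGrad w i b x‖ₑ ^ p)
    (fun _ _ => zero_le) (Finset.mem_univ k))
    (Finset.single_le_sum (f := fun a => ∑ b, ∫⁻ x in B, ‖symGrad w a b x‖ₑ ^ p)
    (fun _ _ => zero_le) (Finset.mem_univ i))

lemma support_dl_subset (f : Evec n → ℝ) (l : Fin n) : Function.support (dl l f) ⊆ tsupport f := by
  intro x hx
  apply support_fderiv_subset ℝ (f := f)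
  intro h0
  apply hx
  simp [dl, h0]

lemma local_korn_unit {p : ℝ} (hp : 1 < p) : ∃ C : ℝ≥0∞, C ≠ ⊤ ∧ ∀ w : Fin n → Evec n → ℝ,
    (∀ i, IsTest (w i)) → ∀ i j, ∃ A : ℝ,
      ∫⁻ x in Metric.ball 0 (1 / 2), ‖dl j (w i) x - A‖ₑ ^ p ≤ C * symEnergy p (Metric.ball 0 1) w := by
  set B := Metric.ball (0 : Evec n) 1 with hB
  have hBm : MeasurableSet B := Metric.isOpen_ball.measurableSet
  have hvB : volume B ≠ ⊤ := measure_ball_lt_top.ne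
  have hp0 : 0 < p := by linarith
  have hφ := isTest_normed (stdBump n)
  have hφts : tsupport ((stdBump n).normed volume) ⊆ B := by
    rw [(stdBump n).tsupport_normed_eq]
    exact Metric.closedBall_subset_ball (by norm_num [stdBump])
  obtain ⟨C1, hC1, h1⟩ := korn_poincare hp hφ (stdBump n).integral_normed
    ((subset_tsupport _).trans hφts) (fun i => (support_dl_subset _ i).trans hφts)
  obtain ⟨C2, hC2, h2⟩ := korn_global_enorm (n := n) hp
  set η : ContDiffBump (0 : Evec n) := ⟨1 / 2, 3 / 4, by norm_num, by norm_num⟩ with hη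
  have hηt : IsTest (η : Evec n → ℝ) := ⟨η.contDiff, η.hasCompactSupport⟩
  have hηs : tsupport η ⊆ B := by
    rw [η.tsupport_eq]
    exact Metric.closedBall_subset_ball (by norm_num [hη])
  have hη1 : ∀ x ∈ Metric.ball (0 : Evec n) (1 / 2), (η : Evec n → ℝ) =ᶠ[𝓝 x] fun _ => 1 := by
    intro x hx
    filter_upwards [Metric.isOpen_ball.mem_nhds hx] with y hy
    exact η.one_of_mem_closedBall (Metric.ball_subset_closedBall hy)
  obtain ⟨M, hM, hMb⟩ := exists_unif_bdd (fun i => hηt.dl i)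
  set K : ℝ≥0∞ := 4 ^ (p - 1) * (1 + C1 * volume B + M ^ p * C1 + M ^ p * C1) with hK
  have hKt : K ≠ ⊤ := by
    refine ENNReal.mul_ne_top (ENNReal.rpow_ne_top_of_nonneg (by linarith) (by simp)) ?_
    have hMp := ENNReal.rpow_ne_top_of_nonneg hp0.le hM
    finiteness
  refine ⟨C2 * (n * (n * K)), by finiteness, fun w hw i j => ?_⟩
  obtain ⟨hA, hA'⟩ := h1 w hw
  set A := rigidMat ((stdBump n).normed volume) w with hAdef
  choose c hc using hA
  set r : Fin n → Evec n → ℝ := fun i x => w i x - c i - ∑ k, A i k * x k with hr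
  have hrs : ∀ i, ContDiff ℝ (⊤ : ℕ∞) (r i) := by
    intro i
    have := (hw i).smooth
    fun_prop
  have hdr : ∀ i j x, dl j (r i) x = dl j (w i) x - A i j := by
    intro i j x
    have e : HasFDerivAt (r i) (fderiv ℝ (w i) x - ∑ k, A i k • (EuclideanSpace.proj k : Evec n →L[ℝ] ℝ)) x := by
      refine (((hw i).differentiable x).hasFDerivAt.sub_const (c i)).sub ?_
      refine HasFDerivAt.fun_sum fun k _ => ?_
      exact (EuclideanSpace.proj k : Evec n →L[ℝ] ℝ).hasFDerivAt.const_mul _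
    simp [dl, e.fderiv]
  set W : Fin n → Evec n → ℝ := fun i x => r i x * η x with hW
  have hWt : ∀ i, IsTest (W i) := fun i => IsTest.mul_left (hrs i) hηt
  have hdW : ∀ i j x, dl j (W i) x = r i x * dl j η x + (dl j (w i) x - A i j) * η x := by
    intro i j x
    rw [← hdr, hW, dl_mul ((hrs i).differentiable (by simp) x) (hηt.differentiable x)]
  have hEW : ∀ a b, ∫⁻ x, ‖symGrad W a b x‖ₑ ^ p ≤ K * symEnergy p B w := by
    intro a b
    rw [← setLIntegral_eq_of_support_subset (s := B)]
    swap
    · intro x hx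
      by_contra hxB
      have e1 : η x = 0 := image_eq_zero_of_notMem_tsupport fun h => hxB (hηs h)
      have e2 : ∀ l, dl l η x = 0 := fun l => by
        by_contra h
        exact hxB (hηs (support_dl_subset _ l h))
      apply hx
      simp [symGrad, hdW, e1, e2, hp0]
    have hpt : ∀ x, ‖symGrad W a b x‖ₑ ^ p ≤ 4 ^ (p - 1) * (‖symGrad w a b x‖ₑ ^ p + ‖A a b + A b a‖ₑ ^ p +
        M ^ p * ‖r a x‖ₑ ^ p + M ^ p * ‖r b x‖ₑ ^ p) := by
      intro x
      rw [← ENNReal.mul_rpow_of_nonneg _ _ hp0.le, ← ENNReal.mul_rpow_of_nonneg _ _ hp0.le]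
      refine le_trans ?_ (rpow_add_four_le _ _ _ _ hp)
      refine ENNReal.rpow_le_rpow ?_ hp0.le
      have hhalf : ∀ y : ℝ, ‖(1 / 2 : ℝ) * y‖ₑ ≤ ‖y‖ₑ := by
        intro y
        rw [← ofReal_norm, ← ofReal_norm]
        apply ENNReal.ofReal_le_ofReal
        rw [norm_mul]
        have : ‖(1 / 2 : ℝ)‖ = 1 / 2 := by norm_num
        rw [this]
        linarith [norm_nonneg y]
      have hη01 : ∀ y : ℝ, ‖η x * y‖ₑ ≤ ‖y‖ₑ := by
        intro y
        rw [← ofReal_norm, ← ofReal_norm]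
        apply ENNReal.ofReal_le_ofReal
        rw [norm_mul, Real.norm_of_nonneg η.nonneg]
        exact mul_le_of_le_one_left (norm_nonneg _) η.le_one
      have e : symGrad W a b x = η x * symGrad w a b x + η x * (1 / 2 * (-(A a b + A b a))) +
          1 / 2 * (dl b η x * r a x) + 1 / 2 * (dl a η x * r b x) := by
        simp only [symGrad, hdW]; ring
      rw [e]
      refine (enorm_add_le _ _).trans (add_le_add ((enorm_add_le _ _).trans (add_le_add
        ((enorm_add_le _ _).trans (add_le_add (hη01 _) ((hη01 _).trans ?_))) ?_)) ?_)
      · refine (hhalf _).trans ?_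
        rw [enorm_neg]
      · refine (hhalf _).trans ?_
        rw [enorm_mul]
        gcongr
        exact hMb _ _
      · refine (hhalf _).trans ?_
        rw [enorm_mul]
        gcongr
        exact hMb _ _
    have hm : ∀ a, Measurable (r a) := fun a => (hrs a).continuous.measurable
    have hm2 : Measurable (symGrad w a b) := (isTest_symGrad hw a b).continuous.measurable
    refine (lintegral_mono hpt).trans ?_
    rw [lintegral_const_mul _ (by fun_prop), lintegral_add_right _ (by fun_prop),
      lintegral_add_right _ (by fun_prop), lintegral_add_right _ (by fun_prop),
      lintegral_const_mul _ (by fun_prop), lintegral_const_mul _ (by fun_prop), setLIntegral_const]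
    calc _ ≤ 4 ^ (p - 1) * (symEnergy p B w + C1 * symEnergy p B w * volume B +
        M ^ p * (C1 * symEnergy p B w) + M ^ p * (C1 * symEnergy p B w)) := by
          gcongr
          · exact le_symEnergy _ _ _ _ _
          · exact hA' _ _
          · exact hc _
          · exact hc _
      _ = K * symEnergy p B w := by rw [hK]; ring
  refine ⟨A i j, ?_⟩
  calc ∫⁻ x in Metric.ball 0 (1 / 2), ‖dl j (w i) x - A i j‖ₑ ^ p
      = ∫⁻ x in Metric.ball 0 (1 / 2), ‖dl j (W i) x‖ₑ ^ p := by
        refine setLIntegral_congr_fun Metric.isOpen_ball.measurableSet fun x hx => ?_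
        have e1 : η x = 1 := (hη1 x hx).eq_of_nhds
        have e2 : dl j η x = 0 := by simp [dl, (hη1 x hx).fderiv_eq]
        simp [hdW, e1, e2]
    _ ≤ ∫⁻ x, ‖dl j (W i) x‖ₑ ^ p := setLIntegral_le_lintegral _ _
    _ ≤ C2 * symEnergy p univ W := h2 W hWt i j
    _ ≤ C2 * ∑ a : Fin n, ∑ b : Fin n, K * symEnergy p B w := by
        rw [symEnergy]
        simp only [setLIntegral_univ]
        gcongr
        exact hEW _ _
    _ = _ := by simp; ring

end LocalKorn

section LocalKorn

variable {n : ℕ}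

lemma setLIntegral_ball_comp_affine (G : Evec n → ℝ≥0∞) (hG : Measurable G) (c : Evec n) {r : ℝ}
    (hr : 0 < r) (s : ℝ) : ∫⁻ y in Metric.ball 0 s, G (r • y + c) =
      ENNReal.ofReal ((r ^ n)⁻¹) * ∫⁻ y in Metric.ball c (r * s), G y := by
  rw [← lintegral_indicator Metric.isOpen_ball.measurableSet,
    ← lintegral_indicator Metric.isOpen_ball.measurableSet,
    ← lintegral_comp_affine _ (hG.indicator Metric.isOpen_ball.measurableSet) c hr]
  congr 1 with y
  have : r • y + c ∈ Metric.ball c (r * s) ↔ y ∈ Metric.ball 0 s := by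
    simp [Metric.mem_ball, dist_eq_norm, norm_smul, abs_of_pos hr, hr]
  by_cases h : y ∈ Metric.ball 0 s
  · rw [indicator_of_mem h, indicator_of_mem (this.2 h)]
  · rw [indicator_of_notMem h, indicator_of_notMem (fun h' => h (this.1 h'))]

lemma IsTest.comp_affine {f : Evec n → ℝ} (hf : IsTest f) (c : Evec n) {r : ℝ} (hr : 0 < r) :
    IsTest (fun y => f (r • y + c)) := by
  have hs := hf.smooth
  refine ⟨by fun_prop, ?_⟩
  have : (fun y => f (r • y + c)) = f ∘ ((Homeomorph.smulOfNeZero r hr.ne').trans (Homeomorph.addRight c)) := by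
    ext y; simp
  rw [this]
  exact hf.supp.comp_homeomorph _

lemma dl_comp_affine {f : Evec n → ℝ} (hf : Differentiable ℝ f) (c : Evec n) (r : ℝ) (l : Fin n) (y : Evec n) :
    dl l (fun y => f (r • y + c)) y = r * dl l f (r • y + c) := by
  have h1 : HasFDerivAt (fun y : Evec n => r • y + c) (r • ContinuousLinearMap.id ℝ (Evec n)) y :=
    ((hasFDerivAt_id y).const_smul r).add_const c
  have h2 := (hf (r • y + c)).hasFDerivAt.comp y h1
  have h3 : fderiv ℝ (fun y => f (r • y + c)) y = _ := h2.fderiv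
  simp [dl, h3]

lemma local_korn_ball {p : ℝ} (hp : 1 < p) : ∃ C : ℝ≥0∞, C ≠ ⊤ ∧ ∀ w : Fin n → Evec n → ℝ,
    (∀ i, IsTest (w i)) → ∀ (x₀ : Evec n) (r : ℝ), 0 < r → ∀ i j, ∃ A : ℝ,
      ∫⁻ x in Metric.ball x₀ (r / 2), ‖dl j (w i) x - A‖ₑ ^ p ≤ C * symEnergy p (Metric.ball x₀ r) w := by
  obtain ⟨C, hC, h⟩ := local_korn_unit (n := n) hp
  refine ⟨C, hC, fun w hw x₀ r hr i j => ?_⟩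
  set w' : Fin n → Evec n → ℝ := fun i y => r⁻¹ * w i (r • y + x₀) with hw'
  have hw't : ∀ i, IsTest (w' i) := fun i => ((hw i).comp_affine x₀ hr).const_mul _
  have hd : ∀ i j y, dl j (w' i) y = dl j (w i) (r • y + x₀) := by
    intro i j y
    rw [hw', dl_const_mul ((hw i).comp_affine x₀ hr)]
    dsimp only
    rw [dl_comp_affine (hw i).differentiable]
    field_simp
  obtain ⟨A, hA⟩ := h w' hw't i j
  refine ⟨A, ?_⟩
  have hm : Measurable (dl j (w i)) := ((hw i).dl j).continuous.measurable
  have hs : ∀ a b, Measurable (symGrad w a b) := fun a b => (isTest_symGrad hw a b).continuous.measurable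
  simp only [symEnergy, symGrad, hd] at hA
  rw [setLIntegral_ball_comp_affine (fun x => ‖dl j (w i) x - A‖ₑ ^ p) (by fun_prop) x₀ hr] at hA
  have hsum : ∑ a, ∑ b, ∫⁻ y in Metric.ball 0 1,
      ‖(dl b (w a) (r • y + x₀) + dl a (w b) (r • y + x₀)) / 2‖ₑ ^ p =
      ENNReal.ofReal ((r ^ n)⁻¹) * symEnergy p (Metric.ball x₀ r) w := by
    rw [symEnergy, Finset.mul_sum]
    refine Finset.sum_congr rfl fun a _ => ?_
    rw [Finset.mul_sum]
    refine Finset.sum_congr rfl fun b _ => ?_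
    have := setLIntegral_ball_comp_affine (fun x => ‖symGrad w a b x‖ₑ ^ p) (by fun_prop) x₀ hr 1
    rw [mul_one] at this
    exact this
  rw [hsum, mul_left_comm, show r * (1 / 2) = r / 2 by ring] at hA
  exact (ENNReal.mul_le_mul_iff_right (by simpa using by positivity) ENNReal.ofReal_ne_top).1 hA

lemma enorm_sub_rpow_le (x y A : ℝ) {p : ℝ} (hp : 1 < p) :
    ‖x - y‖ₑ ^ p ≤ 2 ^ (p - 1) * (‖x - A‖ₑ ^ p + ‖y - A‖ₑ ^ p) := by
  refine le_trans (ENNReal.rpow_le_rpow ?_ (by linarith)) (ENNReal.rpow_add_le_mul_rpow_add_rpow _ _ hp.le)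
  rw [show x - y = (x - A) - (y - A) by ring]
  exact enorm_sub_le

lemma lintegral_lintegral_sub_le {B : Set (Evec n)} {f : Evec n → ℝ} (hf : Measurable f) (A : ℝ) {p : ℝ} (hp : 1 < p) :
    ∫⁻ x in B, ∫⁻ y in B, ‖f x - f y‖ₑ ^ p ≤ 2 ^ (p - 1) * 2 * volume B * ∫⁻ x in B, ‖f x - A‖ₑ ^ p := by
  have h := fun x y => enorm_sub_rpow_le (f x) (f y) A hp
  refine (lintegral_mono fun x => lintegral_mono fun y => h x y).trans_eq ?_
  have h1 : ∀ x, ∫⁻ y in B, 2 ^ (p - 1) * (‖f x - A‖ₑ ^ p + ‖f y - A‖ₑ ^ p) =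
      2 ^ (p - 1) * (‖f x - A‖ₑ ^ p * volume B + ∫⁻ y in B, ‖f y - A‖ₑ ^ p) := by
    intro x
    rw [lintegral_const_mul _ (by fun_prop), lintegral_add_left (by fun_prop), setLIntegral_const]
  simp_rw [h1]
  rw [lintegral_const_mul _ (by fun_prop), lintegral_add_right _ (by fun_prop),
    lintegral_mul_const _ (by fun_prop), setLIntegral_const]
  ring

lemma local_korn_double {p : ℝ} (hp : 1 < p) : ∃ C : ℝ≥0∞, C ≠ ⊤ ∧ ∀ w : Fin n → Evec n → ℝ,
    (∀ i, IsTest (w i)) → ∀ (x₀ : Evec n) (r : ℝ), 0 < r → ∀ i j,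
      ∫⁻ x in Metric.ball x₀ (r / 2), ∫⁻ y in Metric.ball x₀ (r / 2), ‖dl j (w i) x - dl j (w i) y‖ₑ ^ p ≤
        C * volume (Metric.ball x₀ (r / 2)) * symEnergy p (Metric.ball x₀ r) w := by
  obtain ⟨C, hC, h⟩ := local_korn_ball (n := n) hp
  have h2 : (2 : ℝ≥0∞) ^ (p - 1) ≠ ⊤ := ENNReal.rpow_ne_top_of_nonneg (by linarith) (by simp)
  refine ⟨2 ^ (p - 1) * 2 * C, by finiteness, fun w hw x₀ r hr i j => ?_⟩
  obtain ⟨A, hA⟩ := h w hw x₀ r hr i j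
  refine (lintegral_lintegral_sub_le ((hw i).dl j).continuous.measurable A hp).trans ?_
  calc _ ≤ 2 ^ (p - 1) * 2 * volume (Metric.ball x₀ (r / 2)) * (C * symEnergy p (Metric.ball x₀ r) w) := by
        gcongr
    _ = _ := by ring

end LocalKorn

section Mollify

open scoped Convolution

variable {n : ℕ}

/-- Mollification of `V` by `φ`. -/
def moll (φ V : Evec n → ℝ) : Evec n → ℝ := φ ⋆[ContinuousLinearMap.lsmul ℝ ℝ, volume] V

lemma moll_apply (φ V : Evec n → ℝ) (x : Evec n) : moll φ V x = ∫ t, φ t * V (x - t) := rfl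

lemma isTest_moll {φ V : Evec n → ℝ} (hφ : IsTest φ) (hV : Continuous V) (hVs : HasCompactSupport V) :
    IsTest (moll φ V) :=
  ⟨hφ.supp.contDiff_convolution_left _ hφ.smooth hV.locallyIntegrable, hφ.supp.convolution _ hVs⟩

lemma dl_moll {φ V : Evec n → ℝ} (hφ : IsTest φ) (hV : Differentiable ℝ V)
    (j : Fin n) (hVi : Integrable (dl j V)) (x : Evec n) : dl j (moll φ V) x = moll φ (dl j V) x := by
  have h1 := (hφ.supp.hasFDerivAt_convolution_left (ContinuousLinearMap.lsmul ℝ ℝ)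
    (hφ.contDiff 1) hV.continuous.locallyIntegrable x (μ := volume)).fderiv
  have h2 : dl j (moll φ V) x = ∫ t, dl j φ t * V (x - t) := by
    have hex : ConvolutionExists (fderiv ℝ φ) V
        ((ContinuousLinearMap.lsmul ℝ ℝ : ℝ →L[ℝ] ℝ →L[ℝ] ℝ).precompL (Evec n)) volume :=
      hφ.supp.fderiv (𝕜 := ℝ) |>.convolutionExists_left _ hφ.fderiv.continuous
        hV.continuous.locallyIntegrable
    rw [dl, moll, h1, convolution, ContinuousLinearMap.integral_apply (hex x)]
    rfl
  have hsub : ∀ t, HasFDerivAt (fun t => x - t) (-ContinuousLinearMap.id ℝ (Evec n)) t := fun t =>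
    (hasFDerivAt_id t).const_sub x
  have hVx : Differentiable ℝ (fun t => V (x - t)) := fun t =>
    (((hV (x - t)).hasFDerivAt).comp t (hsub t)).differentiableAt
  have hdV : ∀ t, dl j (fun t => V (x - t)) t = - dl j V (x - t) := by
    intro t
    have h3 : fderiv ℝ (fun t => V (x - t)) t = _ := ((hV (x - t)).hasFDerivAt.comp t (hsub t)).fderiv
    simp [dl, h3]
  have hprod : ∀ t, dl j (fun t => φ t * V (x - t)) t = - (φ t * dl j V (x - t)) + dl j φ t * V (x - t) := by
    intro t
    rw [dl_mul (hφ.differentiable t) (hVx t), hdV]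
    ring
  have hc := hVx.continuous
  have hφc := hφ.continuous
  have hdc := (hφ.dl j).continuous
  obtain ⟨M, -, hM⟩ := hφ.bdd
  have i1 : Integrable (fun t => φ t * dl j V (x - t)) :=
    (hVi.comp_sub_left x).bdd_mul (c := M) hφc.aestronglyMeasurable (ae_of_all _ hM)
  have i2 : Integrable (fun t => dl j φ t * V (x - t)) :=
    Continuous.integrable_of_hasCompactSupport (hdc.mul hc) (hφ.dl j).supp.mul_right
  have i3 : Integrable (fun t => φ t * V (x - t)) :=
    Continuous.integrable_of_hasCompactSupport (hφc.mul hc) hφ.supp.mul_right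
  have h0 : ∫ t, dl j (fun t => φ t * V (x - t)) t = 0 := by
    refine integral_fderiv_apply_eq_zero i3 _ (hφ.differentiable.mul hVx) ?_
    refine (i1.neg.add i2).congr (ae_of_all _ fun t => ?_)
    exact (hprod t).symm
  simp_rw [hprod] at h0
  have i1n : Integrable (fun t => - (φ t * dl j V (x - t))) := i1.neg
  rw [integral_add i1n i2, integral_neg] at h0
  rw [h2, moll_apply]
  linarith

lemma enorm_moll_rpow_le {φ V : Evec n → ℝ} (hφ : IsTest φ) (hφ0 : ∀ x, 0 ≤ φ x) (hφ1 : ∫ x, φ x = 1)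
    (hV : Measurable V) {p : ℝ} (hp : 1 < p) (x : Evec n) :
    ‖moll φ V x‖ₑ ^ p ≤ ∫⁻ t, ENNReal.ofReal (φ t) * ‖V (x - t)‖ₑ ^ p := by
  have hφm : Measurable (fun t => ENNReal.ofReal (φ t)) := hφ.continuous.measurable.ennreal_ofReal
  set μ := (volume : Measure (Evec n)).withDensity (fun t => ENNReal.ofReal (φ t)) with hμ
  have hμ1 : μ univ = 1 := by
    rw [hμ, withDensity_apply _ MeasurableSet.univ, setLIntegral_univ,
      ← ofReal_integral_eq_lintegral_ofReal hφ.integrable (ae_of_all _ hφ0), hφ1, ENNReal.ofReal_one]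
  have h1 : ‖moll φ V x‖ₑ ≤ ∫⁻ t, ‖V (x - t)‖ₑ ∂μ := by
    rw [lintegral_withDensity_eq_lintegral_mul _ hφm (by fun_prop), moll_apply]
    refine (enorm_integral_le_lintegral_enorm _).trans (lintegral_mono fun t => ?_)
    rw [enorm_mul, Real.enorm_of_nonneg (hφ0 t)]
    rfl
  refine (ENNReal.rpow_le_rpow h1 (by linarith)).trans ?_
  refine (lintegral_rpow_le_measure_mul hp (Measurable.aemeasurable (by fun_prop))).trans_eq ?_
  rw [hμ1, ENNReal.one_rpow, one_mul, lintegral_withDensity_eq_lintegral_mul _ hφm (by fun_prop)]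
  rfl

lemma setLIntegral_moll_le {φ V : Evec n → ℝ} (hφ : IsTest φ) (hφ0 : ∀ x, 0 ≤ φ x) (hφ1 : ∫ x, φ x = 1)
    {δ : ℝ} (hφs : Function.support φ ⊆ Metric.ball 0 δ)
    (hV : Measurable V) {p : ℝ} (hp : 1 < p) (x₀ : Evec n) (r : ℝ) :
    ∫⁻ x in Metric.ball x₀ r, ‖moll φ V x‖ₑ ^ p ≤ ∫⁻ x in Metric.ball x₀ (r + δ), ‖V x‖ₑ ^ p := by
  have hφm : Measurable (fun t => ENNReal.ofReal (φ t)) := hφ.continuous.measurable.ennreal_ofReal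
  have hφm0 : Measurable φ := hφ.continuous.measurable
  refine (lintegral_mono fun x => enorm_moll_rpow_le hφ hφ0 hφ1 hV hp x).trans ?_
  rw [lintegral_lintegral_swap (Measurable.aemeasurable (by fun_prop))]
  have h : ∀ t, ∫⁻ x in Metric.ball x₀ r, ENNReal.ofReal (φ t) * ‖V (x - t)‖ₑ ^ p ≤
      ENNReal.ofReal (φ t) * ∫⁻ x in Metric.ball x₀ (r + δ), ‖V x‖ₑ ^ p := by
    intro t
    rw [lintegral_const_mul _ (by fun_prop)]
    by_cases ht : φ t = 0
    · simp [ht]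
    refine mul_le_mul' le_rfl ?_
    have ht' : ‖t‖ < δ := by simpa using hφs ht
    rw [← lintegral_indicator Metric.isOpen_ball.measurableSet,
      ← lintegral_indicator Metric.isOpen_ball.measurableSet,
      ← lintegral_sub_right_eq_self (fun x => (Metric.ball x₀ (r + δ)).indicator (fun x => ‖V x‖ₑ ^ p) x) t]
    refine lintegral_mono fun x => ?_
    dsimp only
    by_cases hx : x ∈ Metric.ball x₀ r
    · rw [indicator_of_mem hx, indicator_of_mem]
      rw [Metric.mem_ball, dist_eq_norm] at hx ⊢
      calc ‖x - t - x₀‖ = ‖(x - x₀) - t‖ := by congr 1; abel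
        _ ≤ ‖x - x₀‖ + ‖t‖ := norm_sub_le _ _
        _ < r + δ := add_lt_add hx ht'
    · simp [indicator_of_notMem hx]
  refine (lintegral_mono h).trans_eq ?_
  rw [lintegral_mul_const _ hφm,
    ← ofReal_integral_eq_lintegral_ofReal hφ.integrable (ae_of_all _ hφ0), hφ1, ENNReal.ofReal_one, one_mul]

end Mollify

section Mollify

variable {n : ℕ}

/-- A sequence of bump functions shrinking to a point. -/
def bumpSeq (n m : ℕ) : ContDiffBump (0 : Evec n) :=
  ⟨1 / (m + 1), 2 / (m + 1), by positivity, by gcongr; norm_num⟩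

lemma tendsto_bumpSeq_rOut : Tendsto (fun m => (bumpSeq n m).rOut) atTop (𝓝 0) := by
  have := (tendsto_one_div_add_atTop_nhds_zero_nat (𝕜 := ℝ)).const_mul 2
  rw [mul_zero] at this
  refine this.congr fun m => ?_
  simp [bumpSeq, div_eq_mul_inv]

lemma ae_tendsto_moll {V : Evec n → ℝ} (hV : Integrable V) :
    ∀ᵐ x, Tendsto (fun m => moll ((bumpSeq n m).normed volume) V x) atTop (𝓝 (V x)) :=
  ContDiffBump.ae_convolution_tendsto_right_of_locallyIntegrable (K := 2) tendsto_bumpSeq_rOut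
    (Eventually.of_forall fun m => by simp [bumpSeq, div_eq_mul_inv]) hV.locallyIntegrable

lemma moll_add_div_two {φ f g : Evec n → ℝ} (hφ : IsTest φ) (hf : Integrable f) (hg : Integrable g)
    (x : Evec n) : (moll φ f x + moll φ g x) / 2 = moll φ (fun y => (f y + g y) / 2) x := by
  obtain ⟨M, -, hM⟩ := hφ.bdd
  have i1 : ∀ f, Integrable f → Integrable (fun t => φ t * f (x - t)) := fun f hf =>
    (hf.comp_sub_left x).bdd_mul (c := M) hφ.continuous.aestronglyMeasurable (ae_of_all _ hM)
  rw [moll_apply, moll_apply, moll_apply, ← integral_add (i1 f hf) (i1 g hg), ← integral_div]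
  congr 1 with t
  ring

lemma measurable_dl {f : Evec n → ℝ} (j : Fin n) : Measurable (dl j f) :=
  measurable_fderiv_apply_const ℝ f _

lemma local_korn_differentiable {p : ℝ} (hp : 1 < p) : ∃ C : ℝ≥0∞, C ≠ ⊤ ∧ ∀ V : Fin n → Evec n → ℝ,
    (∀ i, Differentiable ℝ (V i)) → (∀ i, HasCompactSupport (V i)) →
    (∀ i j, Integrable (dl j (V i))) → ∀ (x₀ : Evec n) (r : ℝ), 0 < r → ∀ i j,
      ∫⁻ x in Metric.ball x₀ (r / 2), ∫⁻ y in Metric.ball x₀ (r / 2),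
        ‖dl j (V i) x - dl j (V i) y‖ₑ ^ p ≤
        C * volume (Metric.ball x₀ (r / 2)) * symEnergy p (Metric.ball x₀ (2 * r)) V := by
  obtain ⟨C, hC, h⟩ := local_korn_double (n := n) hp
  refine ⟨C, hC, fun V hV hVs hVi x₀ r hr i j => ?_⟩
  set φ : ℕ → Evec n → ℝ := fun m => (bumpSeq n m).normed volume with hφdef
  have hφ : ∀ m, IsTest (φ m) := fun m => isTest_normed _
  set w : ℕ → Fin n → Evec n → ℝ := fun m i => moll (φ m) (V i) with hw
  have hwt : ∀ m i, IsTest (w m i) := fun m i => isTest_moll (hφ m) (hV i).continuous (hVs i)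
  have hd : ∀ m i j, dl j (w m i) = moll (φ m) (dl j (V i)) := fun m i j =>
    funext fun x => dl_moll (hφ m) (hV i) j (hVi i j) x
  have hsym : ∀ m a b, symGrad (w m) a b = moll (φ m) (symGrad V a b) := by
    intro m a b
    ext x
    rw [symGrad, hd, hd, moll_add_div_two (hφ m) (hVi a b) (hVi b a)]
    rfl
  have hVm : ∀ i j, Measurable (dl j (V i)) := fun i j => measurable_dl j
  have hSm : ∀ a b, Measurable (symGrad V a b) := fun a b => by
    unfold symGrad
    fun_prop
  have hp0 : 0 < p := by linarith
  set B := Metric.ball x₀ (r / 2) with hB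
  have hwm : ∀ m, Measurable (dl j (w m i)) := fun m => ((hwt m i).dl j).continuous.measurable
  set R : ℝ≥0∞ := C * volume B * symEnergy p (Metric.ball x₀ (2 * r)) V with hR
  have hle : ∀ᶠ m in atTop, ∫⁻ x in B, ∫⁻ y in B, ‖dl j (w m i) x - dl j (w m i) y‖ₑ ^ p ≤ R := by
    filter_upwards [tendsto_bumpSeq_rOut (n := n) |>.eventually (gt_mem_nhds hr)] with m hm
    refine (h (w m) (hwt m) x₀ r hr i j).trans ?_
    rw [hR]
    refine mul_le_mul' le_rfl (Finset.sum_le_sum fun a _ => Finset.sum_le_sum fun b _ => ?_)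
    rw [hsym]
    refine (setLIntegral_moll_le (hφ m) (fun x => (bumpSeq n m).nonneg_normed x)
      (bumpSeq n m).integral_normed (δ := r) ?_ (hSm a b) hp x₀ r).trans_eq (by rw [two_mul])
    rw [hφdef, ContDiffBump.support_normed_eq]
    exact Metric.ball_subset_ball hm.le
  have hae : ∀ᵐ x, Tendsto (fun m => dl j (w m i) x) atTop (𝓝 (dl j (V i) x)) := by
    simp_rw [hd]
    exact ae_tendsto_moll (hVi i j)
  have haeB : ∀ᵐ x ∂(volume.restrict B), Tendsto (fun m => dl j (w m i) x) atTop (𝓝 (dl j (V i) x)) :=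
    ae_restrict_of_ae hae
  calc _ = ∫⁻ x in B, ∫⁻ y in B, liminf (fun m => ‖dl j (w m i) x - dl j (w m i) y‖ₑ ^ p) atTop := by
        refine lintegral_congr_ae ?_
        filter_upwards [haeB] with x hx
        refine lintegral_congr_ae ?_
        filter_upwards [haeB] with y hy
        have ht : Tendsto (fun m => ‖dl j (w m i) x - dl j (w m i) y‖ₑ ^ p) atTop
            (𝓝 (‖dl j (V i) x - dl j (V i) y‖ₑ ^ p)) :=
          (ENNReal.continuous_rpow_const.tendsto _).comp ((continuous_enorm.tendsto _).comp (hx.sub hy))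
        exact ht.liminf_eq.symm
    _ ≤ ∫⁻ x in B, liminf (fun m => ∫⁻ y in B, ‖dl j (w m i) x - dl j (w m i) y‖ₑ ^ p) atTop :=
        lintegral_mono fun x => lintegral_liminf_le fun m => by fun_prop
    _ ≤ liminf (fun m => ∫⁻ x in B, ∫⁻ y in B, ‖dl j (w m i) x - dl j (w m i) y‖ₑ ^ p) atTop :=
        lintegral_liminf_le fun m => Measurable.lintegral_prod_right'
          (f := fun z : Evec n × Evec n => ‖dl j (w m i) z.1 - dl j (w m i) z.2‖ₑ ^ p) (by fun_prop)
    _ ≤ R := by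
        refine (liminf_le_liminf hle).trans_eq ?_
        exact liminf_const _

end Mollify

section LocalKornDomain

variable {n : ℕ}

/-- The entry `ε_{ij}(v)` of the symmetric gradient. -/
def eps (v : Evec n → Evec n) (i j : Fin n) (x : Evec n) : ℝ := (pder v i j x + pder v j i x) / 2

lemma measurable_pder (v : Evec n → Evec n) (i j : Fin n) : Measurable (pder v i j) := by
  have h : Measurable (fun x => fderiv ℝ v x (EuclideanSpace.single j 1)) :=
    measurable_fderiv_apply_const ℝ v _
  unfold pder
  fun_prop

lemma measurable_eps (v : Evec n → Evec n) (i j : Fin n) : Measurable (eps v i j) := by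
  have := measurable_pder v
  unfold eps
  fun_prop

lemma hasFDerivAt_coord {v : Evec n → Evec n} {x : Evec n} (hv : DifferentiableAt ℝ v x) (i : Fin n) :
    HasFDerivAt (fun y => v y i) ((EuclideanSpace.proj i : Evec n →L[ℝ] ℝ).comp (fderiv ℝ v x)) x :=
  (EuclideanSpace.proj i : Evec n →L[ℝ] ℝ).hasFDerivAt.comp x hv.hasFDerivAt

lemma dl_coord_comp {v : Evec n → Evec n} {x : Evec n} (hv : DifferentiableAt ℝ v x) (i j : Fin n) :
    dl j (fun y => v y i) x = pder v i j x := by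
  simp [dl, (hasFDerivAt_coord hv i).fderiv, pder]

lemma integrableOn_of_lintegral_rpow {f : Evec n → ℝ} (hf : Measurable f) {p : ℝ} (hp : 1 < p)
    {K : Set (Evec n)} (hK : volume K ≠ ⊤) (h : ∫⁻ x in K, ‖f x‖ₑ ^ p < ⊤) : IntegrableOn f K := by
  have : IsFiniteMeasure (volume.restrict K) := ⟨by simpa using hK.lt_top⟩
  refine ⟨hf.aestronglyMeasurable, ?_⟩
  have h1 := lintegral_rpow_le_measure_mul (μ := volume.restrict K) hp hf.enorm.aemeasurable
  have h2 : (∫⁻ x in K, ‖f x‖ₑ) ^ p < ⊤ := by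
    refine h1.trans_lt (ENNReal.mul_lt_top ?_ h)
    exact (ENNReal.rpow_ne_top_of_nonneg (by linarith) (measure_ne_top _ _)).lt_top
  by_contra hcon
  rw [HasFiniteIntegral, not_lt, top_le_iff] at hcon
  rw [hcon, ENNReal.top_rpow_of_pos (by linarith)] at h2
  exact lt_irrefl _ h2

lemma local_korn {p : ℝ} (hp : 1 < p) : ∃ C : ℝ≥0∞, C ≠ ⊤ ∧ ∀ (Ω : Set (Evec n)), IsOpen Ω →
    ∀ v : Evec n → Evec n, DifferentiableOn ℝ v Ω → ∀ (x₀ : Evec n) (r : ℝ), 0 < r →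
    Metric.closedBall x₀ (3 * r) ⊆ Ω →
    (∀ i j, ∫⁻ x in Metric.closedBall x₀ (3 * r), ‖pder v i j x‖ₑ ^ p < ⊤) → ∀ i j,
      ∫⁻ x in Metric.ball x₀ (r / 2), ∫⁻ y in Metric.ball x₀ (r / 2),
        ‖pder v i j x - pder v i j y‖ₑ ^ p ≤
        C * volume (Metric.ball x₀ (r / 2)) *
          ∑ a, ∑ b, ∫⁻ x in Metric.ball x₀ (2 * r), ‖eps v a b x‖ₑ ^ p := by
  obtain ⟨C, hC, h⟩ := local_korn_differentiable (n := n) hp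
  refine ⟨C, hC, fun Ω hΩ v hv x₀ r hr hK hfin i j => ?_⟩
  set K := Metric.closedBall x₀ (3 * r) with hKdef
  have hKc : IsCompact K := isCompact_closedBall _ _
  have hvx : ∀ x ∈ Ω, DifferentiableAt ℝ v x := fun x hx => (hv x hx).differentiableAt (hΩ.mem_nhds hx)
  set χ : ContDiffBump x₀ := ⟨2 * r, 3 * r, by positivity, by linarith⟩ with hχ
  have hχt : IsTest (χ : Evec n → ℝ) := ⟨χ.contDiff, χ.hasCompactSupport⟩
  have hχs : tsupport χ = K := χ.tsupport_eq
  set V : Fin n → Evec n → ℝ := fun i x => χ x * v x i with hV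
  have hVs : ∀ i, tsupport (V i) ⊆ K := fun i => hχs ▸ tsupport_mul_subset_left
  have hVd : ∀ i, Differentiable ℝ (V i) := by
    intro i x
    by_cases hx : x ∈ K
    · exact (hχt.differentiable x).mul (hasFDerivAt_coord (hvx x (hK hx)) i).differentiableAt
    · have : V i =ᶠ[𝓝 x] fun _ => 0 := notMem_tsupport_iff_eventuallyEq.1 fun h => hx (hVs i h)
      exact this.differentiableAt_iff.2 (differentiableAt_const _)
  have hdV : ∀ i j, ∀ x ∈ K, dl j (V i) x = χ x * pder v i j x + dl j χ x * v x i := by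
    intro i j x hx
    rw [hV, dl_mul (hχt.differentiable x) (hasFDerivAt_coord (hvx x (hK hx)) i).differentiableAt,
      dl_coord_comp (hvx x (hK hx))]
  have hVi : ∀ i j, Integrable (dl j (V i)) := by
    intro i j
    rw [← integrableOn_iff_integrable_of_support_subset ((support_dl_subset _ _).trans (hVs i))]
    rw [integrableOn_congr_fun (hdV i j) hKc.measurableSet]
    obtain ⟨M1, -, hM1⟩ := hχt.bdd
    obtain ⟨M2, -, hM2⟩ := (hχt.dl j).bdd
    have i1 : IntegrableOn (pder v i j) K :=
      integrableOn_of_lintegral_rpow (measurable_pder v i j) hp hKc.measure_lt_top.ne (hfin i j)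
    have i2 : IntegrableOn (fun x => v x i) K := by
      refine ContinuousOn.integrableOn_compact hKc fun x hx => ?_
      exact (hasFDerivAt_coord (hvx x (hK hx)) i).continuousAt.continuousWithinAt
    exact (i1.bdd_mul (c := M1) hχt.continuous.aestronglyMeasurable (ae_of_all _ hM1)).add
      (i2.bdd_mul (c := M2) (hχt.dl j).continuous.aestronglyMeasurable (ae_of_all _ hM2))
  have hin : ∀ i j, ∀ x ∈ Metric.ball x₀ (2 * r), dl j (V i) x = pder v i j x := by
    intro i j x hx
    have h1 : (χ : Evec n → ℝ) =ᶠ[𝓝 x] fun _ => 1 := by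
      filter_upwards [Metric.isOpen_ball.mem_nhds hx] with y hy
      exact χ.one_of_mem_closedBall (Metric.ball_subset_closedBall hy)
    have hxK : x ∈ K := Metric.ball_subset_closedBall (Metric.ball_subset_ball (by linarith) hx)
    rw [hdV i j x hxK, h1.eq_of_nhds]
    simp [dl, h1.fderiv_eq]
  have hsub : Metric.ball x₀ (r / 2) ⊆ Metric.ball x₀ (2 * r) := Metric.ball_subset_ball (by linarith)
  have hmB : MeasurableSet (Metric.ball x₀ (r / 2)) := Metric.isOpen_ball.measurableSet
  have key := h V hVd (fun i => hKc.of_isClosed_subset (isClosed_tsupport _) (hVs i)) hVi x₀ r hr i j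
  have e1 : ∫⁻ x in Metric.ball x₀ (r / 2), ∫⁻ y in Metric.ball x₀ (r / 2),
        ‖pder v i j x - pder v i j y‖ₑ ^ p = ∫⁻ x in Metric.ball x₀ (r / 2), ∫⁻ y in Metric.ball x₀ (r / 2),
        ‖dl j (V i) x - dl j (V i) y‖ₑ ^ p :=
    setLIntegral_congr_fun hmB fun x hx => setLIntegral_congr_fun hmB fun y hy => by
      rw [hin i j x (hsub hx), hin i j y (hsub hy)]
  have e2 : symEnergy p (Metric.ball x₀ (2 * r)) V =
      ∑ a, ∑ b, ∫⁻ x in Metric.ball x₀ (2 * r), ‖eps v a b x‖ₑ ^ p :=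
    Finset.sum_congr rfl fun a _ => Finset.sum_congr rfl fun b _ =>
      setLIntegral_congr_fun Metric.isOpen_ball.measurableSet fun x hx => by
        rw [symGrad, hin a b x hx, hin b a x hx, eps]
  rw [e1, ← e2]
  exact key

end LocalKornDomain

section Geometry

variable {n : ℕ} {Ω : Set (Evec n)}

lemma IsBoundedDomain.ne_univ [NeZero n] (hΩ : IsBoundedDomain Ω) : Ω ≠ univ := by
  rintro rfl
  exact NormedSpace.unbounded_univ ℝ (Evec n) hΩ.2.2

lemma bdist_pos [NeZero n] (hΩ : IsBoundedDomain Ω) {x : Evec n} (hx : x ∈ Ω) : 0 < bdist Ω x := by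
  have hne : (frontier Ω).Nonempty := nonempty_frontier_iff.2 ⟨⟨x, hx⟩, hΩ.ne_univ⟩
  refine (isClosed_frontier.notMem_iff_infDist_pos hne).1 fun h => ?_
  rw [hΩ.1.frontier_eq] at h
  exact h.2 hx

lemma ball_bdist_subset [NeZero n] (hΩ : IsBoundedDomain Ω) {x : Evec n} (hx : x ∈ Ω) :
    Metric.ball x (bdist Ω x) ⊆ Ω := by
  obtain ⟨y, hy, hxy⟩ := exists_mem_frontier_infDist_compl_eq_dist hx hΩ.ne_univ
  refine Subset.trans (Metric.ball_subset_ball ?_) Metric.ball_infDist_compl_subset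
  rw [hxy]
  exact Metric.infDist_le_dist_of_mem hy

lemma bdist_nonneg (x : Evec n) : 0 ≤ bdist Ω x := Metric.infDist_nonneg

lemma bdist_le_add (x y : Evec n) : bdist Ω x ≤ bdist Ω y + dist x y :=
  Metric.infDist_le_infDist_add_dist

lemma continuous_bdist : Continuous (bdist Ω) := Metric.continuous_infDist_pt _

@[fun_prop]
lemma measurable_bdist : Measurable (bdist Ω) := continuous_bdist.measurable

/-- The volume of the largest ball about `x` inside `Ω`. -/
def wvol (Ω : Set (Evec n)) (x : Evec n) : ℝ≥0∞ := volume (Metric.ball x (bdist Ω x))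

lemma volume_ball_mul (x : Evec n) {c r : ℝ} (hc : 0 < c) :
    volume (Metric.ball x (c * r)) = ENNReal.ofReal (c ^ n) * volume (Metric.ball x r) := by
  rw [Measure.addHaar_ball_mul_of_pos _ _ hc, finrank_euclideanSpace_fin, Measure.addHaar_ball_center _ x r]

lemma wvol_ne_top (x : Evec n) : wvol Ω x ≠ ⊤ := measure_ball_lt_top.ne

lemma wvol_ne_zero [NeZero n] (hΩ : IsBoundedDomain Ω) {x : Evec n} (hx : x ∈ Ω) : wvol Ω x ≠ 0 :=
  (Metric.measure_ball_pos _ _ (bdist_pos hΩ hx)).ne'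

lemma wvol_le {x y : Evec n} {c : ℝ} (hc : 0 < c) (h : bdist Ω x ≤ c * bdist Ω y) :
    wvol Ω x ≤ ENNReal.ofReal (c ^ n) * wvol Ω y := by
  rw [wvol, wvol, ← volume_ball_mul _ hc, Measure.addHaar_ball_center _ x,
    Measure.addHaar_ball_center _ y]
  exact measure_mono (Metric.ball_subset_ball h)

@[fun_prop]
lemma measurable_wvol [NeZero n] : Measurable (wvol Ω) := by
  have : wvol Ω = fun x => ENNReal.ofReal (bdist Ω x ^ n) * volume (Metric.ball (0 : Evec n) 1) := by
    funext x
    rw [wvol, Measure.addHaar_ball _ _ (r := bdist Ω x) Metric.infDist_nonneg, finrank_euclideanSpace_fin]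
  rw [this]
  fun_prop

lemma rpow_le_of_comparable {x y t : ℝ} (hx : 0 < x) (h1 : x / 2 ≤ y) (h2 : y ≤ 2 * x) :
    y ^ t ≤ 2 ^ |t| * x ^ t := by
  have hy : 0 < y := by linarith
  have e : y ^ t = (y / x) ^ t * x ^ t := by
    rw [Real.div_rpow hy.le hx.le, div_mul_cancel₀ _ (Real.rpow_pos_of_pos hx t).ne']
  rw [e]
  gcongr
  have hz2 : y / x ≤ 2 := by rwa [div_le_iff₀ hx]
  have hz1 : 2⁻¹ ≤ y / x := by rw [le_div_iff₀ hx]; linarith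
  rcases le_total 0 t with ht | ht
  · rw [abs_of_nonneg ht]
    exact Real.rpow_le_rpow (by positivity) hz2 ht
  · rw [abs_of_nonpos ht]
    calc (y / x) ^ t ≤ (2⁻¹ : ℝ) ^ t := Real.rpow_le_rpow_of_nonpos (by norm_num) hz1 ht
      _ = _ := by rw [Real.inv_rpow (by norm_num), Real.rpow_neg (by norm_num)]

lemma measurableSet_near (hΩ : IsBoundedDomain Ω) (c : ℝ) (y : Evec n) :
    MeasurableSet {x | x ∈ Ω ∧ dist x y < c * bdist Ω x} := by
  have h1 : MeasurableSet {x : Evec n | dist x y < c * bdist Ω x} :=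
    measurableSet_lt (by fun_prop) (by fun_prop)
  exact hΩ.1.measurableSet.inter h1

lemma lintegral_ball_swap [NeZero n] (hΩ : IsBoundedDomain Ω) {c : ℝ} (hc : c ≤ 1)
    (F : Evec n → Evec n → ℝ≥0∞) (hF : Measurable (Function.uncurry F)) :
    ∫⁻ x in Ω, ∫⁻ y in Metric.ball x (c * bdist Ω x), F x y =
      ∫⁻ y in Ω, ∫⁻ x in {x | x ∈ Ω ∧ dist x y < c * bdist Ω x}, F x y := by
  have hmΩ := hΩ.1.measurableSet
  set S : Set (Evec n × Evec n) := {z | z.1 ∈ Ω ∧ dist z.1 z.2 < c * bdist Ω z.1} with hS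
  have hmS : MeasurableSet S := by
    have h1 : MeasurableSet {z : Evec n × Evec n | dist z.1 z.2 < c * bdist Ω z.1} :=
      measurableSet_lt (by fun_prop) (by fun_prop)
    exact (measurable_fst hmΩ).inter h1
  have hG : Measurable (S.indicator (Function.uncurry F)) := hF.indicator hmS
  have hsub : ∀ x y, (x, y) ∈ S → y ∈ Ω := fun x y h => by
    refine ball_bdist_subset hΩ h.1 ?_
    have := h.2
    have hp := bdist_pos hΩ h.1
    simp only [Metric.mem_ball] at this ⊢
    rw [dist_comm]
    nlinarith
  have e1 : ∫⁻ x in Ω, ∫⁻ y in Metric.ball x (c * bdist Ω x), F x y =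
      ∫⁻ x, ∫⁻ y, S.indicator (Function.uncurry F) (x, y) := by
    rw [← lintegral_indicator hmΩ]
    refine lintegral_congr fun x => ?_
    by_cases hx : x ∈ Ω
    · rw [indicator_of_mem hx, ← lintegral_indicator Metric.isOpen_ball.measurableSet]
      refine lintegral_congr fun y => ?_
      by_cases hy : y ∈ Metric.ball x (c * bdist Ω x)
      · rw [indicator_of_mem hy, indicator_of_mem]
        · rfl
        · exact ⟨hx, by rw [dist_comm]; exact hy⟩
      · rw [indicator_of_notMem hy, indicator_of_notMem]
        exact fun h => hy (by rw [Metric.mem_ball, dist_comm]; exact h.2)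
    · rw [indicator_of_notMem hx]
      symm
      rw [lintegral_eq_zero_of_ae_eq_zero]
      exact Eventually.of_forall fun y => indicator_of_notMem (fun h => hx h.1) _
  have e2 : ∫⁻ y in Ω, ∫⁻ x in {x | x ∈ Ω ∧ dist x y < c * bdist Ω x}, F x y =
      ∫⁻ y, ∫⁻ x, S.indicator (Function.uncurry F) (x, y) := by
    rw [← lintegral_indicator hmΩ]
    refine lintegral_congr fun y => ?_
    have hmy : MeasurableSet {x | x ∈ Ω ∧ dist x y < c * bdist Ω x} :=
      measurableSet_near hΩ _ _
    by_cases hy : y ∈ Ω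
    · rw [indicator_of_mem hy, ← lintegral_indicator hmy]
      rfl
    · rw [indicator_of_notMem hy]
      symm
      rw [lintegral_eq_zero_of_ae_eq_zero]
      exact Eventually.of_forall fun x => indicator_of_notMem (fun h => hy (hsub x y h)) _
  rw [e1, e2]
  exact lintegral_lintegral_swap hG.aemeasurable

lemma inv_wvol_le {x y : Evec n} (h : bdist Ω y ≤ 2 * bdist Ω x) :
    (wvol Ω x)⁻¹ ≤ ENNReal.ofReal (2 ^ n) * (wvol Ω y)⁻¹ := by
  have := wvol_le (Ω := Ω) (by norm_num) h
  have h2 : ENNReal.ofReal ((2 : ℝ) ^ n) ≠ 0 := by simp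
  rw [← ENNReal.inv_le_inv, ENNReal.mul_inv (.inl h2) (.inl ENNReal.ofReal_ne_top)] at this
  calc (wvol Ω x)⁻¹ = ENNReal.ofReal (2 ^ n) * ((ENNReal.ofReal (2 ^ n))⁻¹ * (wvol Ω x)⁻¹) := by
        rw [← mul_assoc, ENNReal.mul_inv_cancel h2 ENNReal.ofReal_ne_top, one_mul]
    _ ≤ _ := by gcongr

lemma lintegral_avg_le [NeZero n] (hΩ : IsBoundedDomain Ω) (s : ℝ) :
    ∃ C : ℝ≥0∞, C ≠ ⊤ ∧ ∀ g : Evec n → ℝ≥0∞, Measurable g →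
      ∫⁻ x in Ω, ENNReal.ofReal (bdist Ω x ^ s) *
        ((wvol Ω x)⁻¹ * ∫⁻ y in Metric.ball x (1 / 3 * bdist Ω x), g y) ≤
      C * ∫⁻ y in Ω, ENNReal.ofReal (bdist Ω y ^ s) * g y := by
  refine ⟨ENNReal.ofReal (2 ^ |s|) * ENNReal.ofReal (2 ^ n), by finiteness, fun g hg => ?_⟩
  have hmΩ := hΩ.1.measurableSet
  calc ∫⁻ x in Ω, ENNReal.ofReal (bdist Ω x ^ s) *
        ((wvol Ω x)⁻¹ * ∫⁻ y in Metric.ball x (1 / 3 * bdist Ω x), g y)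
      = ∫⁻ x in Ω, ∫⁻ y in Metric.ball x (1 / 3 * bdist Ω x),
          ENNReal.ofReal (bdist Ω x ^ s) * ((wvol Ω x)⁻¹ * g y) := by
        refine lintegral_congr fun x => ?_
        rw [lintegral_const_mul _ (by fun_prop), lintegral_const_mul _ hg]
    _ = ∫⁻ y in Ω, ∫⁻ x in {x | x ∈ Ω ∧ dist x y < 1 / 3 * bdist Ω x},
          ENNReal.ofReal (bdist Ω x ^ s) * ((wvol Ω x)⁻¹ * g y) :=
        lintegral_ball_swap hΩ (by norm_num) _ (by unfold Function.uncurry; fun_prop)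
    _ ≤ ∫⁻ y in Ω, ENNReal.ofReal (2 ^ |s|) * ENNReal.ofReal (2 ^ n) *
          (ENNReal.ofReal (bdist Ω y ^ s) * g y) := by
        refine setLIntegral_mono' hmΩ fun y hy => ?_
        have hyp := bdist_pos hΩ hy
        have hmy : MeasurableSet {x | x ∈ Ω ∧ dist x y < 1 / 3 * bdist Ω x} :=
          measurableSet_near hΩ _ _
        have hcmp : ∀ x ∈ {x | x ∈ Ω ∧ dist x y < 1 / 3 * bdist Ω x},
            bdist Ω y / 2 ≤ bdist Ω x ∧ bdist Ω x ≤ 3 / 2 * bdist Ω y := by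
          rintro x ⟨hx, hxy⟩
          have h1 := bdist_le_add (Ω := Ω) x y
          have h2 := bdist_le_add (Ω := Ω) y x
          rw [dist_comm] at h2
          constructor <;> linarith
        calc ∫⁻ x in {x | x ∈ Ω ∧ dist x y < 1 / 3 * bdist Ω x},
              ENNReal.ofReal (bdist Ω x ^ s) * ((wvol Ω x)⁻¹ * g y)
            ≤ ∫⁻ x in {x | x ∈ Ω ∧ dist x y < 1 / 3 * bdist Ω x},
              ENNReal.ofReal (2 ^ |s| * bdist Ω y ^ s) *
                (ENNReal.ofReal (2 ^ n) * (wvol Ω y)⁻¹ * g y) := by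
              refine setLIntegral_mono' hmy fun x hx => ?_
              obtain ⟨h1, h2⟩ := hcmp x hx
              refine mul_le_mul' (ENNReal.ofReal_le_ofReal
                (rpow_le_of_comparable hyp h1 (by linarith))) ?_
              exact mul_le_mul' (inv_wvol_le (by linarith)) le_rfl
          _ = ENNReal.ofReal (2 ^ |s| * bdist Ω y ^ s) *
                (ENNReal.ofReal (2 ^ n) * (wvol Ω y)⁻¹ * g y) *
                volume {x | x ∈ Ω ∧ dist x y < 1 / 3 * bdist Ω x} := setLIntegral_const _ _
          _ ≤ ENNReal.ofReal (2 ^ |s| * bdist Ω y ^ s) *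
                (ENNReal.ofReal (2 ^ n) * (wvol Ω y)⁻¹ * g y) * wvol Ω y := by
              refine mul_le_mul' le_rfl (measure_mono fun x hx => ?_)
              obtain ⟨h1, h2⟩ := hcmp x hx
              have := hx.2
              rw [Metric.mem_ball]
              linarith
          _ = ENNReal.ofReal (2 ^ |s|) * ENNReal.ofReal (2 ^ n) *
                (ENNReal.ofReal (bdist Ω y ^ s) * g y) * ((wvol Ω y)⁻¹ * wvol Ω y) := by
              rw [ENNReal.ofReal_mul (by positivity)]
              ring
          _ = _ := by rw [ENNReal.inv_mul_cancel (wvol_ne_zero hΩ hy) (wvol_ne_top y), mul_one]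
    _ = _ := lintegral_const_mul _ (by fun_prop)

lemma lintegral_le_avg [NeZero n] (hΩ : IsBoundedDomain Ω) :
    ∃ C : ℝ≥0∞, C ≠ ⊤ ∧ ∀ h : Evec n → ℝ≥0∞, Measurable h →
      ∫⁻ x in Ω, h x ≤
      C * ∫⁻ y in Ω, (wvol Ω y)⁻¹ * ∫⁻ x in Metric.ball y (1 / 60 * bdist Ω y), h x := by
  have hmΩ := hΩ.1.measurableSet
  set A : ℝ≥0∞ := ENNReal.ofReal (2 ^ n)
  set B : ℝ≥0∞ := ENNReal.ofReal ((1 / 100) ^ n)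
  have hA0 : A ≠ 0 := by simp [A]
  have hAt : A ≠ ⊤ := ENNReal.ofReal_ne_top
  have hB0 : B ≠ 0 := by
    have : (0 : ℝ) < (1 / 100) ^ n := by positivity
    simp [B]
  have hBt : B ≠ ⊤ := ENNReal.ofReal_ne_top
  refine ⟨A * B⁻¹, by finiteness, fun h hh => ?_⟩
  have e : ∫⁻ y in Ω, (wvol Ω y)⁻¹ * ∫⁻ x in Metric.ball y (1 / 60 * bdist Ω y), h x =
      ∫⁻ x in Ω, ∫⁻ y in {y | y ∈ Ω ∧ dist y x < 1 / 60 * bdist Ω y}, (wvol Ω y)⁻¹ * h x := by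
    rw [← lintegral_ball_swap hΩ (by norm_num) (fun y x => (wvol Ω y)⁻¹ * h x)
      (by unfold Function.uncurry; fun_prop)]
    refine lintegral_congr fun y => ?_
    rw [lintegral_const_mul _ hh]
  rw [e, ← lintegral_const_mul' _ _ (by finiteness)]
  refine setLIntegral_mono' hmΩ fun x hx => ?_
  have hxp := bdist_pos hΩ hx
  have hcmp : ∀ y ∈ Metric.ball x (1 / 100 * bdist Ω x),
      y ∈ Ω ∧ dist y x < 1 / 60 * bdist Ω y ∧ bdist Ω y ≤ 2 * bdist Ω x := by
    intro y hy
    have hy' := hy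
    rw [Metric.mem_ball] at hy'
    have h1 := bdist_le_add (Ω := Ω) x y
    have h2 := bdist_le_add (Ω := Ω) y x
    rw [dist_comm] at h1
    refine ⟨ball_bdist_subset hΩ hx (Metric.ball_subset_ball (by linarith) hy), ?_, ?_⟩ <;> linarith
  calc h x = A * B⁻¹ * (A⁻¹ * (wvol Ω x)⁻¹ * h x * (B * wvol Ω x)) := by
        have h3 : (wvol Ω x)⁻¹ * wvol Ω x = 1 :=
          ENNReal.inv_mul_cancel (wvol_ne_zero hΩ hx) (wvol_ne_top x)
        have h1 : A * A⁻¹ = 1 := ENNReal.mul_inv_cancel hA0 hAt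
        have h2 : B⁻¹ * B = 1 := ENNReal.inv_mul_cancel hB0 hBt
        calc h x = (A * A⁻¹) * (B⁻¹ * B) * ((wvol Ω x)⁻¹ * wvol Ω x) * h x := by
              rw [h1, h2, h3]; simp
          _ = _ := by ring
    _ = A * B⁻¹ * ∫⁻ y in Metric.ball x (1 / 100 * bdist Ω x), A⁻¹ * (wvol Ω x)⁻¹ * h x := by
        rw [setLIntegral_const, volume_ball_mul _ (by norm_num)]
        rfl
    _ ≤ A * B⁻¹ * ∫⁻ y in Metric.ball x (1 / 100 * bdist Ω x), (wvol Ω y)⁻¹ * h x := by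
        refine mul_le_mul' le_rfl (setLIntegral_mono' Metric.isOpen_ball.measurableSet fun y hy => ?_)
        refine mul_le_mul' ?_ le_rfl
        rw [← ENNReal.mul_inv (.inl hA0) (.inl hAt), ENNReal.inv_le_inv]
        exact wvol_le (by norm_num) (hcmp y hy).2.2
    _ ≤ _ := by
        refine mul_le_mul' le_rfl (lintegral_mono_set fun y hy => ?_)
        exact ⟨(hcmp y hy).1, (hcmp y hy).2.1⟩

end Geometry

section Smoothing

variable {n : ℕ} {Ω : Set (Evec n)}

/-- A bump function supported in the ball of radius `1 / 32`. -/
def molBump (n : ℕ) : ContDiffBump (0 : Evec n) := ⟨1 / 64, 1 / 32, by norm_num, by norm_num⟩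

/-- The smoothing kernel, at scale comparable to the distance to the boundary. -/
def sker (Ω : Set (Evec n)) (x y : Evec n) : ℝ := molBump n ((bdist Ω y)⁻¹ • (x - y))

/-- The derivative of the smoothing kernel in its first variable. -/
def dker (Ω : Set (Evec n)) (x y : Evec n) : Evec n →L[ℝ] ℝ :=
  (bdist Ω y)⁻¹ • fderiv ℝ (molBump n) ((bdist Ω y)⁻¹ • (x - y))

lemma isTest_molBump : IsTest (molBump n : Evec n → ℝ) :=
  ⟨(molBump n).contDiff, (molBump n).hasCompactSupport⟩

lemma sker_nonneg (x y : Evec n) : 0 ≤ sker Ω x y := (molBump n).nonneg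

lemma sker_le_one (x y : Evec n) : sker Ω x y ≤ 1 := (molBump n).le_one

lemma enorm_sker_le_one (x y : Evec n) : ‖sker Ω x y‖ₑ ≤ 1 := by
  rw [Real.enorm_of_nonneg (sker_nonneg x y), ← ENNReal.ofReal_one]
  exact ENNReal.ofReal_le_ofReal (sker_le_one x y)

lemma measurable_sker (x : Evec n) : Measurable (sker Ω x) := by
  have h : Measurable (molBump n : Evec n → ℝ) := (molBump n).continuous.measurable
  unfold sker
  fun_prop

lemma measurable_dker (x : Evec n) : Measurable (dker Ω x) := by
  have h : Measurable (fderiv ℝ (molBump n : Evec n → ℝ)) := isTest_molBump.fderiv.continuous.measurable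
  unfold dker
  fun_prop

lemma hasFDerivAt_sker (x y : Evec n) : HasFDerivAt (fun x => sker Ω x y) (dker Ω x y) x := by
  have h1 : HasFDerivAt (fun x : Evec n => (bdist Ω y)⁻¹ • (x - y))
      ((bdist Ω y)⁻¹ • ContinuousLinearMap.id ℝ (Evec n)) x :=
    HasFDerivAt.fun_const_smul ((hasFDerivAt_id x).sub_const y) (bdist Ω y)⁻¹
  have h2 := (isTest_molBump.differentiable ((bdist Ω y)⁻¹ • (x - y))).hasFDerivAt.comp x h1
  refine h2.congr_fderiv ?_
  ext z
  simp [dker]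

lemma exists_norm_dker_le (n : ℕ) : ∃ M : ℝ, 0 ≤ M ∧ ∀ (Ω : Set (Evec n)) (x y : Evec n),
    ‖dker Ω x y‖ ≤ (bdist Ω y)⁻¹ * M := by
  obtain ⟨M, hM0, hM⟩ := (isTest_molBump (n := n)).fderiv.bdd
  refine ⟨M, hM0.le, fun Ω x y => ?_⟩
  have h : 0 ≤ bdist Ω y := Metric.infDist_nonneg
  rw [dker, norm_smul, norm_inv, Real.norm_of_nonneg h]
  exact mul_le_mul_of_nonneg_left (hM _) (inv_nonneg.2 Metric.infDist_nonneg)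

lemma ker_eq_zero [NeZero n] (hΩ : IsBoundedDomain Ω) {x₀ x y : Evec n} (hx₀ : x₀ ∈ Ω)
    (hx : x ∈ Metric.ball x₀ (1 / 10000 * bdist Ω x₀)) (hy : y ∈ Ω)
    (hyB : y ∉ Metric.ball x₀ (1 / 30 * bdist Ω x₀)) : sker Ω x y = 0 ∧ dker Ω x y = 0 := by
  have hyp := bdist_pos hΩ hy
  have hz : (bdist Ω y)⁻¹ • (x - y) ∉ tsupport (molBump n) := by
    rw [(molBump n).tsupport_eq, mem_closedBall_zero_iff, norm_smul, norm_inv, Real.norm_of_nonneg hyp.le,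
      ← dist_eq_norm, not_le, inv_mul_eq_div, lt_div_iff₀ hyp]
    by_contra! h
    change dist x y ≤ 1 / 32 * bdist Ω y at h
    refine hyB ?_
    rw [Metric.mem_ball] at hx ⊢
    have h1 := bdist_le_add (Ω := Ω) y x₀
    have h2 := dist_triangle y x x₀
    rw [dist_comm y x] at h2
    have := bdist_pos hΩ hx₀
    linarith
  refine ⟨image_eq_zero_of_notMem_tsupport (f := molBump n) hz, ?_⟩
  rw [dker, image_eq_zero_of_notMem_tsupport (fun h => hz (tsupport_fderiv_subset ℝ h)), smul_zero]

/-- The unnormalised smoothing of `f`. -/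
def smth (Ω : Set (Evec n)) (f : Evec n → ℝ) (x : Evec n) : ℝ := ∫ y in Ω, sker Ω x y * f y

/-- The smoothing of `f` at scale comparable to the distance to the boundary. -/
def smoothing (Ω : Set (Evec n)) (f : Evec n → ℝ) (x : Evec n) : ℝ :=
  smth Ω f x / smth Ω (fun _ => 1) x

lemma smth_bounds [NeZero n] (hΩ : IsBoundedDomain Ω) {f : Evec n → ℝ} (hf : Measurable f)
    {x₀ : Evec n} (hx₀ : x₀ ∈ Ω) (hfi : IntegrableOn f (Metric.ball x₀ (1 / 30 * bdist Ω x₀))) :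
    IntegrableOn (fun y => sker Ω x₀ y * f y) Ω ∧ IntegrableOn (fun y => f y • dker Ω x₀ y) Ω ∧
    HasFDerivAt (smth Ω f) (∫ y in Ω, f y • dker Ω x₀ y) x₀ := by
  obtain ⟨M, hM0, hM⟩ := exists_norm_dker_le n
  have hmΩ := hΩ.1.measurableSet
  have h0 := bdist_pos hΩ hx₀
  set B := Metric.ball x₀ (1 / 30 * bdist Ω x₀) with hB
  have hmB : MeasurableSet B := Metric.isOpen_ball.measurableSet
  set N := Metric.ball x₀ (1 / 10000 * bdist Ω x₀) with hN
  have hx₀N : x₀ ∈ N := Metric.mem_ball_self (by positivity)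
  have hbi : Integrable (B.indicator f) := (integrable_indicator_iff hmB).2 hfi
  have hM1 : ∀ y ∈ B, ∀ x, ‖dker Ω x y‖ ≤ 2 * (bdist Ω x₀)⁻¹ * M := by
    intro y hy x
    refine (hM Ω x y).trans (mul_le_mul_of_nonneg_right ?_ hM0)
    have h1 := bdist_le_add (Ω := Ω) x₀ y
    rw [hB, Metric.mem_ball, dist_comm] at hy
    have h2 : bdist Ω x₀ / 2 ≤ bdist Ω y := by linarith
    calc (bdist Ω y)⁻¹ ≤ (bdist Ω x₀ / 2)⁻¹ := inv_anti₀ (by positivity) h2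
      _ = 2 * (bdist Ω x₀)⁻¹ := by rw [inv_div]; rfl
  set bound : Evec n → ℝ := fun y => 2 * (bdist Ω x₀)⁻¹ * M * ‖B.indicator f y‖ with hbound
  have hbnd : ∀ x ∈ N, ∀ y ∈ Ω, ‖f y • dker Ω x y‖ ≤ bound y := by
    intro x hx y hy
    by_cases hyB : y ∈ B
    · rw [hbound]
      dsimp only
      rw [indicator_of_mem hyB, norm_smul, mul_comm]
      exact mul_le_mul_of_nonneg_right (hM1 y hyB x) (norm_nonneg _)
    · rw [(ker_eq_zero hΩ hx₀ hx hy hyB).2, smul_zero, norm_zero]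
      positivity
  have hboundi : Integrable bound (volume.restrict Ω) := (hbi.norm.const_mul _).restrict
  have i1 : IntegrableOn (fun y => sker Ω x₀ y * f y) Ω := by
    refine (hbi.norm.restrict (s := Ω)).mono' ((measurable_sker x₀).mul hf).aestronglyMeasurable ?_
    rw [ae_restrict_iff' hmΩ]
    refine ae_of_all _ fun y hy => ?_
    by_cases hyB : y ∈ B
    · rw [indicator_of_mem hyB, norm_mul, Real.norm_of_nonneg (sker_nonneg _ _)]
      exact mul_le_of_le_one_left (norm_nonneg _) (sker_le_one _ _)
    · rw [(ker_eq_zero hΩ hx₀ hx₀N hy hyB).1, zero_mul, norm_zero]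
      positivity
  have m2 : AEStronglyMeasurable (fun y => f y • dker Ω x₀ y) (volume.restrict Ω) :=
    (hf.smul (measurable_dker x₀)).aestronglyMeasurable
  refine ⟨i1, ?_, ?_⟩
  · refine hboundi.mono' m2 ?_
    rw [ae_restrict_iff' hmΩ]
    exact ae_of_all _ fun y hy => hbnd x₀ hx₀N y hy
  · refine hasFDerivAt_integral_of_dominated_of_fderiv_le (F' := fun x y => f y • dker Ω x y)
      (Metric.isOpen_ball.mem_nhds hx₀N)
      (Eventually.of_forall fun x => ((measurable_sker x).mul hf).aestronglyMeasurable) i1 m2 ?_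
      hboundi ?_
    · rw [ae_restrict_iff' hmΩ]
      exact ae_of_all _ fun y hy x hx => hbnd x hx y hy
    · exact ae_of_all _ fun y x _ => (hasFDerivAt_sker x y).mul_const (f y)

lemma setLIntegral_le_ball {B : Set (Evec n)} (hB : MeasurableSet B) {h g : Evec n → ℝ≥0∞}
    (h0 : ∀ y ∈ Ω, y ∉ B → h y = 0) (hg : ∀ y ∈ B, h y ≤ g y) (hm : MeasurableSet Ω) :
    ∫⁻ y in Ω, h y ≤ ∫⁻ y in B, g y := by
  rw [← lintegral_indicator hm, ← lintegral_indicator hB]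
  refine lintegral_mono fun y => ?_
  by_cases hy : y ∈ B
  · rw [indicator_of_mem hy]
    exact (indicator_le_self _ _ _).trans (hg y hy)
  · rw [indicator_of_notMem hy]
    by_cases hyΩ : y ∈ Ω
    · rw [indicator_of_mem hyΩ, h0 y hyΩ hy]
    · rw [indicator_of_notMem hyΩ]

lemma inv_smth_one_le [NeZero n] (hΩ : IsBoundedDomain Ω) {x : Evec n} (hx : x ∈ Ω) :
    0 < smth Ω (fun _ => 1) x ∧
    ‖(smth Ω (fun _ => 1) x)⁻¹‖ₑ ≤ ENNReal.ofReal (100 ^ n) * (wvol Ω x)⁻¹ := by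
  have h0 := bdist_pos hΩ hx
  have hi := (smth_bounds hΩ (f := fun _ => 1) measurable_const hx
    (integrableOn_const measure_ball_lt_top.ne)).1
  have hle : ENNReal.ofReal ((1 / 100) ^ n) * wvol Ω x ≤ ENNReal.ofReal (smth Ω (fun _ => 1) x) := by
    rw [smth, ofReal_integral_eq_lintegral_ofReal hi
      (ae_of_all _ fun y => mul_nonneg (sker_nonneg _ _) zero_le_one), wvol,
      ← volume_ball_mul _ (by norm_num), ← setLIntegral_one]
    refine (setLIntegral_mono' Metric.isOpen_ball.measurableSet fun y hy => ?_).trans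
      (lintegral_mono_set (s := Metric.ball x (1 / 100 * bdist Ω x))
        ((Metric.ball_subset_ball (by linarith)).trans (ball_bdist_subset hΩ hx)))
    rw [Metric.mem_ball, dist_comm] at hy
    have h1 := bdist_le_add (Ω := Ω) x y
    have hyp : 0 < bdist Ω y := by linarith
    have : sker Ω x y = 1 := by
      refine (molBump n).one_of_mem_closedBall ?_
      rw [mem_closedBall_zero_iff, norm_smul, norm_inv, Real.norm_of_nonneg hyp.le,
        ← dist_eq_norm, inv_mul_eq_div, div_le_iff₀ hyp]
      change dist x y ≤ 1 / 64 * bdist Ω y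
      linarith
    rw [this]
    simp
  have hc : (0 : ℝ) < (1 / 100) ^ n := by positivity
  have hpos : 0 < smth Ω (fun _ => 1) x := by
    rw [← ENNReal.ofReal_pos]
    refine lt_of_lt_of_le ?_ hle
    exact ENNReal.mul_pos (ENNReal.ofReal_pos.2 hc).ne' (wvol_ne_zero hΩ hx)
  refine ⟨hpos, ?_⟩
  rw [Real.enorm_of_nonneg (inv_nonneg.2 hpos.le), ENNReal.ofReal_inv_of_pos hpos,
    show (100 : ℝ) ^ n = ((1 / 100) ^ n)⁻¹ by rw [one_div, inv_pow, inv_inv],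
    ENNReal.ofReal_inv_of_pos hc, ← ENNReal.mul_inv (.inr (wvol_ne_top x)) (.inl ENNReal.ofReal_ne_top),
    ENNReal.inv_le_inv]
  exact hle

lemma enorm_sub_smoothing_le [NeZero n] (hΩ : IsBoundedDomain Ω) {f : Evec n → ℝ} (hf : Measurable f)
    {x : Evec n} (hx : x ∈ Ω) (hfi : IntegrableOn f (Metric.ball x (1 / 30 * bdist Ω x))) (A : ℝ) :
    ‖A - smoothing Ω f x‖ₑ ≤ ENNReal.ofReal (100 ^ n) *
      ((wvol Ω x)⁻¹ * ∫⁻ z in Metric.ball x (1 / 30 * bdist Ω x), ‖A - f z‖ₑ) := by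
  obtain ⟨hpos, hinv⟩ := inv_smth_one_le hΩ hx
  have h0 := bdist_pos hΩ hx
  have i1 := (smth_bounds hΩ (f := fun _ => A) measurable_const hx
    (integrableOn_const measure_ball_lt_top.ne)).1
  have i2 := (smth_bounds hΩ hf hx hfi).1
  have e : A - smoothing Ω f x = (smth Ω (fun _ => 1) x)⁻¹ * ∫ y in Ω, sker Ω x y * (A - f y) := by
    have e1 : ∫ y in Ω, sker Ω x y * (A - f y) = A * smth Ω (fun _ => 1) x - smth Ω f x := by
      simp only [mul_sub]
      rw [integral_sub i1 i2, smth, smth, ← integral_const_mul]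
      congr 2
      funext y
      ring
    rw [e1, smoothing]
    field_simp
  rw [e, enorm_mul, ← mul_assoc]
  refine mul_le_mul' hinv ((enorm_integral_le_lintegral_enorm _).trans ?_)
  refine setLIntegral_le_ball Metric.isOpen_ball.measurableSet (fun y hy hyB => ?_) (fun y _ => ?_)
    hΩ.1.measurableSet
  · rw [(ker_eq_zero hΩ hx (Metric.mem_ball_self (by positivity)) hy hyB).1, zero_mul, enorm_zero]
  · rw [enorm_mul]
    exact mul_le_of_le_one_left' (enorm_sker_le_one _ _)

lemma fderiv_smoothing_le (n : ℕ) [NeZero n] : ∃ C : ℝ≥0∞, C ≠ ⊤ ∧ ∀ Ω : Set (Evec n),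
    IsBoundedDomain Ω → ∀ f : Evec n → ℝ, Measurable f → ∀ x ∈ Ω,
    IntegrableOn f (Metric.ball x (1 / 30 * bdist Ω x)) →
    DifferentiableAt ℝ (smoothing Ω f) x ∧
    ‖fderiv ℝ (smoothing Ω f) x‖ₑ ≤ C * (ENNReal.ofReal (bdist Ω x)⁻¹ *
      ((wvol Ω x)⁻¹ * ∫⁻ y in Metric.ball x (1 / 30 * bdist Ω x),
        (wvol Ω x)⁻¹ * ∫⁻ z in Metric.ball x (1 / 30 * bdist Ω x), ‖f y - f z‖ₑ)) := by
  obtain ⟨M, hM0, hM⟩ := exists_norm_dker_le n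
  refine ⟨ENNReal.ofReal (100 ^ n) * ENNReal.ofReal (2 * M) * ENNReal.ofReal (100 ^ n),
    by finiteness, fun Ω hΩ f hf x hx hfi => ?_⟩
  obtain ⟨hpos, hinv⟩ := inv_smth_one_le hΩ hx
  have h0 := bdist_pos hΩ hx
  obtain ⟨-, i1, d1⟩ := smth_bounds hΩ (f := fun _ => (1 : ℝ)) measurable_const hx
    (integrableOn_const measure_ball_lt_top.ne)
  obtain ⟨-, i2, d2⟩ := smth_bounds hΩ hf hx hfi
  set m := smoothing Ω f x with hm
  have hinvd : HasFDerivAt (fun x => (smth Ω (fun _ => 1) x)⁻¹) _ x :=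
    (hasDerivAt_inv hpos.ne').comp_hasFDerivAt x d1
  have hd : HasFDerivAt (smoothing Ω f)
      ((smth Ω (fun _ => 1) x)⁻¹ • ∫ y in Ω, (f y - m) • dker Ω x y) x := by
    have := d2.mul hinvd
    refine this.congr_fderiv ?_
    have e1 : ∫ y in Ω, (f y - m) • dker Ω x y =
        (∫ y in Ω, f y • dker Ω x y) - m • ∫ y in Ω, (1 : ℝ) • dker Ω x y := by
      have i3 : IntegrableOn (fun y => m • (1 : ℝ) • dker Ω x y) Ω := i1.smul m
      rw [← integral_smul, ← integral_sub i2 i3]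
      congr 1
      funext y
      ext z
      simp
      ring
    rw [e1, hm, smoothing]
    ext z
    simp
    field_simp
    ring
  refine ⟨hd.differentiableAt, ?_⟩
  rw [hd.fderiv, enorm_smul]
  calc _ ≤ ENNReal.ofReal (100 ^ n) * (wvol Ω x)⁻¹ *
        ∫⁻ y in Metric.ball x (1 / 30 * bdist Ω x),
          (ENNReal.ofReal (2 * M) * ENNReal.ofReal (bdist Ω x)⁻¹) * (ENNReal.ofReal (100 ^ n) *
          ((wvol Ω x)⁻¹ * ∫⁻ z in Metric.ball x (1 / 30 * bdist Ω x), ‖f y - f z‖ₑ)) := by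
        refine mul_le_mul' hinv ((enorm_integral_le_lintegral_enorm _).trans ?_)
        refine setLIntegral_le_ball Metric.isOpen_ball.measurableSet (fun y hy hyB => ?_)
          (fun y hy => ?_) hΩ.1.measurableSet
        · rw [(ker_eq_zero hΩ hx (Metric.mem_ball_self (by positivity)) hy hyB).2, smul_zero]
          simp
        · rw [enorm_smul, mul_comm]
          refine mul_le_mul' ?_ (enorm_sub_smoothing_le hΩ hf hx hfi (f y))
          rw [← ofReal_norm, ← ENNReal.ofReal_mul (by positivity)]
          refine ENNReal.ofReal_le_ofReal ((hM Ω x y).trans ?_)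
          have h1 := bdist_le_add (Ω := Ω) x y
          rw [Metric.mem_ball, dist_comm] at hy
          have h2 : bdist Ω x / 2 ≤ bdist Ω y := by linarith
          calc (bdist Ω y)⁻¹ * M ≤ (bdist Ω x / 2)⁻¹ * M :=
                mul_le_mul_of_nonneg_right (inv_anti₀ (by positivity) h2) hM0
            _ = _ := by rw [inv_div]; ring
    _ = _ := by
        have hmeas : Measurable fun y => ∫⁻ z in Metric.ball x (1 / 30 * bdist Ω x), ‖f y - f z‖ₑ :=
          Measurable.lintegral_prod_right' (f := fun z : Evec n × Evec n => ‖f z.1 - f z.2‖ₑ)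
            (by fun_prop)
        rw [lintegral_const_mul _ (by fun_prop), lintegral_const_mul _ (by fun_prop)]
        ring

end Smoothing

section SmoothingEstimates

variable {n : ℕ} {Ω : Set (Evec n)}

lemma avg_rpow_le {p : ℝ} (hp : 1 < p) {W : ℝ≥0∞} (hW0 : W ≠ 0) (hWt : W ≠ ⊤) {B : Set (Evec n)}
    (hB : volume B ≤ W) {h : Evec n → ℝ≥0∞} (hh : Measurable h) :
    (W⁻¹ * ∫⁻ x in B, h x) ^ p ≤ W⁻¹ * ∫⁻ x in B, h x ^ p := by
  have hp0 : 0 ≤ p := by linarith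
  have h1 := lintegral_rpow_le_measure_mul hp (hh.aemeasurable (μ := volume.restrict B))
  rw [Measure.restrict_apply_univ] at h1
  rw [ENNReal.mul_rpow_of_nonneg _ _ hp0]
  calc W⁻¹ ^ p * (∫⁻ x in B, h x) ^ p ≤ W⁻¹ ^ p * (W ^ (p - 1) * ∫⁻ x in B, h x ^ p) :=
        mul_le_mul' le_rfl (h1.trans (mul_le_mul' (ENNReal.rpow_le_rpow hB (by linarith)) le_rfl))
    _ = _ := by
        rw [← mul_assoc, ENNReal.inv_rpow, ← ENNReal.rpow_neg, ← ENNReal.rpow_add _ _ hW0 hWt,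
          show -p + (p - 1) = -1 by ring, ENNReal.rpow_neg_one]

lemma volume_ball_le_wvol (x : Evec n) {c : ℝ} (hc : c ≤ 1) :
    volume (Metric.ball x (c * bdist Ω x)) ≤ wvol Ω x :=
  measure_mono (Metric.ball_subset_ball
    (mul_le_of_le_one_left (Metric.infDist_nonneg : 0 ≤ bdist Ω x) hc))

lemma measurable_lintegral_ball (c : ℝ) {F : Evec n → Evec n → ℝ≥0∞}
    (hF : Measurable (Function.uncurry F)) :
    Measurable fun x => ∫⁻ y in Metric.ball x (c * bdist Ω x), F x y := by
  have hmS : MeasurableSet {z : Evec n × Evec n | dist z.2 z.1 < c * bdist Ω z.1} :=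
    measurableSet_lt (by fun_prop) (by fun_prop)
  have e : (fun x => ∫⁻ y in Metric.ball x (c * bdist Ω x), F x y) = fun x => ∫⁻ y,
      {z : Evec n × Evec n | dist z.2 z.1 < c * bdist Ω z.1}.indicator (Function.uncurry F) (x, y) := by
    funext x
    rw [← lintegral_indicator Metric.isOpen_ball.measurableSet]
    rfl
  rw [e]
  exact (hF.indicator hmS).lintegral_prod_right'

/-- The oscillation of `f` on balls well inside `Ω` is controlled by the energy density `g`. -/
def OscBound (Ω : Set (Evec n)) (p : ℝ) (C : ℝ≥0∞) (f : Evec n → ℝ) (g : Evec n → ℝ≥0∞) : Prop :=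
  ∀ x ∈ Ω, ∫⁻ y in Metric.ball x (1 / 12 * bdist Ω x), ∫⁻ z in Metric.ball x (1 / 12 * bdist Ω x),
    ‖f y - f z‖ₑ ^ p ≤ C * wvol Ω x * ∫⁻ y in Metric.ball x (1 / 3 * bdist Ω x), g y

lemma fderiv_smoothing_energy_le [NeZero n] (hΩ : IsBoundedDomain Ω) {p : ℝ} (hp : 1 < p) (b : ℝ)
    {C₀ : ℝ≥0∞} (hC₀ : C₀ ≠ ⊤) : ∃ C : ℝ≥0∞, C ≠ ⊤ ∧ ∀ (f : Evec n → ℝ) (g : Evec n → ℝ≥0∞),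
      Measurable f → Measurable g →
      (∀ x ∈ Ω, IntegrableOn f (Metric.ball x (1 / 30 * bdist Ω x))) → OscBound Ω p C₀ f g →
      ∫⁻ x in Ω, ENNReal.ofReal (bdist Ω x ^ b) * ‖fderiv ℝ (smoothing Ω f) x‖ₑ ^ p ≤
        C * ∫⁻ x in Ω, ENNReal.ofReal (bdist Ω x ^ (b - p)) * g x := by
  obtain ⟨C1, hC1, h1⟩ := fderiv_smoothing_le n
  obtain ⟨C2, hC2, h2⟩ := lintegral_avg_le hΩ (b - p)
  have hp0 : 0 ≤ p := by linarith
  have hC1p : C1 ^ p ≠ ⊤ := ENNReal.rpow_ne_top_of_nonneg hp0 hC1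
  refine ⟨C1 ^ p * C₀ * C2, by finiteness, fun f g hf hg hfi hosc => ?_⟩
  rw [mul_assoc]
  refine le_trans ?_ (mul_le_mul' le_rfl (h2 g hg))
  rw [← lintegral_const_mul' _ _ (by finiteness)]
  refine setLIntegral_mono' hΩ.1.measurableSet fun x hx => ?_
  have h0 := bdist_pos hΩ hx
  have hW0 := wvol_ne_zero hΩ hx
  have hWt := wvol_ne_top (Ω := Ω) x
  have hWi : (wvol Ω x)⁻¹ * wvol Ω x = 1 := ENNReal.inv_mul_cancel hW0 hWt
  set B := Metric.ball x (1 / 30 * bdist Ω x)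
  have hBW : volume B ≤ wvol Ω x := volume_ball_le_wvol x (by norm_num)
  have hB12 : B ⊆ Metric.ball x (1 / 12 * bdist Ω x) := Metric.ball_subset_ball (by linarith)
  have hm1 : Measurable fun y => ∫⁻ z in B, ‖f y - f z‖ₑ :=
    Measurable.lintegral_prod_right' (f := fun z : Evec n × Evec n => ‖f z.1 - f z.2‖ₑ) (by fun_prop)
  have hm2 : Measurable fun y => ∫⁻ z in B, ‖f y - f z‖ₑ ^ p :=
    Measurable.lintegral_prod_right' (f := fun z : Evec n × Evec n => ‖f z.1 - f z.2‖ₑ ^ p) (by fun_prop)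
  have hav : ((wvol Ω x)⁻¹ * ∫⁻ y in B, (wvol Ω x)⁻¹ * ∫⁻ z in B, ‖f y - f z‖ₑ) ^ p ≤
      (wvol Ω x)⁻¹ * (C₀ * ∫⁻ y in Metric.ball x (1 / 3 * bdist Ω x), g y) := by
    refine (avg_rpow_le hp hW0 hWt hBW (by fun_prop)).trans (mul_le_mul' le_rfl ?_)
    calc ∫⁻ y in B, ((wvol Ω x)⁻¹ * ∫⁻ z in B, ‖f y - f z‖ₑ) ^ p
        ≤ ∫⁻ y in B, (wvol Ω x)⁻¹ * ∫⁻ z in B, ‖f y - f z‖ₑ ^ p :=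
          lintegral_mono fun y => avg_rpow_le hp hW0 hWt hBW (by fun_prop)
      _ = (wvol Ω x)⁻¹ * ∫⁻ y in B, ∫⁻ z in B, ‖f y - f z‖ₑ ^ p := lintegral_const_mul _ hm2
      _ ≤ (wvol Ω x)⁻¹ * (C₀ * wvol Ω x * ∫⁻ y in Metric.ball x (1 / 3 * bdist Ω x), g y) :=
          mul_le_mul' le_rfl (((lintegral_mono_set hB12).trans
            (lintegral_mono fun y => lintegral_mono_set hB12)).trans (hosc x hx))
      _ = ((wvol Ω x)⁻¹ * wvol Ω x) * (C₀ * ∫⁻ y in Metric.ball x (1 / 3 * bdist Ω x), g y) := by ring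
      _ = _ := by rw [hWi, one_mul]
  calc ENNReal.ofReal (bdist Ω x ^ b) * ‖fderiv ℝ (smoothing Ω f) x‖ₑ ^ p
      ≤ ENNReal.ofReal (bdist Ω x ^ b) * (C1 ^ p * (ENNReal.ofReal ((bdist Ω x)⁻¹ ^ p) *
          ((wvol Ω x)⁻¹ * (C₀ * ∫⁻ y in Metric.ball x (1 / 3 * bdist Ω x), g y)))) := by
        refine mul_le_mul' le_rfl
          ((ENNReal.rpow_le_rpow (h1 Ω hΩ f hf x hx (hfi x hx)).2 hp0).trans ?_)
        rw [ENNReal.mul_rpow_of_nonneg _ _ hp0, ENNReal.mul_rpow_of_nonneg _ _ hp0,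
          ENNReal.ofReal_rpow_of_pos (by positivity)]
        exact mul_le_mul' le_rfl (mul_le_mul' le_rfl hav)
    _ = C1 ^ p * C₀ * (ENNReal.ofReal (bdist Ω x ^ b) * ENNReal.ofReal ((bdist Ω x)⁻¹ ^ p) *
          ((wvol Ω x)⁻¹ * ∫⁻ y in Metric.ball x (1 / 3 * bdist Ω x), g y)) := by ring
    _ = _ := by
        rw [← ENNReal.ofReal_mul (by positivity), Real.inv_rpow h0.le, ← Real.rpow_neg h0.le,
          ← Real.rpow_add h0, ← sub_eq_add_neg]

lemma sub_smoothing_energy_le [NeZero n] (hΩ : IsBoundedDomain Ω) {p : ℝ} (hp : 1 < p) (a : ℝ)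
    {C₀ : ℝ≥0∞} (hC₀ : C₀ ≠ ⊤) : ∃ C : ℝ≥0∞, C ≠ ⊤ ∧ ∀ (f : Evec n → ℝ) (g : Evec n → ℝ≥0∞),
      Measurable f → Measurable g →
      (∀ x ∈ Ω, IntegrableOn f (Metric.ball x (1 / 30 * bdist Ω x))) → OscBound Ω p C₀ f g →
      ∫⁻ x in Ω, ENNReal.ofReal (bdist Ω x ^ a) * ‖f x - smoothing Ω f x‖ₑ ^ p ≤
        C * ∫⁻ x in Ω, ENNReal.ofReal (bdist Ω x ^ a) * g x := by
  obtain ⟨C1, hC1, h1⟩ := lintegral_le_avg hΩ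
  obtain ⟨C2, hC2, h2⟩ := lintegral_avg_le hΩ a
  have hp0 : 0 ≤ p := by linarith
  set N : ℝ≥0∞ := ENNReal.ofReal (100 ^ n) ^ p with hN
  have hNt : N ≠ ⊤ := ENNReal.rpow_ne_top_of_nonneg hp0 ENNReal.ofReal_ne_top
  set A : ℝ≥0∞ := ENNReal.ofReal (2 ^ |a|) * ENNReal.ofReal (2 ^ n) with hA
  have hmΩ := hΩ.1.measurableSet
  refine ⟨N * C1 * (A * C₀) * C2, by finiteness, fun f g hf hg hfi hosc => ?_⟩
  set h : Evec n → ℝ≥0∞ := fun x => ENNReal.ofReal (bdist Ω x ^ a) *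
    ((wvol Ω x)⁻¹ * ∫⁻ z in Metric.ball x (1 / 30 * bdist Ω x), ‖f x - f z‖ₑ ^ p) with hh
  have hhm : Measurable h := by
    have := measurable_lintegral_ball (Ω := Ω) (1 / 30) (F := fun x z => ‖f x - f z‖ₑ ^ p)
      (by unfold Function.uncurry; fun_prop)
    fun_prop
  have hpt : ∀ y ∈ Ω, ∀ x ∈ Metric.ball y (1 / 60 * bdist Ω y), h x ≤
      A * ENNReal.ofReal (bdist Ω y ^ a) * (wvol Ω y)⁻¹ *
        ∫⁻ z in Metric.ball y (1 / 12 * bdist Ω y), ‖f x - f z‖ₑ ^ p := by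
    intro y hy x hxy
    have h0 := bdist_pos hΩ hy
    rw [Metric.mem_ball] at hxy
    have e1 := bdist_le_add (Ω := Ω) x y
    have e2 := bdist_le_add (Ω := Ω) y x
    rw [dist_comm] at e2
    have hsub : Metric.ball x (1 / 30 * bdist Ω x) ⊆ Metric.ball y (1 / 12 * bdist Ω y) :=
      Metric.ball_subset_ball' (by linarith)
    calc h x ≤ ENNReal.ofReal (2 ^ |a| * bdist Ω y ^ a) * ((ENNReal.ofReal (2 ^ n) * (wvol Ω y)⁻¹) *
          ∫⁻ z in Metric.ball y (1 / 12 * bdist Ω y), ‖f x - f z‖ₑ ^ p) := by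
          refine mul_le_mul' (ENNReal.ofReal_le_ofReal
            (rpow_le_of_comparable h0 (by linarith) (by linarith))) ?_
          exact mul_le_mul' (inv_wvol_le (by linarith)) (lintegral_mono_set hsub)
      _ = _ := by
          rw [ENNReal.ofReal_mul (by positivity), hA]
          ring
  calc ∫⁻ x in Ω, ENNReal.ofReal (bdist Ω x ^ a) * ‖f x - smoothing Ω f x‖ₑ ^ p
      ≤ ∫⁻ x in Ω, N * h x := by
        refine setLIntegral_mono' hmΩ fun x hx => ?_
        have hW0 := wvol_ne_zero hΩ hx
        have hWt := wvol_ne_top (Ω := Ω) x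
        calc ENNReal.ofReal (bdist Ω x ^ a) * ‖f x - smoothing Ω f x‖ₑ ^ p
            ≤ ENNReal.ofReal (bdist Ω x ^ a) * (N * ((wvol Ω x)⁻¹ *
              ∫⁻ z in Metric.ball x (1 / 30 * bdist Ω x), ‖f x - f z‖ₑ ^ p)) := by
              refine mul_le_mul' le_rfl ((ENNReal.rpow_le_rpow
                (enorm_sub_smoothing_le hΩ hf hx (hfi x hx) (f x)) hp0).trans ?_)
              rw [ENNReal.mul_rpow_of_nonneg _ _ hp0]
              exact mul_le_mul' le_rfl (avg_rpow_le hp hW0 hWt (volume_ball_le_wvol x (by norm_num))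
                (by fun_prop))
          _ = _ := by rw [hh]; ring
    _ = N * ∫⁻ x in Ω, h x := lintegral_const_mul _ hhm
    _ ≤ N * (C1 * ∫⁻ y in Ω, (wvol Ω y)⁻¹ * ∫⁻ x in Metric.ball y (1 / 60 * bdist Ω y), h x) :=
        mul_le_mul' le_rfl (h1 h hhm)
    _ ≤ N * (C1 * ∫⁻ y in Ω, A * C₀ * (ENNReal.ofReal (bdist Ω y ^ a) *
          ((wvol Ω y)⁻¹ * ∫⁻ z in Metric.ball y (1 / 3 * bdist Ω y), g z))) := by
        refine mul_le_mul' le_rfl (mul_le_mul' le_rfl (setLIntegral_mono' hmΩ fun y hy => ?_))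
        have hWi : (wvol Ω y)⁻¹ * wvol Ω y = 1 :=
          ENNReal.inv_mul_cancel (wvol_ne_zero hΩ hy) (wvol_ne_top y)
        have h0 := bdist_pos hΩ hy
        have hm2 : Measurable fun x => ∫⁻ z in Metric.ball y (1 / 12 * bdist Ω y), ‖f x - f z‖ₑ ^ p :=
          Measurable.lintegral_prod_right' (f := fun z : Evec n × Evec n => ‖f z.1 - f z.2‖ₑ ^ p)
            (by fun_prop)
        calc (wvol Ω y)⁻¹ * ∫⁻ x in Metric.ball y (1 / 60 * bdist Ω y), h x
            ≤ (wvol Ω y)⁻¹ * ∫⁻ x in Metric.ball y (1 / 60 * bdist Ω y),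
              A * ENNReal.ofReal (bdist Ω y ^ a) * (wvol Ω y)⁻¹ *
              ∫⁻ z in Metric.ball y (1 / 12 * bdist Ω y), ‖f x - f z‖ₑ ^ p :=
              mul_le_mul' le_rfl (setLIntegral_mono' Metric.isOpen_ball.measurableSet (hpt y hy))
          _ ≤ (wvol Ω y)⁻¹ * ∫⁻ x in Metric.ball y (1 / 12 * bdist Ω y),
              A * ENNReal.ofReal (bdist Ω y ^ a) * (wvol Ω y)⁻¹ *
              ∫⁻ z in Metric.ball y (1 / 12 * bdist Ω y), ‖f x - f z‖ₑ ^ p :=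
              mul_le_mul' le_rfl (lintegral_mono_set (Metric.ball_subset_ball (by linarith)))
          _ = (wvol Ω y)⁻¹ * (A * ENNReal.ofReal (bdist Ω y ^ a) * (wvol Ω y)⁻¹ *
              ∫⁻ x in Metric.ball y (1 / 12 * bdist Ω y),
              ∫⁻ z in Metric.ball y (1 / 12 * bdist Ω y), ‖f x - f z‖ₑ ^ p) := by
              rw [lintegral_const_mul _ hm2]
          _ ≤ (wvol Ω y)⁻¹ * (A * ENNReal.ofReal (bdist Ω y ^ a) * (wvol Ω y)⁻¹ *
              (C₀ * wvol Ω y * ∫⁻ z in Metric.ball y (1 / 3 * bdist Ω y), g z)) :=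
              mul_le_mul' le_rfl (mul_le_mul' le_rfl (hosc y hy))
          _ = ((wvol Ω y)⁻¹ * wvol Ω y) * (A * C₀ * (ENNReal.ofReal (bdist Ω y ^ a) *
              ((wvol Ω y)⁻¹ * ∫⁻ z in Metric.ball y (1 / 3 * bdist Ω y), g z))) := by ring
          _ = _ := by rw [hWi, one_mul]
    _ = N * (C1 * (A * C₀ * ∫⁻ y in Ω, ENNReal.ofReal (bdist Ω y ^ a) *
          ((wvol Ω y)⁻¹ * ∫⁻ z in Metric.ball y (1 / 3 * bdist Ω y), g z))) := by
        rw [lintegral_const_mul' _ _ (by finiteness)]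
    _ ≤ N * (C1 * (A * C₀ * (C2 * ∫⁻ y in Ω, ENNReal.ofReal (bdist Ω y ^ a) * g y))) :=
        mul_le_mul' le_rfl (mul_le_mul' le_rfl (mul_le_mul' le_rfl (h2 g hg)))
    _ = _ := by ring

end SmoothingEstimates

section PoincareStep

variable {n : ℕ} {Ω : Set (Evec n)}

lemma wIp_eq {p : ℝ} (hp : 0 ≤ p) (S : Set (Evec n)) (a : ℝ) (g : Evec n → ℝ) :
    wIp Ω S p a g = ∫⁻ x in S, ENNReal.ofReal (bdist Ω x ^ a) * ‖g x‖ₑ ^ p := by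
  refine lintegral_congr fun x => ?_
  rw [mul_comm, ENNReal.ofReal_mul (Real.rpow_nonneg (bdist_nonneg x) a),
    Real.enorm_eq_ofReal_abs, ENNReal.ofReal_rpow_of_nonneg (abs_nonneg _) hp]

lemma measurable_smoothing {f : Evec n → ℝ} (hf : Measurable f) : Measurable (smoothing Ω f) := by
  have h : Measurable (molBump n : Evec n → ℝ) := (molBump n).continuous.measurable
  have key : ∀ f : Evec n → ℝ, Measurable f → Measurable (smth Ω f) := by
    intro f hf
    have : Measurable (Function.uncurry fun x y : Evec n => sker Ω x y * f y) := by
      unfold Function.uncurry sker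
      fun_prop
    exact (this.stronglyMeasurable.integral_prod_right (ν := volume.restrict Ω)).measurable
  exact (key f hf).div (key _ measurable_const)

lemma exists_bdist_le (hΩ : IsBoundedDomain Ω) : ∃ R : ℝ, 0 < R ∧ ∀ x ∈ Ω, bdist Ω x ≤ R := by
  obtain ⟨R, hR⟩ := hΩ.2.2.isCompact_closure.bddAbove_image (continuous_bdist (Ω := Ω)).continuousOn
  exact ⟨max R 1, by positivity,
    fun x hx => (hR (mem_image_of_mem _ (subset_closure hx))).trans (le_max_left _ _)⟩

lemma lintegral_weight_ne_top (hΩ : IsBoundedDomain Ω) {a : ℝ} (ha : 0 ≤ a) :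
    ∫⁻ x in Ω, ENNReal.ofReal (bdist Ω x ^ a) ≠ ⊤ := by
  obtain ⟨R, hR0, hR⟩ := exists_bdist_le hΩ
  refine ne_top_of_le_ne_top (b := ∫⁻ _ in Ω, ENNReal.ofReal (R ^ a)) ?_
    (setLIntegral_mono' hΩ.1.measurableSet fun x hx => ENNReal.ofReal_le_ofReal
      (Real.rpow_le_rpow (bdist_nonneg x) (hR x hx) ha))
  rw [setLIntegral_const]
  have := hΩ.2.2.measure_lt_top (μ := volume)
  finiteness

lemma lintegral_weight_ne_zero [NeZero n] (hΩ : IsBoundedDomain Ω) {Q : Set (Evec n)}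
    (hQΩ : Q ⊆ Ω) (hQ0 : volume Q ≠ 0) (a : ℝ) : ∫⁻ x in Q, ENNReal.ofReal (bdist Ω x ^ a) ≠ 0 := by
  rw [← pos_iff_ne_zero, setLIntegral_pos_iff (by fun_prop), inter_eq_right.2, pos_iff_ne_zero]
  · exact hQ0
  · intro x hx
    exact (ENNReal.ofReal_pos.2 (Real.rpow_pos_of_pos (bdist_pos hΩ (hQΩ hx)) a)).ne'

lemma rpow_add_three_le (x y z : ℝ≥0∞) {p : ℝ} (hp : 1 < p) :
    (x + y + z) ^ p ≤ (2 ^ (p - 1) * 2 ^ (p - 1)) * (x ^ p + y ^ p + z ^ p) := by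
  have hT : (1 : ℝ≥0∞) ≤ 2 ^ (p - 1) := ENNReal.one_le_rpow (by norm_num) (by linarith)
  calc (x + y + z) ^ p ≤ 2 ^ (p - 1) * ((x + y) ^ p + z ^ p) :=
        ENNReal.rpow_add_le_mul_rpow_add_rpow _ _ hp.le
    _ ≤ 2 ^ (p - 1) * (2 ^ (p - 1) * (x ^ p + y ^ p) + 2 ^ (p - 1) * z ^ p) :=
        mul_le_mul' le_rfl (add_le_add (ENNReal.rpow_add_le_mul_rpow_add_rpow _ _ hp.le)
          (le_mul_of_one_le_left' hT))
    _ = _ := by ring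

lemma weighted_rpow_le {w F A B D : ℝ≥0∞} {p : ℝ} (hp : 1 < p) (h : F ≤ A + B + D) :
    w * F ^ p ≤ (2 ^ (p - 1) * 2 ^ (p - 1)) * (w * A ^ p + w * B ^ p + w * D ^ p) := by
  calc w * F ^ p ≤ w * ((2 ^ (p - 1) * 2 ^ (p - 1)) * (A ^ p + B ^ p + D ^ p)) :=
        mul_le_mul' le_rfl ((ENNReal.rpow_le_rpow h (by linarith)).trans (rpow_add_three_le _ _ _ hp))
    _ = _ := by ring

/-- Weighted control of `f` by its smoothing, the Poincaré inequality and the values on `Q`. -/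
lemma poincare_step [NeZero n] (hΩ : IsBoundedDomain Ω) {Q : Set (Evec n)} {p a b : ℝ} (hp : 1 < p)
    (ha : 0 ≤ a) (hP : PoincareIneq Ω p a b) (hQΩ : Q ⊆ Ω) (hQ0 : volume Q ≠ 0)
    {C₀ : ℝ≥0∞} (hC₀ : C₀ ≠ ⊤) : ∃ C : ℝ≥0∞, C ≠ ⊤ ∧ ∀ (f : Evec n → ℝ) (g : Evec n → ℝ≥0∞),
      Measurable f → Measurable g →
      (∀ x ∈ Ω, IntegrableOn f (Metric.ball x (1 / 30 * bdist Ω x))) → OscBound Ω p C₀ f g →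
      ∫⁻ x in Ω, ENNReal.ofReal (bdist Ω x ^ a) * ‖f x‖ₑ ^ p < ⊤ →
      ∫⁻ x in Ω, ENNReal.ofReal (bdist Ω x ^ a) * g x < ⊤ →
      ∫⁻ x in Ω, ENNReal.ofReal (bdist Ω x ^ (b - p)) * g x < ⊤ →
      ∫⁻ x in Ω, ENNReal.ofReal (bdist Ω x ^ a) * ‖f x‖ₑ ^ p ≤
        C * ((∫⁻ x in Ω, ENNReal.ofReal (bdist Ω x ^ a) * g x) +
          (∫⁻ x in Ω, ENNReal.ofReal (bdist Ω x ^ (b - p)) * g x) +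
          ∫⁻ x in Q, ENNReal.ofReal (bdist Ω x ^ a) * ‖f x‖ₑ ^ p) := by
  obtain ⟨C1, hC1, h1⟩ := sub_smoothing_energy_le hΩ hp a hC₀
  obtain ⟨C2, hC2, h2⟩ := fderiv_smoothing_energy_le hΩ hp b hC₀
  obtain ⟨CP, -, hPoin⟩ := hP
  have hp0 : 0 ≤ p := by linarith
  have hmΩ := hΩ.1.measurableSet
  set K : ℝ≥0∞ := 2 ^ (p - 1) * 2 ^ (p - 1) with hK
  have hTt : (2 : ℝ≥0∞) ^ (p - 1) ≠ ⊤ := ENNReal.rpow_ne_top_of_nonneg (by linarith) (by norm_num)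
  have hKt : K ≠ ⊤ := by finiteness
  set I := ∫⁻ x in Ω, ENNReal.ofReal (bdist Ω x ^ a) with hI
  set J := ∫⁻ x in Q, ENNReal.ofReal (bdist Ω x ^ a) with hJ
  have hIt : I ≠ ⊤ := lintegral_weight_ne_top hΩ ha
  have hJ0 : J ≠ 0 := lintegral_weight_ne_zero hΩ hQΩ hQ0 a
  have hJt : J ≠ ⊤ := ne_top_of_le_ne_top hIt (lintegral_mono_set hQΩ)
  refine ⟨K * ((1 + I * J⁻¹ * K) * (C1 + ENNReal.ofReal CP * C2 + 1)), by finiteness,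
    fun f g hf hg hfi hosc hfin hga hgb => ?_⟩
  set Ga := ∫⁻ x in Ω, ENNReal.ofReal (bdist Ω x ^ a) * g x with hGa
  set Gb := ∫⁻ x in Ω, ENNReal.ofReal (bdist Ω x ^ (b - p)) * g x with hGb
  set EQ := ∫⁻ x in Q, ENNReal.ofReal (bdist Ω x ^ a) * ‖f x‖ₑ ^ p with hEQ
  set u := smoothing Ω f with hu
  have hum : Measurable u := measurable_smoothing hf
  have hE1 := h1 f g hf hg hfi hosc
  have hE2' := h2 f g hf hg hfi hosc
  have hmem : MemW1 Ω p a b u := by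
    obtain ⟨_, _, hd⟩ := fderiv_smoothing_le n
    refine ⟨fun x hx => (hd Ω hΩ f hf x hx (hfi x hx)).1.differentiableWithinAt, ?_, ?_⟩
    · rw [wIp_eq hp0]
      calc ∫⁻ x in Ω, ENNReal.ofReal (bdist Ω x ^ a) * ‖u x‖ₑ ^ p
          ≤ ∫⁻ x in Ω, K * (ENNReal.ofReal (bdist Ω x ^ a) * ‖f x - u x‖ₑ ^ p +
              ENNReal.ofReal (bdist Ω x ^ a) * ‖f x‖ₑ ^ p +
              ENNReal.ofReal (bdist Ω x ^ a) * 0 ^ p) := by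
            refine lintegral_mono fun x => weighted_rpow_le hp ?_
            rw [add_zero, ← enorm_neg (f x - u x)]
            calc ‖u x‖ₑ = ‖-(f x - u x) + f x‖ₑ := by congr 1; ring
              _ ≤ _ := enorm_add_le _ _
        _ = K * ((∫⁻ x in Ω, ENNReal.ofReal (bdist Ω x ^ a) * ‖f x - u x‖ₑ ^ p) +
              ∫⁻ x in Ω, ENNReal.ofReal (bdist Ω x ^ a) * ‖f x‖ₑ ^ p) := by
            rw [ENNReal.zero_rpow_of_pos (by linarith)]
            simp only [mul_zero, add_zero]
            rw [lintegral_const_mul _ (by fun_prop), lintegral_add_left (by fun_prop)]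
        _ < ⊤ := by
            refine ENNReal.mul_lt_top hKt.lt_top (ENNReal.add_lt_top.2 ⟨hE1.trans_lt ?_, hfin⟩)
            exact ENNReal.mul_lt_top hC1.lt_top hga
    · rw [wIp_eq hp0]
      simp only [gradLen, enorm_norm]
      exact hE2'.trans_lt (ENNReal.mul_lt_top hC2.lt_top hgb)
  have hE2 := hPoin u hmem
  set m := wAvg Ω a u with hm
  rw [wIp_eq hp0, wIp_eq hp0] at hE2
  simp only [gradLen, enorm_norm] at hE2
  replace hE2 := hE2.trans (mul_le_mul' le_rfl hE2')
  set E1 := ∫⁻ x in Ω, ENNReal.ofReal (bdist Ω x ^ a) * ‖f x - u x‖ₑ ^ p with hE1d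
  set E2 := ∫⁻ x in Ω, ENNReal.ofReal (bdist Ω x ^ a) * ‖u x - m‖ₑ ^ p with hE2d
  have hmJ : ‖m‖ₑ ^ p * J ≤ K * (E1 + E2 + EQ) := by
    calc ‖m‖ₑ ^ p * J = ∫⁻ x in Q, ENNReal.ofReal (bdist Ω x ^ a) * ‖m‖ₑ ^ p := by
          rw [hJ, lintegral_mul_const _ (by fun_prop), mul_comm]
      _ ≤ ∫⁻ x in Q, K * (ENNReal.ofReal (bdist Ω x ^ a) * ‖f x - u x‖ₑ ^ p +
            ENNReal.ofReal (bdist Ω x ^ a) * ‖u x - m‖ₑ ^ p +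
            ENNReal.ofReal (bdist Ω x ^ a) * ‖f x‖ₑ ^ p) := by
          refine lintegral_mono fun x => weighted_rpow_le hp ?_
          rw [← enorm_neg (f x - u x), ← enorm_neg (u x - m)]
          calc ‖m‖ₑ = ‖-(f x - u x) + -(u x - m) + f x‖ₑ := by congr 1; ring
            _ ≤ _ := (enorm_add_le _ _).trans (add_le_add (enorm_add_le _ _) le_rfl)
      _ = K * ((∫⁻ x in Q, ENNReal.ofReal (bdist Ω x ^ a) * ‖f x - u x‖ₑ ^ p) +
            (∫⁻ x in Q, ENNReal.ofReal (bdist Ω x ^ a) * ‖u x - m‖ₑ ^ p) + EQ) := by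
          rw [lintegral_const_mul _ (by fun_prop), lintegral_add_left (by fun_prop),
            lintegral_add_left (by fun_prop)]
      _ ≤ _ := mul_le_mul' le_rfl (add_le_add (add_le_add (lintegral_mono_set hQΩ)
          (lintegral_mono_set hQΩ)) le_rfl)
  have hmI : ‖m‖ₑ ^ p * I ≤ I * J⁻¹ * K * (E1 + E2 + EQ) := by
    calc ‖m‖ₑ ^ p * I = I * J⁻¹ * (‖m‖ₑ ^ p * J) := by
          have : J⁻¹ * J = 1 := ENNReal.inv_mul_cancel hJ0 hJt
          calc ‖m‖ₑ ^ p * I = ‖m‖ₑ ^ p * I * (J⁻¹ * J) := by rw [this, mul_one]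
            _ = _ := by ring
      _ ≤ I * J⁻¹ * (K * (E1 + E2 + EQ)) := mul_le_mul' le_rfl hmJ
      _ = _ := by ring
  have hS : E1 + E2 + EQ ≤ (C1 + ENNReal.ofReal CP * C2 + 1) * (Ga + Gb + EQ) := by
    calc E1 + E2 + EQ ≤ C1 * Ga + ENNReal.ofReal CP * (C2 * Gb) + 1 * EQ :=
          add_le_add (add_le_add hE1 hE2) (one_mul EQ).ge
      _ = C1 * Ga + ENNReal.ofReal CP * C2 * Gb + 1 * EQ := by rw [mul_assoc]
      _ ≤ C1 * (Ga + Gb + EQ) + ENNReal.ofReal CP * C2 * (Ga + Gb + EQ) + 1 * (Ga + Gb + EQ) := by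
          gcongr
          · exact le_self_add.trans le_self_add
          · exact le_add_self.trans le_self_add
          · exact le_add_self
      _ = _ := by ring
  calc ∫⁻ x in Ω, ENNReal.ofReal (bdist Ω x ^ a) * ‖f x‖ₑ ^ p
      ≤ ∫⁻ x in Ω, K * (ENNReal.ofReal (bdist Ω x ^ a) * ‖f x - u x‖ₑ ^ p +
            ENNReal.ofReal (bdist Ω x ^ a) * ‖u x - m‖ₑ ^ p +
            ENNReal.ofReal (bdist Ω x ^ a) * ‖m‖ₑ ^ p) := by
        refine lintegral_mono fun x => weighted_rpow_le hp ?_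
        calc ‖f x‖ₑ = ‖(f x - u x) + (u x - m) + m‖ₑ := by congr 1; ring
          _ ≤ _ := (enorm_add_le _ _).trans (add_le_add (enorm_add_le _ _) le_rfl)
    _ = K * (E1 + E2 + ‖m‖ₑ ^ p * I) := by
        rw [lintegral_const_mul _ (by fun_prop), lintegral_add_left (by fun_prop),
          lintegral_add_left (by fun_prop), lintegral_mul_const _ (by fun_prop), mul_comm I]
    _ ≤ K * ((E1 + E2 + EQ) + I * J⁻¹ * K * (E1 + E2 + EQ)) :=
        mul_le_mul' le_rfl (add_le_add le_self_add hmI)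
    _ = K * ((1 + I * J⁻¹ * K) * (E1 + E2 + EQ)) := by ring
    _ ≤ K * ((1 + I * J⁻¹ * K) * ((C1 + ENNReal.ofReal CP * C2 + 1) * (Ga + Gb + EQ))) :=
        mul_le_mul' le_rfl (mul_le_mul' le_rfl hS)
    _ = _ := by ring

end PoincareStep

section WeightComparison

variable {n : ℕ} {Ω : Set (Evec n)}

lemma ofReal_weight_le {x y : Evec n} (hx : 0 < bdist Ω x) (hxy : dist x y ≤ 1 / 2 * bdist Ω x) (t : ℝ) :
    ENNReal.ofReal (bdist Ω x ^ t) ≤ ENNReal.ofReal (2 ^ |t|) * ENNReal.ofReal (bdist Ω y ^ t) ∧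
    ENNReal.ofReal (bdist Ω y ^ t) ≤ ENNReal.ofReal (2 ^ |t|) * ENNReal.ofReal (bdist Ω x ^ t) := by
  have e1 := bdist_le_add (Ω := Ω) x y
  have e2 := bdist_le_add (Ω := Ω) y x
  rw [dist_comm] at e2
  have hy : 0 < bdist Ω y := by linarith
  rw [← ENNReal.ofReal_mul (by positivity), ← ENNReal.ofReal_mul (by positivity)]
  exact ⟨ENNReal.ofReal_le_ofReal (rpow_le_of_comparable hy (by linarith) (by linarith)),
    ENNReal.ofReal_le_ofReal (rpow_le_of_comparable hx (by linarith) (by linarith))⟩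

lemma isTest_stdBump (n : ℕ) : IsTest (stdBump n : Evec n → ℝ) :=
  ⟨(stdBump n).contDiff, (stdBump n).hasCompactSupport⟩

/-- The Poincaré inequality forces `ρ ^ a ≤ C ρ ^ (b - p)`. -/
lemma weight_le_of_poincare [NeZero n] (hΩ : IsBoundedDomain Ω) {p a b : ℝ} (hp : 1 < p)
    (ha : 0 ≤ a) (hP : PoincareIneq Ω p a b) : ∃ C : ℝ≥0∞, C ≠ ⊤ ∧ ∀ x ∈ Ω,
      ENNReal.ofReal (bdist Ω x ^ a) ≤ C * ENNReal.ofReal (bdist Ω x ^ (b - p)) := by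
  obtain ⟨CP, -, hPoin⟩ := hP
  obtain ⟨M, hM0, hM⟩ := (isTest_stdBump n).fderiv.bdd
  have hp0 : 0 ≤ p := by linarith
  have hmΩ := hΩ.1.measurableSet
  set T : ℝ≥0∞ := 2 ^ (p - 1) with hT
  have hTt : T ≠ ⊤ := ENNReal.rpow_ne_top_of_nonneg (by linarith) (by norm_num)
  set β : ℝ≥0∞ := ENNReal.ofReal ((1 / 8) ^ n) with hβ
  have hβ0 : β ≠ 0 := (ENNReal.ofReal_pos.2 (by positivity)).ne'
  have hβt : β ≠ ⊤ := ENNReal.ofReal_ne_top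
  set A2 : ℝ≥0∞ := ENNReal.ofReal (2 ^ |a|) with hA2
  set B2 : ℝ≥0∞ := ENNReal.ofReal (2 ^ |b|) with hB2
  set Mp : ℝ≥0∞ := ENNReal.ofReal (2 * M) ^ p with hMp
  have hMpt : Mp ≠ ⊤ := ENNReal.rpow_ne_top_of_nonneg hp0 ENNReal.ofReal_ne_top
  refine ⟨β⁻¹ * (T * 2 * A2 * (ENNReal.ofReal CP * (B2 * Mp))), by finiteness, fun x hx => ?_⟩
  have h0 := bdist_pos hΩ hx
  have hW0 := wvol_ne_zero hΩ hx
  have hWt := wvol_ne_top (Ω := Ω) x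
  set u : Evec n → ℝ := fun y => stdBump n ((2 * (bdist Ω x)⁻¹) • (y - x)) with hu
  have hud : ∀ y, HasFDerivAt u ((2 * (bdist Ω x)⁻¹) •
      fderiv ℝ (stdBump n) ((2 * (bdist Ω x)⁻¹) • (y - x))) y := by
    intro y
    have h1 : HasFDerivAt (fun y : Evec n => (2 * (bdist Ω x)⁻¹) • (y - x))
        ((2 * (bdist Ω x)⁻¹) • ContinuousLinearMap.id ℝ (Evec n)) y :=
      HasFDerivAt.fun_const_smul ((hasFDerivAt_id y).sub_const x) (2 * (bdist Ω x)⁻¹)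
    refine (((isTest_stdBump n).differentiable ((2 * (bdist Ω x)⁻¹) • (y - x))).hasFDerivAt.comp y
      h1).congr_fderiv ?_
    ext z
    simp
  have hgl : ∀ y, ‖fderiv ℝ u y‖ₑ ≤ ENNReal.ofReal (2 * M) * ENNReal.ofReal (bdist Ω x)⁻¹ := by
    intro y
    rw [(hud y).fderiv, ← ofReal_norm, ← ENNReal.ofReal_mul (by positivity), norm_smul,
      Real.norm_of_nonneg (by positivity)]
    refine ENNReal.ofReal_le_ofReal ?_
    calc 2 * (bdist Ω x)⁻¹ * _ ≤ 2 * (bdist Ω x)⁻¹ * M :=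
          mul_le_mul_of_nonneg_left (hM _) (by positivity)
      _ = _ := by ring
  have hfar : ∀ y, 1 / 4 * bdist Ω x ≤ dist y x → u y = 0 := by
    intro y hy
    refine (stdBump n).zero_of_le_dist ?_
    rw [dist_zero_right, norm_smul, Real.norm_of_nonneg (by positivity), ← dist_eq_norm]
    change 1 / 2 ≤ _
    rw [mul_assoc, inv_mul_eq_div]
    have : 1 / 4 ≤ dist y x / bdist Ω x := by rwa [le_div_iff₀ h0]
    linarith
  have hnear : ∀ y, dist y x ≤ 1 / 8 * bdist Ω x → u y = 1 := by
    intro y hy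
    refine (stdBump n).one_of_mem_closedBall ?_
    rw [Metric.mem_closedBall, dist_zero_right, norm_smul, Real.norm_of_nonneg (by positivity),
      ← dist_eq_norm]
    change _ ≤ 1 / 4
    rw [mul_assoc, inv_mul_eq_div]
    have : dist y x / bdist Ω x ≤ 1 / 8 := by rwa [div_le_iff₀ h0]
    linarith
  have hgfar : ∀ y, y ∉ Metric.ball x (1 / 2 * bdist Ω x) → fderiv ℝ u y = 0 := by
    intro y hy
    rw [Metric.mem_ball, not_lt] at hy
    have : u =ᶠ[𝓝 y] fun _ => 0 := by
      have ho : IsOpen {z : Evec n | 1 / 4 * bdist Ω x < dist z x} :=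
        isOpen_lt continuous_const (by fun_prop)
      have hyo : y ∈ {z : Evec n | 1 / 4 * bdist Ω x < dist z x} := by
        change 1 / 4 * bdist Ω x < dist y x
        linarith
      filter_upwards [ho.mem_nhds hyo] with z hz using hfar z (le_of_lt hz)
    rw [this.fderiv_eq]
    simp
  have hR : ∫⁻ y in Ω, ENNReal.ofReal (bdist Ω y ^ b) * ‖fderiv ℝ u y‖ₑ ^ p ≤
      B2 * Mp * ENNReal.ofReal (bdist Ω x ^ (b - p)) * wvol Ω x := by
    calc ∫⁻ y in Ω, ENNReal.ofReal (bdist Ω y ^ b) * ‖fderiv ℝ u y‖ₑ ^ p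
        ≤ ∫⁻ y in Metric.ball x (1 / 2 * bdist Ω x), B2 * ENNReal.ofReal (bdist Ω x ^ b) *
            (ENNReal.ofReal (2 * M) * ENNReal.ofReal (bdist Ω x)⁻¹) ^ p := by
          refine setLIntegral_le_ball Metric.isOpen_ball.measurableSet (fun y _ hy => ?_)
            (fun y hy => ?_) hmΩ
          · rw [← ofReal_norm, hgfar y hy, norm_zero, ENNReal.ofReal_zero,
              ENNReal.zero_rpow_of_pos (by linarith), mul_zero]
          · rw [Metric.mem_ball, dist_comm] at hy
            exact mul_le_mul' (ofReal_weight_le h0 hy.le b).2 (ENNReal.rpow_le_rpow (hgl y) hp0)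
      _ = B2 * ENNReal.ofReal (bdist Ω x ^ b) *
            (ENNReal.ofReal (2 * M) * ENNReal.ofReal (bdist Ω x)⁻¹) ^ p *
            volume (Metric.ball x (1 / 2 * bdist Ω x)) := setLIntegral_const _ _
      _ ≤ B2 * ENNReal.ofReal (bdist Ω x ^ b) *
            (ENNReal.ofReal (2 * M) * ENNReal.ofReal (bdist Ω x)⁻¹) ^ p * wvol Ω x :=
          mul_le_mul' le_rfl (volume_ball_le_wvol x (by norm_num))
      _ = B2 * Mp * (ENNReal.ofReal (bdist Ω x ^ b) * ENNReal.ofReal ((bdist Ω x)⁻¹ ^ p)) * wvol Ω x := by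
          rw [ENNReal.mul_rpow_of_nonneg _ _ hp0, ENNReal.ofReal_rpow_of_pos (inv_pos.2 h0)]
          ring
      _ = _ := by
          rw [← ENNReal.ofReal_mul (by positivity), Real.inv_rpow h0.le, ← Real.rpow_neg h0.le,
            ← Real.rpow_add h0, ← sub_eq_add_neg]
  have hmem : MemW1 Ω p a b u := by
    refine ⟨fun y _ => (hud y).differentiableAt.differentiableWithinAt, ?_, ?_⟩
    · rw [wIp_eq hp0]
      refine lt_of_le_of_lt (lintegral_mono fun y => ?_) (lintegral_weight_ne_top hΩ ha).lt_top
      refine mul_le_of_le_one_right' (ENNReal.rpow_le_one ?_ hp0)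
      rw [Real.enorm_of_nonneg (stdBump n).nonneg, ← ENNReal.ofReal_one]
      exact ENNReal.ofReal_le_ofReal (stdBump n).le_one
    · rw [wIp_eq hp0]
      simp only [gradLen, enorm_norm]
      exact hR.trans_lt (by finiteness)
  have hL := hPoin u hmem
  set m := wAvg Ω a u with hm
  rw [wIp_eq hp0, wIp_eq hp0] at hL
  simp only [gradLen, enorm_norm] at hL
  replace hL := hL.trans (mul_le_mul' le_rfl hR)
  set L := ∫⁻ y in Ω, ENNReal.ofReal (bdist Ω y ^ a) * ‖u y - m‖ₑ ^ p with hLd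
  have hlow : ∀ (z : Evec n) (c : ℝ), Metric.ball z (1 / 8 * bdist Ω x) ⊆
      Metric.ball x (1 / 2 * bdist Ω x) → (∀ y ∈ Metric.ball z (1 / 8 * bdist Ω x), u y = c) →
      β * wvol Ω x * ENNReal.ofReal (bdist Ω x ^ a) * ‖c - m‖ₑ ^ p ≤ A2 * L := by
    intro z c hsub hc
    have hvol : volume (Metric.ball z (1 / 8 * bdist Ω x)) = β * wvol Ω x := by
      rw [volume_ball_mul _ (by norm_num), wvol, Measure.addHaar_ball_center _ z,
        Measure.addHaar_ball_center _ x]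
    calc β * wvol Ω x * ENNReal.ofReal (bdist Ω x ^ a) * ‖c - m‖ₑ ^ p
        = ∫⁻ y in Metric.ball z (1 / 8 * bdist Ω x), ENNReal.ofReal (bdist Ω x ^ a) * ‖c - m‖ₑ ^ p := by
          rw [setLIntegral_const, hvol]
          ring
      _ ≤ ∫⁻ y in Metric.ball z (1 / 8 * bdist Ω x),
            A2 * (ENNReal.ofReal (bdist Ω y ^ a) * ‖u y - m‖ₑ ^ p) := by
          refine setLIntegral_mono' Metric.isOpen_ball.measurableSet fun y hy => ?_
          have hyx := hsub hy
          rw [Metric.mem_ball, dist_comm] at hyx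
          rw [hc y hy, ← mul_assoc]
          exact mul_le_mul' (ofReal_weight_le h0 hyx.le a).1 le_rfl
      _ = A2 * ∫⁻ y in Metric.ball z (1 / 8 * bdist Ω x),
            ENNReal.ofReal (bdist Ω y ^ a) * ‖u y - m‖ₑ ^ p :=
          lintegral_const_mul' _ _ ENNReal.ofReal_ne_top
      _ ≤ A2 * L := mul_le_mul' le_rfl (lintegral_mono_set (hsub.trans
          ((Metric.ball_subset_ball (by linarith)).trans (ball_bdist_subset hΩ hx))))
  have hlow1 := hlow x 1 (Metric.ball_subset_ball (by linarith)) fun y hy =>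
    hnear y (le_of_lt hy)
  set e : Evec n := EuclideanSpace.single 0 (3 / 8 * bdist Ω x) with he
  have hen : ‖e‖ = 3 / 8 * bdist Ω x := by
    rw [he, PiLp.norm_single, Real.norm_of_nonneg (by positivity)]
  have hdx : dist (x + e) x = 3 / 8 * bdist Ω x := by rw [dist_eq_norm, add_sub_cancel_left, hen]
  have hlow0 := hlow (x + e) 0 (Metric.ball_subset_ball' (by linarith)) fun y hy => by
    refine hfar y ?_
    rw [Metric.mem_ball] at hy
    have := dist_triangle_left (x + e) x y
    linarith
  have hone : (1 : ℝ≥0∞) ≤ T * (‖1 - m‖ₑ ^ p + ‖0 - m‖ₑ ^ p) := by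
    calc (1 : ℝ≥0∞) = ‖(1 : ℝ)‖ₑ ^ p := by simp
      _ = ‖(1 - m) - (0 - m)‖ₑ ^ p := by congr 2; ring
      _ ≤ (‖1 - m‖ₑ + ‖0 - m‖ₑ) ^ p := ENNReal.rpow_le_rpow enorm_sub_le hp0
      _ ≤ _ := ENNReal.rpow_add_le_mul_rpow_add_rpow _ _ hp.le
  have hWi : (wvol Ω x)⁻¹ * wvol Ω x = 1 := ENNReal.inv_mul_cancel hW0 hWt
  have hβi : β⁻¹ * β = 1 := ENNReal.inv_mul_cancel hβ0 hβt
  calc ENNReal.ofReal (bdist Ω x ^ a)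
      ≤ ENNReal.ofReal (bdist Ω x ^ a) * (T * (‖1 - m‖ₑ ^ p + ‖0 - m‖ₑ ^ p)) := le_mul_of_one_le_right' hone
    _ = (β⁻¹ * β) * ((wvol Ω x)⁻¹ * wvol Ω x) *
          (ENNReal.ofReal (bdist Ω x ^ a) * (T * (‖1 - m‖ₑ ^ p + ‖0 - m‖ₑ ^ p))) := by
        rw [hWi, hβi, one_mul, one_mul]
    _ = β⁻¹ * (wvol Ω x)⁻¹ * T * (β * wvol Ω x * ENNReal.ofReal (bdist Ω x ^ a) * ‖1 - m‖ₑ ^ p +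
          β * wvol Ω x * ENNReal.ofReal (bdist Ω x ^ a) * ‖0 - m‖ₑ ^ p) := by ring
    _ ≤ β⁻¹ * (wvol Ω x)⁻¹ * T * (A2 * L + A2 * L) := mul_le_mul' le_rfl (add_le_add hlow1 hlow0)
    _ = β⁻¹ * (wvol Ω x)⁻¹ * T * 2 * A2 * L := by ring
    _ ≤ β⁻¹ * (wvol Ω x)⁻¹ * T * 2 * A2 * (ENNReal.ofReal CP *
          (B2 * Mp * ENNReal.ofReal (bdist Ω x ^ (b - p)) * wvol Ω x)) := mul_le_mul' le_rfl hL
    _ = β⁻¹ * (T * 2 * A2 * (ENNReal.ofReal CP * (B2 * Mp))) * ENNReal.ofReal (bdist Ω x ^ (b - p)) *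
          ((wvol Ω x)⁻¹ * wvol Ω x) := by ring
    _ = _ := by rw [hWi, mul_one]

end WeightComparison

section KornAssembly

variable {n : ℕ} {Ω : Set (Evec n)}

lemma abs_le_sqrt_sum_sum_sq (A : Fin n → Fin n → ℝ) (i j : Fin n) :
    |A i j| ≤ Real.sqrt (∑ i, ∑ j, A i j ^ 2) := by
  refine Real.abs_le_sqrt ?_
  have h1 : A i j ^ 2 ≤ ∑ j, A i j ^ 2 :=
    Finset.single_le_sum (f := fun j => A i j ^ 2) (fun j _ => sq_nonneg _) (Finset.mem_univ j)
  exact h1.trans (Finset.single_le_sum (f := fun i => ∑ j, A i j ^ 2)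
    (fun i _ => Finset.sum_nonneg fun j _ => sq_nonneg _) (Finset.mem_univ i))

lemma DvLen_nonneg (v : Evec n → Evec n) (x : Evec n) : 0 ≤ DvLen v x := Real.sqrt_nonneg _

lemma epsLen_nonneg (v : Evec n → Evec n) (x : Evec n) : 0 ≤ epsLen v x := Real.sqrt_nonneg _

lemma enorm_pder_le (v : Evec n → Evec n) (i j : Fin n) (x : Evec n) :
    ‖pder v i j x‖ₑ ≤ ‖DvLen v x‖ₑ := by
  rw [Real.enorm_eq_ofReal_abs, Real.enorm_of_nonneg (DvLen_nonneg v x)]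
  exact ENNReal.ofReal_le_ofReal (abs_le_sqrt_sum_sum_sq (fun i j => pder v i j x) i j)

lemma enorm_eps_le (v : Evec n → Evec n) (i j : Fin n) (x : Evec n) :
    ‖eps v i j x‖ₑ ≤ ‖epsLen v x‖ₑ := by
  rw [Real.enorm_eq_ofReal_abs, Real.enorm_of_nonneg (epsLen_nonneg v x)]
  exact ENNReal.ofReal_le_ofReal (abs_le_sqrt_sum_sum_sq (fun i j => eps v i j x) i j)

lemma sqrt_sum_sum_sq_le (A : Fin n → Fin n → ℝ) :
    Real.sqrt (∑ i, ∑ j, A i j ^ 2) ≤ ∑ i, ∑ j, |A i j| := by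
  have key : ∀ f : Fin n → ℝ, (∀ i, 0 ≤ f i) → ∑ i, f i ^ 2 ≤ (∑ i, f i) ^ 2 := fun f hf =>
    Finset.sum_sq_le_sq_sum_of_nonneg fun i _ => hf i
  have h0 : ∀ i, 0 ≤ ∑ j, |A i j| := fun i => Finset.sum_nonneg fun j _ => abs_nonneg _
  refine Real.sqrt_le_left (Finset.sum_nonneg fun i _ => h0 i) |>.2 ?_
  refine le_trans (Finset.sum_le_sum fun i _ => ?_) (key _ h0)
  have := key (fun j => |A i j|) fun j => abs_nonneg _
  simpa only [sq_abs] using this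

lemma enorm_DvLen_le (v : Evec n → Evec n) (x : Evec n) :
    ‖DvLen v x‖ₑ ≤ ∑ i, ∑ j, ‖pder v i j x‖ₑ := by
  rw [Real.enorm_of_nonneg (DvLen_nonneg v x)]
  refine (ENNReal.ofReal_le_ofReal (sqrt_sum_sum_sq_le fun i j => pder v i j x)).trans_eq ?_
  rw [ENNReal.ofReal_sum_of_nonneg fun i _ => Finset.sum_nonneg fun j _ => abs_nonneg _]
  refine Finset.sum_congr rfl fun i _ => ?_
  rw [ENNReal.ofReal_sum_of_nonneg fun j _ => abs_nonneg _]
  exact Finset.sum_congr rfl fun j _ => (Real.enorm_eq_ofReal_abs _).symm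

/-- The density `∑ |ε_{ij}(v)|^p`. -/
def epsDens (p : ℝ) (v : Evec n → Evec n) (x : Evec n) : ℝ≥0∞ := ∑ a, ∑ b, ‖eps v a b x‖ₑ ^ p

lemma measurable_epsDens (p : ℝ) (v : Evec n → Evec n) : Measurable (epsDens p v) := by
  have := measurable_eps v
  unfold epsDens
  fun_prop

lemma lintegral_weight_epsDens_le {p : ℝ} (hp : 0 ≤ p) (t : ℝ) (v : Evec n → Evec n) :
    ∫⁻ x in Ω, ENNReal.ofReal (bdist Ω x ^ t) * epsDens p v x ≤
      ((n : ℝ≥0∞) * n) * wIp Ω Ω p t (epsLen v) := by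
  rw [wIp_eq hp, ← lintegral_const_mul' _ _ (by finiteness)]
  refine lintegral_mono fun x => ?_
  calc ENNReal.ofReal (bdist Ω x ^ t) * epsDens p v x
      ≤ ENNReal.ofReal (bdist Ω x ^ t) * ∑ _a : Fin n, ∑ _b : Fin n, ‖epsLen v x‖ₑ ^ p :=
        mul_le_mul' le_rfl (Finset.sum_le_sum fun a _ => Finset.sum_le_sum fun b _ =>
          ENNReal.rpow_le_rpow (enorm_eps_le v a b x) hp)
    _ = _ := by
        simp only [Finset.sum_const, Finset.card_univ, Fintype.card_fin, nsmul_eq_mul]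
        ring

lemma lintegral_weight_pder_le {p : ℝ} (hp : 0 ≤ p) (S : Set (Evec n)) (a : ℝ) (v : Evec n → Evec n)
    (i j : Fin n) :
    ∫⁻ x in S, ENNReal.ofReal (bdist Ω x ^ a) * ‖pder v i j x‖ₑ ^ p ≤ wIp Ω S p a (DvLen v) := by
  rw [wIp_eq hp]
  exact lintegral_mono fun x => mul_le_mul' le_rfl (ENNReal.rpow_le_rpow (enorm_pder_le v i j x) hp)

lemma wIp_DvLen_le {p : ℝ} (hp : 1 < p) (a : ℝ) (v : Evec n → Evec n) :
    wIp Ω Ω p a (DvLen v) ≤ (n : ℝ≥0∞) ^ (p - 1) * (n : ℝ≥0∞) ^ (p - 1) *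
      ∑ i, ∑ j, ∫⁻ x in Ω, ENNReal.ofReal (bdist Ω x ^ a) * ‖pder v i j x‖ₑ ^ p := by
  have hp0 : 0 ≤ p := by linarith
  have hm := measurable_pder v
  have hb := measurable_bdist (Ω := Ω)
  have hn : (n : ℝ≥0∞) ^ (p - 1) ≠ ⊤ :=
    ENNReal.rpow_ne_top_of_nonneg (by linarith) (ENNReal.natCast_ne_top n)
  have hsum : ∑ i, ∑ j, ∫⁻ x in Ω, ENNReal.ofReal (bdist Ω x ^ a) * ‖pder v i j x‖ₑ ^ p =
      ∫⁻ x in Ω, ∑ i, ∑ j, ENNReal.ofReal (bdist Ω x ^ a) * ‖pder v i j x‖ₑ ^ p := by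
    rw [lintegral_finsetSum _ (by fun_prop)]
    exact Finset.sum_congr rfl fun i _ => (lintegral_finsetSum _ (by fun_prop)).symm
  rw [wIp_eq hp0, hsum, ← lintegral_const_mul' _ _ (by finiteness)]
  refine lintegral_mono fun x => ?_
  have h1 := (ENNReal.rpow_le_rpow (enorm_DvLen_le v x) hp0).trans
    (rpow_sum_sum_le (fun i j => ‖pder v i j x‖ₑ) hp)
  rw [Fintype.card_fin] at h1
  refine (mul_le_mul' le_rfl h1).trans_eq ?_
  simp only [← Finset.mul_sum]
  ring

lemma closedBall_half_bdist_subset [NeZero n] (hΩ : IsBoundedDomain Ω) {x : Evec n} (hx : x ∈ Ω) :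
    Metric.closedBall x (1 / 2 * bdist Ω x) ⊆ Ω :=
  (Metric.closedBall_subset_ball (by linarith [bdist_pos hΩ hx])).trans (ball_bdist_subset hΩ hx)

lemma lintegral_closedBall_pder_lt_top [NeZero n] (hΩ : IsBoundedDomain Ω) {p a : ℝ} (hp : 1 < p)
    {v : Evec n → Evec n} (hv : wIp Ω Ω p a (DvLen v) < ⊤) {x : Evec n} (hx : x ∈ Ω) (i j : Fin n) :
    ∫⁻ y in Metric.closedBall x (1 / 2 * bdist Ω x), ‖pder v i j y‖ₑ ^ p < ⊤ := by
  have h0 := bdist_pos hΩ hx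
  have hw0 : ENNReal.ofReal (bdist Ω x ^ a) ≠ 0 :=
    (ENNReal.ofReal_pos.2 (Real.rpow_pos_of_pos h0 a)).ne'
  have hle : ENNReal.ofReal (bdist Ω x ^ a) *
      ∫⁻ y in Metric.closedBall x (1 / 2 * bdist Ω x), ‖pder v i j y‖ₑ ^ p < ⊤ := by
    rw [← lintegral_const_mul' _ _ ENNReal.ofReal_ne_top]
    calc ∫⁻ y in Metric.closedBall x (1 / 2 * bdist Ω x),
          ENNReal.ofReal (bdist Ω x ^ a) * ‖pder v i j y‖ₑ ^ p
        ≤ ∫⁻ y in Metric.closedBall x (1 / 2 * bdist Ω x), ENNReal.ofReal (2 ^ |a|) *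
            (ENNReal.ofReal (bdist Ω y ^ a) * ‖pder v i j y‖ₑ ^ p) := by
          refine setLIntegral_mono' Metric.isClosed_closedBall.measurableSet fun y hy => ?_
          rw [Metric.mem_closedBall, dist_comm] at hy
          rw [← mul_assoc]
          exact mul_le_mul' (ofReal_weight_le h0 hy a).1 le_rfl
      _ = ENNReal.ofReal (2 ^ |a|) * ∫⁻ y in Metric.closedBall x (1 / 2 * bdist Ω x),
            ENNReal.ofReal (bdist Ω y ^ a) * ‖pder v i j y‖ₑ ^ p :=
          lintegral_const_mul' _ _ ENNReal.ofReal_ne_top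
      _ ≤ ENNReal.ofReal (2 ^ |a|) * wIp Ω Ω p a (DvLen v) :=
          mul_le_mul' le_rfl ((lintegral_mono_set (closedBall_half_bdist_subset hΩ hx)).trans
            (lintegral_weight_pder_le (by linarith) Ω a v i j))
      _ < ⊤ := by finiteness
  exact (ENNReal.lt_top_of_mul_ne_top_right hle.ne hw0)

lemma integrableOn_ball_pder [NeZero n] (hΩ : IsBoundedDomain Ω) {p a : ℝ} (hp : 1 < p)
    {v : Evec n → Evec n} (hv : wIp Ω Ω p a (DvLen v) < ⊤) {x : Evec n} (hx : x ∈ Ω) (i j : Fin n) :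
    IntegrableOn (pder v i j) (Metric.ball x (1 / 30 * bdist Ω x)) :=
  (integrableOn_of_lintegral_rpow (measurable_pder v i j) hp
    measure_closedBall_lt_top.ne (lintegral_closedBall_pder_lt_top hΩ hp hv hx i j)).mono_set
    ((Metric.ball_subset_ball (by linarith [bdist_pos hΩ hx])).trans Metric.ball_subset_closedBall)

/-- The local Korn inequality bounds the oscillation of each entry of `Dv`. -/
lemma oscBound_pder [NeZero n] (hΩ : IsBoundedDomain Ω) {p a : ℝ} (hp : 1 < p) :
    ∃ C : ℝ≥0∞, C ≠ ⊤ ∧ ∀ v : Evec n → Evec n, DifferentiableOn ℝ v Ω →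
      wIp Ω Ω p a (DvLen v) < ⊤ → ∀ i j, OscBound Ω p C (pder v i j) (epsDens p v) := by
  obtain ⟨C, hC, h⟩ := local_korn (n := n) hp
  refine ⟨C, hC, fun v hv hvt i j x hx => ?_⟩
  have h0 := bdist_pos hΩ hx
  have h3 : 3 * (1 / 6 * bdist Ω x) = 1 / 2 * bdist Ω x := by ring
  have h2 : 2 * (1 / 6 * bdist Ω x) = 1 / 3 * bdist Ω x := by ring
  have h1 : 1 / 6 * bdist Ω x / 2 = 1 / 12 * bdist Ω x := by ring
  have hk := h Ω hΩ.1 v hv x (1 / 6 * bdist Ω x) (by positivity)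
  rw [h3, h2, h1] at hk
  have hme := measurable_eps v
  have hsum : ∑ a, ∑ b, ∫⁻ y in Metric.ball x (1 / 3 * bdist Ω x), ‖eps v a b y‖ₑ ^ p =
      ∫⁻ y in Metric.ball x (1 / 3 * bdist Ω x), epsDens p v y := by
    unfold epsDens
    rw [lintegral_finsetSum _ (by fun_prop)]
    exact Finset.sum_congr rfl fun i _ => (lintegral_finsetSum _ (by fun_prop)).symm
  rw [hsum] at hk
  refine (hk (closedBall_half_bdist_subset hΩ hx)
    (fun i j => lintegral_closedBall_pder_lt_top hΩ hp hvt hx i j) i j).trans ?_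
  exact mul_le_mul' (mul_le_mul' le_rfl (volume_ball_le_wvol x (by norm_num))) le_rfl

lemma IsClosedCube.volume_ne_zero {Q : Set (Evec n)} (hQ : IsClosedCube Q) : volume Q ≠ 0 := by
  obtain ⟨c, r, hr, rfl⟩ := hQ
  have hsub : Metric.ball c r ⊆ {x : Evec n | ∀ i, |x i - c i| ≤ r} := fun x hx i => by
    rw [Metric.mem_ball, dist_eq_norm] at hx
    exact (abs_coord_le_norm (x - c) i).trans hx.le
  exact (lt_of_lt_of_le (Metric.measure_ball_pos volume c hr) (measure_mono hsub)).ne'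

theorem weighted_korn [NeZero n] {Q : Set (Evec n)} {p a b : ℝ} (hΩ : IsBoundedDomain Ω)
    (hp : 1 < p) (ha : 0 ≤ a) (hP : PoincareIneq Ω p a b) (hQ0 : volume Q ≠ 0) (hQΩ : Q ⊆ Ω) :
    ∃ C : ℝ≥0∞, C ≠ ⊤ ∧ ∀ v : Evec n → Evec n, MemW1Vec Ω p a a v →
      wIp Ω Ω p (b - p) (epsLen v) ≠ ⊤ →
      wIp Ω Ω p a (DvLen v) ≤ C * (wIp Ω Ω p (b - p) (epsLen v) + wIp Ω Q p a (DvLen v)) := by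
  have hp0 : 0 ≤ p := by linarith
  obtain ⟨C₀, hC₀, hosc⟩ := oscBound_pder (a := a) hΩ hp
  obtain ⟨C₁, hC₁, hstep⟩ := poincare_step hΩ hp ha hP hQΩ hQ0 hC₀
  obtain ⟨C₂, hC₂, hwt⟩ := weight_le_of_poincare hΩ hp ha hP
  have hmΩ := hΩ.1.measurableSet
  set N : ℝ≥0∞ := (n : ℝ≥0∞) ^ (p - 1) * (n : ℝ≥0∞) ^ (p - 1) with hN
  have hNt : N ≠ ⊤ := by
    have : (n : ℝ≥0∞) ^ (p - 1) ≠ ⊤ :=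
      ENNReal.rpow_ne_top_of_nonneg (by linarith) (ENNReal.natCast_ne_top n)
    finiteness
  set M : ℝ≥0∞ := (n : ℝ≥0∞) * n with hM
  have hMt : M ≠ ⊤ := by finiteness
  refine ⟨N * (M * (C₁ * (C₂ * M + M + 1))), by finiteness, fun v hv hE => ?_⟩
  set E := wIp Ω Ω p (b - p) (epsLen v) with hEd
  set F := wIp Ω Q p a (DvLen v) with hFd
  have hGb : ∫⁻ x in Ω, ENNReal.ofReal (bdist Ω x ^ (b - p)) * epsDens p v x ≤ M * E :=
    lintegral_weight_epsDens_le hp0 _ v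
  have hGa : ∫⁻ x in Ω, ENNReal.ofReal (bdist Ω x ^ a) * epsDens p v x ≤ C₂ * (M * E) := by
    refine le_trans ?_ (mul_le_mul' le_rfl hGb)
    rw [← lintegral_const_mul' _ _ hC₂]
    refine setLIntegral_mono' hmΩ fun x hx => ?_
    rw [← mul_assoc]
    exact mul_le_mul' (hwt x hx) le_rfl
  have hij : ∀ i j, ∫⁻ x in Ω, ENNReal.ofReal (bdist Ω x ^ a) * ‖pder v i j x‖ₑ ^ p ≤
      C₁ * (C₂ * M + M + 1) * (E + F) := by
    intro i j
    refine (hstep (pder v i j) (epsDens p v) (measurable_pder v i j) (measurable_epsDens p v)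
      (fun x hx => integrableOn_ball_pder hΩ hp hv.2.2 hx i j) (hosc v hv.1 hv.2.2 i j)
      ((lintegral_weight_pder_le hp0 Ω a v i j).trans_lt hv.2.2)
      (hGa.trans_lt (by finiteness)) (hGb.trans_lt (by finiteness))).trans ?_
    rw [mul_assoc]
    refine mul_le_mul' le_rfl ?_
    calc _ ≤ C₂ * (M * E) + M * E + F :=
          add_le_add (add_le_add hGa hGb) (lintegral_weight_pder_le hp0 Q a v i j)
      _ = (C₂ * M + M) * E + 1 * F := by ring
      _ ≤ (C₂ * M + M + 1) * E + (C₂ * M + M + 1) * F :=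
          add_le_add (mul_le_mul' le_self_add le_rfl) (mul_le_mul' le_add_self le_rfl)
      _ = _ := by ring
  calc wIp Ω Ω p a (DvLen v) ≤ N * ∑ _i : Fin n, ∑ _j : Fin n, C₁ * (C₂ * M + M + 1) * (E + F) :=
        (wIp_DvLen_le hp a v).trans (mul_le_mul' le_rfl
          (Finset.sum_le_sum fun i _ => Finset.sum_le_sum fun j _ => hij i j))
    _ = _ := by
        simp only [Finset.sum_const, Finset.card_univ, Fintype.card_fin, nsmul_eq_mul]
        rw [hM]
        ring

end KornAssembly

/-- **Theorem 2.1.** If the weighted Poincaré inequality `(P_{p,a,b})` holds on a bounded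
domain `Ω ⊆ ℝⁿ`, `n ≥ 2`, `p > 1`, `a ≥ 0`, then for any fixed closed cube `Q ⊂⊂ Ω` there
is `C > 0` such that for every `v ∈ W^{1,p}(Ω,ρ^a)ⁿ`,
`∫_Ω |Dv|^p ρ^a ≤ C { ∫_Ω |ε(v)|^p ρ^{b-p} + ∫_Q |Dv|^p ρ^a }`. -/
theorem korn_from_poincare {n : ℕ} (hn : 2 ≤ n) (Ω Q : Set (Evec n)) (p a b : ℝ)
    (hΩ : IsBoundedDomain Ω) (hp : 1 < p) (ha : 0 ≤ a)
    (hP : PoincareIneq Ω p a b) (hQ : IsClosedCube Q) (hQΩ : Q ⊆ Ω) :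
    ∃ C > 0, ∀ v : Evec n → Evec n, MemW1Vec Ω p a a v →
      wIp Ω Ω p a (DvLen v) ≤
        ENNReal.ofReal C * (wIp Ω Ω p (b - p) (epsLen v) + wIp Ω Q p a (DvLen v)) := by
  have : NeZero n := ⟨by omega⟩
  obtain ⟨C, hC, h⟩ := weighted_korn hΩ hp ha hP hQ.volume_ne_zero hQΩ
  refine ⟨C.toReal + 1, by positivity, fun v hv => ?_⟩
  rcases eq_or_ne (wIp Ω Ω p (b - p) (epsLen v)) ⊤ with hE | hE
  · rw [hE, top_add, ENNReal.mul_top (ENNReal.ofReal_pos.2 (by positivity)).ne']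
    exact le_top
  · refine (h v hv hE).trans (mul_le_mul' ?_ le_rfl)
    calc C = ENNReal.ofReal C.toReal := (ENNReal.ofReal_toReal hC).symm
      _ ≤ _ := ENNReal.ofReal_le_ofReal (by linarith)
end
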